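/- arXiv:1401.0472 — 12 statements merged into one kernel-verified Lean document; each statement's English description precedes it below -/
import Mathlib

section
/- Let 𝔤 be a compact simple Lie algebra and let U be a 2-dimensional linear subspace of 𝔤. Then there exist a basis {U₁, U₂} of U and vectors Y₁, Y₂ ∈ 𝔤 such that [U₁, Y₁] = 0, [U₂, Y₂] = 0, [U₁, Y₂] ≠ 0, and [U₂, Y₁] ≠ 0. In other words, there is a basis {U₁, U₂} of U such that neither of the centralizers c_𝔤(U₁), c_𝔤(U₂) is contained in the other. -/
open Module.End in
/-- If `S` and `T` are commuting skew-adjoint operators on a Euclidean space, then every vector is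
a sum of vectors annihilated by a nontrivial linear combination of `S` and `T`. -/
theorem iSup_ker_smul_add_smul_eq_top {V : Type*} [NormedAddCommGroup V] [InnerProductSpace ℝ V]
    [FiniteDimensional ℝ V] (S T : V →ₗ[ℝ] V)
    (hS : ∀ x y, inner ℝ (S x) y = -inner ℝ x (S y))
    (hT : ∀ x y, inner ℝ (T x) y = -inner ℝ x (T y)) (hST : ∀ x, S (T x) = T (S x)) :
    ⨆ p : {p : ℝ × ℝ // p ≠ 0}, LinearMap.ker (p.1.1 • S + p.1.2 • T) = ⊤ := by
  have hA : (S * S).IsSymmetric := fun x y => by simp [hS]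
  have hB : (S * T).IsSymmetric := fun x y => by simp [hS, hT, hST]
  have hAB : Commute (S * S) (S * T) := by
    ext x
    simp [hST]
  rw [eq_top_iff, ← hA.iSup_iSup_eigenspace_inf_eigenspace_eq_top_of_commute hB hAB]
  refine iSup_le fun a => iSup_le fun b => fun v hv => ?_
  simp only [Submodule.mem_inf, mem_eigenspace_iff, Module.End.mul_apply] at hv
  obtain ⟨h₁, h₂⟩ := hv
  by_cases ha : a = 0
  · have hSv : S v = 0 := by
      have h := hS v (S v)
      rwa [h₁, ha, zero_smul, inner_zero_right, neg_zero, inner_self_eq_zero] at h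
    refine Submodule.mem_iSup_of_mem ⟨(1, 0), by simp⟩ ?_
    simp [hSv]
  · refine Submodule.mem_iSup_of_mem ⟨(-b, a), by simp [ha]⟩ ?_
    have h : b • S v = a • T v := by
      rw [← map_smul, ← h₂, hST, hST, h₁, map_smul]
    simp [h]

/-- The inner product given by the negative of a negative definite Killing form. -/
noncomputable abbrev negKillingFormCore (g : Type*) [LieRing g] [LieAlgebra ℝ g]
    (hg : ∀ x : g, x ≠ 0 → killingForm ℝ g x x < 0) : InnerProductSpace.Core ℝ g where
  inner x y := -killingForm ℝ g x y
  conj_inner_symm x y := by simp [LieModule.traceForm_comm ℝ g g y x]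
  re_inner_nonneg x := by
    rcases eq_or_ne x 0 with rfl | hx
    · simp
    · simpa using (hg x hx).le
  add_left x y z := by simp [add_comm]
  smul_left x y r := by simp
  definite x hx := by
    by_contra h
    exact (hg x h).ne (neg_eq_zero.mp hx)

/-- If the Killing form is negative definite and `A`, `B` commute, then the algebra is spanned by
the centralizers of the elements `a • A + b • B` with `(a, b) ≠ 0`. -/
theorem iSup_ker_ad_smul_add_smul_eq_top {g : Type*} [LieRing g] [LieAlgebra ℝ g]
    [FiniteDimensional ℝ g] (hg : ∀ x : g, x ≠ 0 → killingForm ℝ g x x < 0)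
    {A B : g} (hAB : ⁅A, B⁆ = 0) :
    ⨆ p : {p : ℝ × ℝ // p ≠ 0}, LinearMap.ker (LieAlgebra.ad ℝ g (p.1.1 • A + p.1.2 • B)) = ⊤ := by
  let core := negKillingFormCore g hg
  let : NormedAddCommGroup g := core.toNormedAddCommGroup
  let : InnerProductSpace ℝ g := InnerProductSpace.ofCore core.toCore
  have hskew (x y z : g) :
      inner ℝ (LieAlgebra.ad ℝ g x y) z = -inner ℝ y (LieAlgebra.ad ℝ g x z) :=
    congrArg Neg.neg (LieModule.traceForm_apply_lie_apply' ℝ g g x y z)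
  have h := iSup_ker_smul_add_smul_eq_top (LieAlgebra.ad ℝ g A) (LieAlgebra.ad ℝ g B)
    (hskew A) (hskew B) fun x => by
      simp only [LieAlgebra.ad_apply]
      rw [leibniz_lie A B x, hAB, zero_lie, zero_add]
  simpa only [map_add, map_smul] using h

/-- A nonempty chain of submodules of a Noetherian module attains its supremum. -/
theorem exists_eq_iSup_of_total {ι R M : Type*} [Nonempty ι] [Ring R] [AddCommGroup M]
    [Module R M] [IsNoetherian R M] (K : ι → Submodule R M) (hK : ∀ i j, K i ≤ K j ∨ K j ≤ K i) :
    ∃ i, K i = ⨆ j, K j := by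
  obtain ⟨_, ⟨i, rfl⟩, hi⟩ := (wellFounded_gt (α := Submodule R M)).has_min
    (Set.range K) (Set.range_nonempty K)
  refine ⟨i, le_antisymm (le_iSup K i) (iSup_le fun j => ?_)⟩
  rcases hK i j with h | h
  · exact (h.eq_or_lt.resolve_right (hi _ ⟨j, rfl⟩)).ge
  · exact h


/-- Let `𝔤` be a compact simple Lie algebra (the Killing form is negative
definite) and let `U` be a `2`-dimensional subspace of `𝔤`. Then there are a basis
`{U₁, U₂}` of `U` and vectors `Y₁, Y₂ ∈ 𝔤` with `⁅U₁, Y₁⁆ = 0`, `⁅U₂, Y₂⁆ = 0`,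
`⁅U₁, Y₂⁆ ≠ 0` and `⁅U₂, Y₁⁆ ≠ 0`; in particular neither of the centralizers
`c_𝔤(U₁)`, `c_𝔤(U₂)` is contained in the other. -/
theorem statement2 (g : Type*) [LieRing g] [LieAlgebra ℝ g] [FiniteDimensional ℝ g]
    [LieAlgebra.IsSimple ℝ g]
    (hcompact : ∀ x : g, x ≠ 0 → killingForm ℝ g x x < 0)
    (U : Submodule ℝ g) (hU : Module.finrank ℝ U = 2) :
    ∃ U₁ U₂ : g, U₁ ∈ U ∧ U₂ ∈ U ∧ LinearIndependent ℝ ![U₁, U₂] ∧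
      ∃ Y₁ Y₂ : g, ⁅U₁, Y₁⁆ = 0 ∧ ⁅U₂, Y₂⁆ = 0 ∧ ⁅U₁, Y₂⁆ ≠ 0 ∧ ⁅U₂, Y₁⁆ ≠ 0 := by
  by_contra! hcon
  let b := Module.finBasisOfFinrankEq ℝ U hU
  have hli : LinearIndependent ℝ ![(b 0 : g), (b 1 : g)] := by
    have hb : ![(b 0 : g), (b 1 : g)] = U.subtype ∘ b := by
      ext i
      fin_cases i <;> rfl
    exact hb ▸ b.linearIndependent.map' U.subtype U.ker_subtype
  obtain ⟨A, hA⟩ : ∃ A : g, A = b 0 := ⟨_, rfl⟩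
  obtain ⟨B, hB⟩ : ∃ B : g, B = b 1 := ⟨_, rfl⟩
  have hAU : A ∈ U := hA ▸ (b 0).2
  have hBU : B ∈ U := hB ▸ (b 1).2
  rw [← hA, ← hB] at hli
  have hAB : ⁅A, B⁆ = 0 := by
    by_contra h
    have h' := hcon A B hAU hBU hli A B (lie_self A) (lie_self B) h
    exact h (by rw [← lie_skew, h', neg_zero])
  have hchain (u v : g) (hu : u ∈ U) (hv : v ∈ U) (hu0 : u ≠ 0) :
      LinearMap.ker (LieAlgebra.ad ℝ g u) ≤ LinearMap.ker (LieAlgebra.ad ℝ g v) ∨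
        LinearMap.ker (LieAlgebra.ad ℝ g v) ≤ LinearMap.ker (LieAlgebra.ad ℝ g u) := by
    by_cases huv : LinearIndependent ℝ ![u, v]
    · by_contra! h
      obtain ⟨Y₁, h₁, h₁'⟩ := SetLike.not_le_iff_exists.mp h.1
      obtain ⟨Y₂, h₂, h₂'⟩ := SetLike.not_le_iff_exists.mp h.2
      exact h₁' (hcon u v hu hv huv Y₁ Y₂ h₁ h₂ h₂')
    · rw [LinearIndependent.pair_iff' hu0] at huv
      push Not at huv
      obtain ⟨c, rfl⟩ := huv
      left
      intro y hy
      rw [LinearMap.mem_ker, LieAlgebra.ad_apply] at hy ⊢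
      rw [smul_lie, hy, smul_zero]
  have hne (p : {p : ℝ × ℝ // p ≠ 0}) : p.1.1 • A + p.1.2 • B ≠ 0 := fun h =>
    p.2 (Prod.ext_iff.mpr (LinearIndependent.pair_iff.mp hli _ _ h))
  have hmem (p : ℝ × ℝ) : p.1 • A + p.2 • B ∈ U :=
    U.add_mem (U.smul_mem _ hAU) (U.smul_mem _ hBU)
  have : Nonempty {p : ℝ × ℝ // p ≠ 0} := ⟨⟨(1, 0), by simp⟩⟩
  obtain ⟨p, hp⟩ := exists_eq_iSup_of_total
    (fun p : {p : ℝ × ℝ // p ≠ 0} => LinearMap.ker (LieAlgebra.ad ℝ g (p.1.1 • A + p.1.2 • B)))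
    fun p q => hchain _ _ (hmem p) (hmem q) (hne p)
  rw [iSup_ker_ad_smul_add_smul_eq_top hcompact hAB, LinearMap.ker_eq_top] at hp
  refine (hcompact _ (hne p)).ne ?_
  rw [LieModule.traceForm_apply_apply]
  change LinearMap.trace ℝ g (LieAlgebra.ad ℝ g _ ∘ₗ _) = 0
  rw [hp, LinearMap.zero_comp, map_zero]
end

section
/- Let 𝔤 be a compact simple Lie algebra and let l : 𝔤 → 𝔤 be a linear map such that l(𝔱) ⊆ 𝔱 for every Cartan subalgebra 𝔱 of 𝔤. Then l is a scalar multiple of the identity map, i.e., there exists c ∈ ℝ with l(Z) = cZ for all Z ∈ 𝔤. -/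
section EuclideanSpectrum

variable {V : Type*} [AddCommGroup V] [Module ℝ V] [FiniteDimensional ℝ V] [Nontrivial V]

/-- An endomorphism that is self-adjoint for a negative definite symmetric bilinear form has a
real eigenvalue. -/
theorem exists_hasEigenvalue_of_isAdjointPair_of_neg_def (B : LinearMap.BilinForm ℝ V)
    (hsymm : ∀ x y, B x y = B y x) (hneg : ∀ x, x ≠ 0 → B x x < 0) (f : V →ₗ[ℝ] V)
    (hf : ∀ x y, B (f x) y = B x (f y)) : ∃ c : ℝ, Module.End.HasEigenvalue f c := by
  let core : InnerProductSpace.Core ℝ V :=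
    { inner := fun x y => -B x y
      conj_inner_symm := fun x y => by simp [hsymm x y]
      re_inner_nonneg := fun x => by
        rcases eq_or_ne x 0 with rfl | hx
        · simp
        · simpa using (hneg x hx).le
      add_left := fun x y z => by simp [add_comm]
      smul_left := fun x y r => by simp
      definite := fun x hx => by
        by_contra h
        have h₁ := hneg x h
        have h₂ : -B x x = 0 := hx
        linarith }
  let : NormedAddCommGroup V := core.toNormedAddCommGroup
  let : InnerProductSpace ℝ V := InnerProductSpace.ofCore core.toCore
  have hsa : f.IsSymmetric := fun x y => by
    change -B (f x) y = -B x (f y)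
    rw [hf]
  exact ⟨_, hsa.hasEigenvalue_iSup_of_finiteDimensional⟩

end EuclideanSpectrum

section Centroid

variable {K L : Type*} [Field K] [LieRing L] [LieAlgebra K L]

/-- Linearization of the condition `⁅x, f x⁆ = 0`. -/
theorem lie_map_eq_map_lie_of_lie_self_map_eq_zero (f : L →ₗ[K] L) (hf : ∀ x, ⁅x, f x⁆ = 0)
    (x y : L) : ⁅f x, y⁆ = ⁅x, f y⁆ := by
  have h := hf (x + y)
  simp only [map_add, lie_add, add_lie, hf, zero_add, add_zero] at h
  rw [← lie_skew (f x) y, eq_comm, ← add_eq_zero_iff_eq_neg]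
  rw [add_comm] at h
  exact h

/-- An endomorphism commuting with the adjoint action is self-adjoint for the Killing form. -/
theorem killingForm_map_left_of_map_lie (f : L →ₗ[K] L) (hf : ∀ x y, f ⁅x, y⁆ = ⁅f x, y⁆)
    (x y : L) : killingForm K L (f x) y = killingForm K L x (f y) := by
  rw [killingForm_apply_apply, killingForm_apply_apply]
  congr 1
  ext w
  have hf' : f ⁅x, ⁅y, w⁆⁆ = ⁅x, f ⁅y, w⁆⁆ := by
    rw [← lie_skew, map_neg, hf, lie_skew]
  simp [← hf, hf']

variable [LieAlgebra.IsKilling K L]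

theorem LieAlgebra.IsKilling.eq_zero_of_forall_killingForm_eq_zero {u : L}
    (h : ∀ w, killingForm K L u w = 0) : u = 0 :=
  (LieAlgebra.IsKilling.killingForm_nondegenerate K L).1 u h

theorem sum_cyclic_lie_lie_map_eq_zero (f : L →ₗ[K] L)
    (hf : ∀ x y, ⁅f x, y⁆ = ⁅x, f y⁆) (x y z : L) :
    ⁅⁅x, y⁆, f z⁆ + ⁅⁅y, z⁆, f x⁆ + ⁅⁅z, x⁆, f y⁆ = 0 := by
  apply LieAlgebra.IsKilling.eq_zero_of_forall_killingForm_eq_zero (K := K)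
  intro w
  have key (a b c : L) :
      killingForm K L ⁅⁅a, b⁆, f c⁆ w = killingForm K L ⁅⁅a, b⁆, c⁆ (f w) := by
    rw [LieModule.traceForm_apply_lie_apply, hf, ← LieModule.traceForm_apply_lie_apply]
  have jac : ⁅⁅x, y⁆, z⁆ + ⁅⁅y, z⁆, x⁆ + ⁅⁅z, x⁆, y⁆ = 0 := by
    have := lie_jacobi x y z
    rw [← lie_skew ⁅x, y⁆ z, ← lie_skew ⁅y, z⁆ x, ← lie_skew ⁅z, x⁆ y, ← neg_eq_zero, ← this]
    abel
  simp only [map_add, LinearMap.add_apply, key]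
  rw [← LinearMap.add_apply, ← LinearMap.add_apply, ← map_add, ← map_add, jac, map_zero,
    LinearMap.zero_apply]

variable [FiniteDimensional K L]

/-- If `f` satisfies `⁅f x, y⁆ = ⁅x, f y⁆` on a Killing Lie algebra, then `f` commutes with the
adjoint action. -/
theorem map_lie_of_lie_map_eq_map_lie [CharZero K] (f : L →ₗ[K] L)
    (hf : ∀ x y, ⁅f x, y⁆ = ⁅x, f y⁆) (y z : L) : f ⁅y, z⁆ = ⁅f y, z⁆ := by
  have flip (a b : L) : ⁅f a, b⁆ = -⁅f b, a⁆ := by rw [hf, lie_skew]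
  have expand (a b c : L) : ⁅⁅a, b⁆, f c⁆ = ⁅a, ⁅f b, c⁆⁆ + ⁅b, ⁅f c, a⁆⁆ := by
    rw [lie_lie, ← hf b c, ← hf a c, flip a c, lie_neg, sub_neg_eq_add]
  have hsum (x : L) : ⁅x, ⁅f y, z⁆⁆ + ⁅y, ⁅f z, x⁆⁆ + ⁅z, ⁅f x, y⁆⁆ = 0 := by
    have h := sum_cyclic_lie_lie_map_eq_zero f hf x y z
    simp only [expand] at h
    have h₂ : (2 : K) • (⁅x, ⁅f y, z⁆⁆ + ⁅y, ⁅f z, x⁆⁆ + ⁅z, ⁅f x, y⁆⁆) = 0 := by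
      rw [two_smul, ← h]
      abel
    exact (smul_eq_zero.mp h₂).resolve_left two_ne_zero
  have hlie (x : L) : ⁅x, f ⁅y, z⁆⁆ = ⁅x, ⁅f y, z⁆⁆ := by
    rw [← hf, leibniz_lie, flip x z, lie_neg, ← lie_skew ⁅f x, y⁆ z, ← sub_eq_zero,
      ← neg_eq_zero, ← hsum x]
    abel
  have hmem : f ⁅y, z⁆ - ⁅f y, z⁆ ∈ LieAlgebra.center K L := fun x => by
    rw [lie_sub, hlie, sub_self]
  rw [LieAlgebra.center_eq_bot, LieSubmodule.mem_bot] at hmem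
  exact sub_eq_zero.mp hmem

end Centroid

section Simple

variable {K L : Type*} [Field K] [LieRing L] [LieAlgebra K L] [LieAlgebra.IsSimple K L]

/-- On a simple Lie algebra, an endomorphism commuting with the adjoint action and having an
eigenvalue is a scalar. -/
theorem eq_smul_of_hasEigenvalue_of_map_lie (f : L →ₗ[K] L) (hf : ∀ x y : L, f ⁅x, y⁆ = ⁅x, f y⁆)
    {c : K} (hc : Module.End.HasEigenvalue f c) (z : L) : f z = c • z := by
  let I : LieIdeal K L :=
    { Module.End.eigenspace f c with
      lie_mem := fun {x m} hm => by
        have hm' : f m = c • m := Module.End.mem_eigenspace_iff.mp hm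
        apply Module.End.mem_eigenspace_iff.mpr
        rw [hf, hm', lie_smul] }
  have hmem (w : L) : w ∈ I ↔ f w = c • w := Module.End.mem_eigenspace_iff
  obtain ⟨v, hv⟩ := hc.exists_hasEigenvector
  rcases LieAlgebra.IsSimple.eq_bot_or_eq_top (R := K) I with h | h
  · have hvI : v ∈ I := (hmem v).mpr hv.apply_eq_smul
    rw [h, LieSubmodule.mem_bot] at hvI
    exact absurd hvI hv.2
  · exact (hmem z).mp (h ▸ LieSubmodule.mem_top z)

end Simple

section Compact

variable {g : Type*} [LieRing g] [LieAlgebra ℝ g]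

theorem isKilling_of_killingForm_neg_def (hneg : ∀ x : g, x ≠ 0 → killingForm ℝ g x x < 0) :
    LieAlgebra.IsKilling ℝ g := by
  refine ⟨(LieSubmodule.eq_bot_iff _).mpr fun x hx => ?_⟩
  by_contra h
  exact (hneg x h).ne ((LieIdeal.mem_killingCompl ℝ g _).mp hx x (LieSubmodule.mem_top x))

variable [FiniteDimensional ℝ g]

/-- In a Lie algebra with negative definite Killing form, every element lies in a Cartan
subalgebra which is abelian. -/
theorem exists_isCartanSubalgebra_mem (hneg : ∀ x : g, x ≠ 0 → killingForm ℝ g x x < 0) (x : g) :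
    ∃ t : LieSubalgebra ℝ g, t.IsCartanSubalgebra ∧ (∀ a ∈ t, ∀ b ∈ t, ⁅a, b⁆ = 0) ∧ x ∈ t := by
  let S : Set (LieSubalgebra ℝ g) := {t | IsLieAbelian t ∧ x ∈ t}
  have hS : S.Nonempty := by
    refine ⟨LieSubalgebra.lieSpan ℝ g {x}, ?_, LieSubalgebra.subset_lieSpan rfl⟩
    simp
  obtain ⟨t, ht⟩ := exists_maximal_of_wellFoundedGT (· ∈ S) hS
  obtain ⟨htab, hxt⟩ := ht.prop
  have hcomm : ∀ a ∈ t, ∀ b ∈ t, ⁅a, b⁆ = 0 := fun a ha b hb =>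
    congrArg Subtype.val (htab.trivial ⟨a, ha⟩ ⟨b, hb⟩)
  refine ⟨t, ⟨inferInstance, le_antisymm (fun n hn => ?_) t.le_normalizer⟩, hcomm, hxt⟩
  have hn0 : ∀ a ∈ t, ⁅n, a⁆ = 0 := fun a ha => by
    by_contra h
    refine (hneg _ h).ne ?_
    rw [LieModule.traceForm_apply_lie_apply,
      hcomm a ha _ ((LieSubalgebra.mem_normalizer_iff t n).mp hn a ha), map_zero]
  have hmem : LieSubalgebra.lieSpan ℝ g (insert n (t : Set g)) ∈ S := by
    refine ⟨LieSubalgebra.isLieAbelian_lieSpan_iff.mpr ?_,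
      LieSubalgebra.subset_lieSpan (Or.inr hxt)⟩
    rintro a (rfl | ha) b (rfl | hb)
    · exact lie_self _
    · exact hn0 b hb
    · rw [← lie_skew, hn0 a ha, neg_zero]
    · exact hcomm a ha b hb
  exact ht.le_of_ge hmem (fun a ha => LieSubalgebra.subset_lieSpan (Or.inr ha))
    (LieSubalgebra.subset_lieSpan (Or.inl rfl))

end Compact


/-- Let `𝔤` be a compact simple Lie algebra (the Killing form is negative
definite) and let `l : 𝔤 → 𝔤` be a linear map mapping every Cartan subalgebra of `𝔤` into
itself. Then `l` is a scalar multiple of the identity. -/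
theorem statement4 (g : Type*) [LieRing g] [LieAlgebra ℝ g] [FiniteDimensional ℝ g]
    [LieAlgebra.IsSimple ℝ g]
    (hcompact : ∀ x : g, x ≠ 0 → killingForm ℝ g x x < 0)
    (l : g →ₗ[ℝ] g)
    (hl : ∀ t : LieSubalgebra ℝ g, t.IsCartanSubalgebra → ∀ x ∈ t, l x ∈ t) :
    ∃ c : ℝ, ∀ z : g, l z = c • z := by
  have : LieAlgebra.IsKilling ℝ g := isKilling_of_killingForm_neg_def hcompact
  have hself (x : g) : ⁅x, l x⁆ = 0 := by
    obtain ⟨t, htC, htab, hx⟩ := exists_isCartanSubalgebra_mem hcompact x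
    exact htab x hx (l x) (hl t htC x hx)
  have hleft := map_lie_of_lie_map_eq_map_lie l
    (lie_map_eq_map_lie_of_lie_self_map_eq_zero l hself)
  have : Nontrivial g := by
    by_contra h
    rw [not_nontrivial_iff_subsingleton] at h
    exact LieAlgebra.IsSimple.non_abelian ℝ (L := g) ⟨fun _ _ => Subsingleton.elim _ _⟩
  obtain ⟨c, hc⟩ := exists_hasEigenvalue_of_isAdjointPair_of_neg_def (killingForm ℝ g)
    (LieModule.traceForm_comm ℝ g g) hcompact l (killingForm_map_left_of_map_lie l hleft)
  refine ⟨c, eq_smul_of_hasEigenvalue_of_map_lie l (fun x y => ?_) hc⟩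
  rw [hleft, lie_map_eq_map_lie_of_lie_self_map_eq_zero l hself]
end

section
/- Let n ≥ 4 and let Δ = {±eᵢ ± eⱼ : 1 ≤ i < j ≤ n} ⊂ ℝⁿ be the root system of type Dₙ (all four sign combinations for each pair i < j). Then for any two nonzero vectors u, x ∈ ℝⁿ there exist at least four distinct roots r ∈ Δ with ⟨r, u⟩ ≠ 0 and ⟨r, x⟩ ≠ 0, where ⟨·,·⟩ is the standard inner product on ℝⁿ. -/
/-- The root system of type `Dₙ` in `ℝⁿ`: the vectors `±eᵢ ± eⱼ` for `i < j`. -/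
def DRoots (n : ℕ) : Set (Fin n → ℝ) :=
  {r | ∃ i j : Fin n, i < j ∧ ∃ ε₁ ε₂ : ℝ, (ε₁ = 1 ∨ ε₁ = -1) ∧ (ε₂ = 1 ∨ ε₂ = -1) ∧
    r = ε₁ • (Pi.single i 1 : Fin n → ℝ) + ε₂ • (Pi.single j 1 : Fin n → ℝ)}

/-- The vector `eᵢ + a eⱼ`. -/
def rootVec {n : ℕ} (i j : Fin n) (a : ℝ) : Fin n → ℝ :=
  (Pi.single i 1 : Fin n → ℝ) + a • (Pi.single j 1 : Fin n → ℝ)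

/-- `r` is a root of type `Dₙ` orthogonal to neither `u` nor `x`. -/
def IsGoodRoot {n : ℕ} (u x r : Fin n → ℝ) : Prop :=
  r ∈ DRoots n ∧ (∑ i, r i * u i) ≠ 0 ∧ (∑ i, r i * x i) ≠ 0

theorem sum_rootVec_mul {n : ℕ} (i j : Fin n) (a : ℝ) (v : Fin n → ℝ) :
    ∑ k, rootVec i j a k * v k = v i + a * v j := by
  simp [rootVec, add_mul, Finset.sum_add_distrib, Pi.single_apply]

theorem rootVec_mem_DRoots {n : ℕ} {i j : Fin n} (hij : i ≠ j) {a : ℝ} (ha : a = 1 ∨ a = -1) :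
    rootVec i j a ∈ DRoots n := by
  rcases lt_or_gt_of_ne hij with h | h
  · exact ⟨i, j, h, 1, a, Or.inl rfl, ha, by simp [rootVec]⟩
  · exact ⟨j, i, h, a, 1, ha, Or.inl rfl, by simp [rootVec, add_comm]⟩

theorem neg_mem_DRoots {n : ℕ} {r : Fin n → ℝ} (hr : r ∈ DRoots n) : -r ∈ DRoots n := by
  obtain ⟨i, j, hij, a, b, ha, hb, rfl⟩ := hr
  refine ⟨i, j, hij, -a, -b, ?_, ?_, ?_⟩
  · rcases ha with rfl | rfl <;> simp
  · rcases hb with rfl | rfl <;> simp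
  · simp only [neg_smul, neg_add]

theorem IsGoodRoot.neg {n : ℕ} {u x r : Fin n → ℝ} (h : IsGoodRoot u x r) :
    IsGoodRoot u x (-r) :=
  ⟨neg_mem_DRoots h.1, by simpa using h.2.1, by simpa using h.2.2⟩

theorem IsGoodRoot.ne_neg_self {n : ℕ} {u x r : Fin n → ℝ} (h : IsGoodRoot u x r) :
    r ≠ -r := by
  intro h0
  rw [self_eq_neg] at h0
  exact h.2.1 (by simp [h0])

theorem isGoodRoot_rootVec {n : ℕ} {u x : Fin n → ℝ} {i j : Fin n} (hij : i ≠ j) {a : ℝ}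
    (ha : a = 1 ∨ a = -1) (hu : u i + a * u j ≠ 0) (hx : x i + a * x j ≠ 0) :
    IsGoodRoot u x (rootVec i j a) :=
  ⟨rootVec_mem_DRoots hij ha, by rwa [sum_rootVec_mul], by rwa [sum_rootVec_mul]⟩

theorem exists_four_goodRoots {n : ℕ} {u x r s : Fin n → ℝ} (hr : IsGoodRoot u x r)
    (hs : IsGoodRoot u x s) (h₁ : r ≠ s) (h₂ : r ≠ -s) :
    ∃ t : Finset (Fin n → ℝ), 4 ≤ t.card ∧ ∀ r ∈ t, IsGoodRoot u x r := by
  classical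
  refine ⟨{r, s, -r, -s}, ?_, ?_⟩
  · have h₃ : s ≠ -r := fun h => h₂ (by rw [h, neg_neg])
    have h₄ : -r ≠ -s := fun h => h₁ (neg_injective h)
    rw [Finset.card_insert_of_notMem, Finset.card_insert_of_notMem, Finset.card_pair h₄]
    · simp [h₃, hs.ne_neg_self]
    · simp [h₁, h₂, hr.ne_neg_self]
  · intro q hq
    simp only [Finset.mem_insert, Finset.mem_singleton] at hq
    rcases hq with rfl | rfl | rfl | rfl
    exacts [hr, hs, hr.neg, hs.neg]

/-- The version of `exists_four_goodRoots` for roots with different supports. -/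
theorem exists_four_goodRoots_of_apply {n : ℕ} {u x r s : Fin n → ℝ} (hr : IsGoodRoot u x r)
    (hs : IsGoodRoot u x s) (p : Fin n) (hrp : r p ≠ 0) (hsp : s p = 0) :
    ∃ t : Finset (Fin n → ℝ), 4 ≤ t.card ∧ ∀ r ∈ t, IsGoodRoot u x r :=
  exists_four_goodRoots hr hs (fun h => hrp (by rw [h, hsp]))
    (fun h => hrp (by rw [h, Pi.neg_apply, hsp, neg_zero]))

theorem rootVec_apply_left {n : ℕ} {i j : Fin n} (hij : i ≠ j) (a : ℝ) :
    rootVec i j a i = 1 := by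
  simp [rootVec, hij]

theorem rootVec_apply_right {n : ℕ} {i j : Fin n} (hij : i ≠ j) (a : ℝ) :
    rootVec i j a j = a := by
  simp [rootVec, hij.symm]

theorem rootVec_apply_of_ne {n : ℕ} {i j k : Fin n} (hi : k ≠ i) (hj : k ≠ j) (a : ℝ) :
    rootVec i j a k = 0 := by
  simp [rootVec, hi, hj]

/-- If neither `u` nor `x` vanishes at `k`, either one of `eₖ ± eⱼ` is good, or the coordinates
of `u` and `x` at `j` agree with those at `k` up to opposite signs. -/
theorem exists_goodRoot_or {n : ℕ} {u x : Fin n → ℝ} {k j : Fin n} (hkj : k ≠ j)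
    (hu : u k ≠ 0) (hx : x k ≠ 0) :
    (∃ a : ℝ, a ≠ 0 ∧ IsGoodRoot u x (rootVec k j a)) ∨
      ∃ c : ℝ, (c = 1 ∨ c = -1) ∧ u j = c * u k ∧ x j = -c * x k := by
  by_cases h₁ : u k + 1 * u j ≠ 0 ∧ x k + 1 * x j ≠ 0
  · exact Or.inl ⟨1, by norm_num, isGoodRoot_rootVec hkj (Or.inl rfl) h₁.1 h₁.2⟩
  by_cases h₂ : u k + -1 * u j ≠ 0 ∧ x k + -1 * x j ≠ 0
  · exact Or.inl ⟨-1, by norm_num, isGoodRoot_rootVec hkj (Or.inr rfl) h₂.1 h₂.2⟩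
  right
  rw [not_and_or, not_not, not_not] at h₁ h₂
  rcases h₁ with h₁ | h₁ <;> rcases h₂ with h₂ | h₂
  · exact absurd (by linarith) hu
  · exact ⟨-1, Or.inr rfl, by linarith, by linarith⟩
  · exact ⟨1, Or.inl rfl, by linarith, by linarith⟩
  · exact absurd (by linarith) hx

/-- Two indices failing the first alternative of `exists_goodRoot_or` span a good root. -/
theorem exists_goodRoot_of_signs {n : ℕ} {u x : Fin n → ℝ} {k i j : Fin n} (hij : i ≠ j)
    (hu : u k ≠ 0) (hx : x k ≠ 0)
    (hi : ∃ c : ℝ, (c = 1 ∨ c = -1) ∧ u i = c * u k ∧ x i = -c * x k)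
    (hj : ∃ c : ℝ, (c = 1 ∨ c = -1) ∧ u j = c * u k ∧ x j = -c * x k) :
    ∃ a : ℝ, a ≠ 0 ∧ IsGoodRoot u x (rootVec i j a) := by
  obtain ⟨c, hc, hui, hxi⟩ := hi
  obtain ⟨d, hd, huj, hxj⟩ := hj
  have hcc : c * c = 1 := by rcases hc with rfl | rfl <;> norm_num
  have hdd : d * d = 1 := by rcases hd with rfl | rfl <;> norm_num
  have hc0 : c ≠ 0 := left_ne_zero_of_mul_eq_one hcc
  have hd0 : d ≠ 0 := left_ne_zero_of_mul_eq_one hdd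
  refine ⟨c * d, mul_ne_zero hc0 hd0, isGoodRoot_rootVec hij ?_ ?_ ?_⟩
  · rcases hc with rfl | rfl <;> rcases hd with rfl | rfl <;> norm_num
  · have h : u i + c * d * u j = 2 * c * u k := by
      rw [hui, huj]; linear_combination c * u k * hdd
    rw [h]; positivity
  · have h : x i + c * d * x j = -2 * c * x k := by
      rw [hxi, hxj]; linear_combination -c * x k * hdd
    rw [h]; simp [hc0, hx]

theorem exists_four_goodRoots_of_common_support {n : ℕ} (hn : 4 ≤ n) {u x : Fin n → ℝ}
    {k : Fin n} (hu : u k ≠ 0) (hx : x k ≠ 0) :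
    ∃ t : Finset (Fin n → ℝ), 4 ≤ t.card ∧ ∀ r ∈ t, IsGoodRoot u x r := by
  have hcard : 2 < (Finset.univ.erase k).card := by
    rw [Finset.card_erase_of_mem (Finset.mem_univ k), Finset.card_univ, Fintype.card_fin]
    omega
  obtain ⟨p, hp, q, hq, r, hr, hpq, hpr, hqr⟩ := Finset.two_lt_card.1 hcard
  replace hp : k ≠ p := (Finset.ne_of_mem_erase hp).symm
  replace hq : k ≠ q := (Finset.ne_of_mem_erase hq).symm
  replace hr : k ≠ r := (Finset.ne_of_mem_erase hr).symm
  have two_star : ∀ {i j : Fin n}, k ≠ i → k ≠ j → i ≠ j →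
      (∃ a : ℝ, a ≠ 0 ∧ IsGoodRoot u x (rootVec k i a)) →
      (∃ a : ℝ, a ≠ 0 ∧ IsGoodRoot u x (rootVec k j a)) →
      ∃ t : Finset (Fin n → ℝ), 4 ≤ t.card ∧ ∀ r ∈ t, IsGoodRoot u x r := by
    rintro i j hi hj hij ⟨a, ha, h⟩ ⟨b, -, h'⟩
    exact exists_four_goodRoots_of_apply h h' i (by rwa [rootVec_apply_right hi])
      (rootVec_apply_of_ne hi.symm hij b)
  have star_and_edge : ∀ {i j l : Fin n}, k ≠ i → k ≠ j → k ≠ l →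
      (∃ a : ℝ, a ≠ 0 ∧ IsGoodRoot u x (rootVec k i a)) →
      (∃ a : ℝ, a ≠ 0 ∧ IsGoodRoot u x (rootVec j l a)) →
      ∃ t : Finset (Fin n → ℝ), 4 ≤ t.card ∧ ∀ r ∈ t, IsGoodRoot u x r := by
    rintro i j l hi hj hl ⟨a, -, h⟩ ⟨b, -, h'⟩
    exact exists_four_goodRoots_of_apply h h' k (by simp [rootVec_apply_left hi])
      (rootVec_apply_of_ne hj hl b)
  rcases exists_goodRoot_or hp hu hx with gp | bp <;>
  rcases exists_goodRoot_or hq hu hx with gq | bq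
  · exact two_star hp hq hpq gp gq
  · rcases exists_goodRoot_or hr hu hx with gr | br
    · exact two_star hp hr hpr gp gr
    · exact star_and_edge hp hq hr gp (exists_goodRoot_of_signs hqr hu hx bq br)
  · rcases exists_goodRoot_or hr hu hx with gr | br
    · exact two_star hq hr hqr gq gr
    · exact star_and_edge hq hp hr gq (exists_goodRoot_of_signs hpr hu hx bp br)
  · rcases exists_goodRoot_or hr hu hx with gr | br
    · exact star_and_edge hr hp hq gr (exists_goodRoot_of_signs hpq hu hx bp bq)
    · obtain ⟨a, ha, h⟩ := exists_goodRoot_of_signs hpq hu hx bp bq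
      obtain ⟨b, -, h'⟩ := exists_goodRoot_of_signs hpr hu hx bp br
      exact exists_four_goodRoots_of_apply h h' q (by rwa [rootVec_apply_right hpq])
        (rootVec_apply_of_ne hpq.symm hqr b)

theorem exists_four_goodRoots_of_disjoint {n : ℕ} {u x : Fin n → ℝ} {k m : Fin n}
    (huk : u k ≠ 0) (hxk : x k = 0) (hum : u m = 0) (hxm : x m ≠ 0) :
    ∃ t : Finset (Fin n → ℝ), 4 ≤ t.card ∧ ∀ r ∈ t, IsGoodRoot u x r := by
  have hkm : k ≠ m := by
    rintro rfl
    exact huk hum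
  refine exists_four_goodRoots (r := rootVec k m 1) (s := rootVec k m (-1))
    (isGoodRoot_rootVec hkm (Or.inl rfl) (by simpa [hum]) (by simpa [hxk]))
    (isGoodRoot_rootVec hkm (Or.inr rfl) (by simpa [hum]) (by simpa [hxk])) ?_ ?_
  · intro h
    have := congrFun h m
    rw [rootVec_apply_right hkm, rootVec_apply_right hkm] at this
    norm_num at this
  · intro h
    have := congrFun h k
    rw [Pi.neg_apply, rootVec_apply_left hkm, rootVec_apply_left hkm] at this
    norm_num at this

/-- For `n ≥ 4` and any two nonzero vectors `u, x ∈ ℝⁿ` there are at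
least four distinct roots `r` of the root system of type `Dₙ` with `⟨r, u⟩ ≠ 0` and
`⟨r, x⟩ ≠ 0`. -/
theorem statement5 (n : ℕ) (hn : 4 ≤ n) (u x : Fin n → ℝ) (hu : u ≠ 0) (hx : x ≠ 0) :
    ∃ s : Finset (Fin n → ℝ), 4 ≤ s.card ∧
      ∀ r ∈ s, r ∈ DRoots n ∧ (∑ i, r i * u i) ≠ 0 ∧ (∑ i, r i * x i) ≠ 0 := by
  change ∃ s : Finset (Fin n → ℝ), 4 ≤ s.card ∧ ∀ r ∈ s, IsGoodRoot u x r
  obtain ⟨k, hk⟩ := Function.ne_iff.1 hu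
  obtain ⟨m, hm⟩ := Function.ne_iff.1 hx
  by_cases hxk : x k = 0
  · by_cases hum : u m = 0
    · exact exists_four_goodRoots_of_disjoint hk hxk hum hm
    · exact exists_four_goodRoots_of_common_support hn hum hm
  · exact exists_four_goodRoots_of_common_support hn hk hxk
end

section
/- Let Δ ⊂ ℝ⁴ be the root system of type F₄, consisting of the 48 vectors: all coordinate permutations of (±1, ±1, 0, 0), the eight vectors ±eᵢ (1 ≤ i ≤ 4), and the sixteen vectors (±1/2, ±1/2, ±1/2, ±1/2). Then for any two nonzero vectors u, x ∈ ℝ⁴ there exist at least four distinct roots r ∈ Δ with ⟨r, u⟩ ≠ 0 and ⟨r, x⟩ ≠ 0, where ⟨·,·⟩ is the standard inner product on ℝ⁴. -/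
/-- The root system of type `F₄` in `ℝ⁴`: the 24 vectors `±eᵢ ± eⱼ` (`i < j`, i.e. all
coordinate permutations of `(±1, ±1, 0, 0)`), the 8 vectors `±eᵢ`, and the 16 vectors
`(±1/2, ±1/2, ±1/2, ±1/2)`. -/
def F4Roots : Set (Fin 4 → ℝ) :=
  {r | ∃ i j : Fin 4, i < j ∧ ∃ ε₁ ε₂ : ℝ, (ε₁ = 1 ∨ ε₁ = -1) ∧ (ε₂ = 1 ∨ ε₂ = -1) ∧
    r = ε₁ • (Pi.single i 1 : Fin 4 → ℝ) + ε₂ • (Pi.single j 1 : Fin 4 → ℝ)} ∪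
  {r | ∃ i : Fin 4, r = (Pi.single i 1 : Fin 4 → ℝ) ∨ r = -(Pi.single i 1 : Fin 4 → ℝ)} ∪
  {r | ∀ i : Fin 4, r i = 1 / 2 ∨ r i = -(1 / 2)}

theorem neg_mem_F4Roots {r : Fin 4 → ℝ} (hr : r ∈ F4Roots) : -r ∈ F4Roots := by
  rcases hr with (⟨i, j, hij, a, b, ha, hb, rfl⟩ | ⟨i, rfl | rfl⟩) | h
  · refine Or.inl (Or.inl ⟨i, j, hij, -a, -b, ?_, ?_, ?_⟩)
    · rcases ha with rfl | rfl <;> simp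
    · rcases hb with rfl | rfl <;> simp
    · simp only [neg_smul, neg_add]
  · exact Or.inl (Or.inr ⟨i, Or.inr rfl⟩)
  · exact Or.inl (Or.inr ⟨i, Or.inl (neg_neg _)⟩)
  · refine Or.inr fun i => ?_
    rcases h i with h | h <;> simp [h]

theorem sum_sq_mul_sum_sq_add_pos {u x : Fin 4 → ℝ} (hu : u ≠ 0) (hx : x ≠ 0) :
    0 < (∑ i, u i ^ 2) * (∑ i, x i ^ 2) + 2 * (∑ i, u i * x i) ^ 2 := by
  have pos : ∀ {v : Fin 4 → ℝ}, v ≠ 0 → 0 < ∑ i, v i ^ 2 := by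
    intro v hv
    obtain ⟨i, hi⟩ := Function.ne_iff.mp hv
    exact Finset.sum_pos' (fun i _ => sq_nonneg (v i)) ⟨i, Finset.mem_univ i, sq_pos_of_ne_zero hi⟩
  have := mul_pos (pos hu) (pos hx)
  positivity

/-- The short roots form a spherical design of strength four, so the sum of
`⟨r, u⟩² ⟨r, x⟩²` over them is positive; hence some short root is orthogonal to neither vector. -/
theorem exists_short_root_not_orthogonal {u x : Fin 4 → ℝ} (hu : u ≠ 0) (hx : x ≠ 0) :
    ∃ r ∈ F4Roots, ∑ i, r i ^ 2 = 1 ∧ (∑ i, r i * u i) ≠ 0 ∧ (∑ i, r i * x i) ≠ 0 := by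
  by_contra! h
  have unit (i : Fin 4) : u i * x i = 0 := by
    have := h (Pi.single i 1) (Or.inl (Or.inr ⟨i, Or.inl rfl⟩)) (by simp [Pi.single_apply])
    simpa [Pi.single_apply, or_iff_not_imp_left] using this
  have half (b c d : ℝ) (hb : b = 1 ∨ b = -1) (hc : c = 1 ∨ c = -1) (hd : d = 1 ∨ d = -1) :
      (u 0 + b * u 1 + c * u 2 + d * u 3) * (x 0 + b * x 1 + c * x 2 + d * x 3) = 0 := by
    have := h ![1 / 2, b / 2, c / 2, d / 2]
      (Or.inr fun i => by
        fin_cases i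
        · simp
        · rcases hb with rfl | rfl <;> norm_num
        · rcases hc with rfl | rfl <;> norm_num
        · rcases hd with rfl | rfl <;> norm_num)
      (by
        simp only [Fin.sum_univ_four, Matrix.cons_val]
        rcases hb with rfl | rfl <;> rcases hc with rfl | rfl <;> rcases hd with rfl | rfl <;>
          norm_num)
    simp only [Fin.sum_univ_four, Matrix.cons_val] at this
    rw [mul_eq_zero, or_iff_not_imp_left]
    intro hne
    have := this fun h0 => hne (by linear_combination 2 * h0)
    linear_combination 2 * this
  have key : (∑ i, u i ^ 2) * (∑ i, x i ^ 2) + 2 * (∑ i, u i * x i) ^ 2 =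
      2 * ∑ i, (u i * x i) ^ 2 + (1 / 8) * ∑ b : Fin 2, ∑ c : Fin 2, ∑ d : Fin 2,
        ((u 0 + (-1) ^ (b : ℕ) * u 1 + (-1) ^ (c : ℕ) * u 2 + (-1) ^ (d : ℕ) * u 3) *
          (x 0 + (-1) ^ (b : ℕ) * x 1 + (-1) ^ (c : ℕ) * x 2 + (-1) ^ (d : ℕ) * x 3)) ^ 2 := by
    simp only [Fin.sum_univ_four, Fin.sum_univ_two, Fin.val_zero, Fin.val_one]
    ring
  have pos := sum_sq_mul_sum_sq_add_pos hu hx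
  rw [key] at pos
  simp only [unit, half _ _ _ (neg_one_pow_eq_or ℝ _) (neg_one_pow_eq_or ℝ _)
    (neg_one_pow_eq_or ℝ _)] at pos
  norm_num at pos

/-- The long roots form a spherical design of strength four, so the sum of
`⟨r, u⟩² ⟨r, x⟩²` over them is positive; hence some long root is orthogonal to neither vector. -/
theorem exists_long_root_not_orthogonal {u x : Fin 4 → ℝ} (hu : u ≠ 0) (hx : x ≠ 0) :
    ∃ r ∈ F4Roots, ∑ i, r i ^ 2 = 2 ∧ (∑ i, r i * u i) ≠ 0 ∧ (∑ i, r i * x i) ≠ 0 := by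
  by_contra! h
  have pair (i j : Fin 4) (hij : i < j) (b : ℝ) (hb : b = 1 ∨ b = -1) :
      (u i + b * u j) * (x i + b * x j) = 0 := by
    have hb2 : b ^ 2 = 1 := by rcases hb with rfl | rfl <;> norm_num
    have := h ((1 : ℝ) • Pi.single i 1 + b • Pi.single j 1)
      (Or.inl (Or.inl ⟨i, j, hij, 1, b, Or.inl rfl, hb, rfl⟩))
      (by
        simp [Pi.single_apply, add_sq, Finset.sum_add_distrib, hb2, hij.ne']
        norm_num)
    rw [mul_eq_zero, or_iff_not_imp_left]
    simpa [Pi.single_apply, add_mul, Finset.sum_add_distrib] using this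
  have key : (∑ i, u i ^ 2) * (∑ i, x i ^ 2) + 2 * (∑ i, u i * x i) ^ 2 =
      (1 / 2) * ∑ b : Fin 2,
        (((u 0 + (-1) ^ (b : ℕ) * u 1) * (x 0 + (-1) ^ (b : ℕ) * x 1)) ^ 2 +
        ((u 0 + (-1) ^ (b : ℕ) * u 2) * (x 0 + (-1) ^ (b : ℕ) * x 2)) ^ 2 +
        ((u 0 + (-1) ^ (b : ℕ) * u 3) * (x 0 + (-1) ^ (b : ℕ) * x 3)) ^ 2 +
        ((u 1 + (-1) ^ (b : ℕ) * u 2) * (x 1 + (-1) ^ (b : ℕ) * x 2)) ^ 2 +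
        ((u 1 + (-1) ^ (b : ℕ) * u 3) * (x 1 + (-1) ^ (b : ℕ) * x 3)) ^ 2 +
        ((u 2 + (-1) ^ (b : ℕ) * u 3) * (x 2 + (-1) ^ (b : ℕ) * x 3)) ^ 2) := by
    simp only [Fin.sum_univ_four, Fin.sum_univ_two, Fin.val_zero, Fin.val_one]
    ring
  have pos := sum_sq_mul_sum_sq_add_pos hu hx
  rw [key] at pos
  simp only [pair 0 1 (by decide) _ (neg_one_pow_eq_or ℝ _),
    pair 0 2 (by decide) _ (neg_one_pow_eq_or ℝ _), pair 0 3 (by decide) _ (neg_one_pow_eq_or ℝ _),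
    pair 1 2 (by decide) _ (neg_one_pow_eq_or ℝ _), pair 1 3 (by decide) _ (neg_one_pow_eq_or ℝ _),
    pair 2 3 (by decide) _ (neg_one_pow_eq_or ℝ _)] at pos
  norm_num at pos

/-- For any two nonzero vectors `u, x ∈ ℝ⁴` there are at least four
distinct roots `r` of the root system of type `F₄` with `⟨r, u⟩ ≠ 0` and `⟨r, x⟩ ≠ 0`. -/
theorem statement7 (u x : Fin 4 → ℝ) (hu : u ≠ 0) (hx : x ≠ 0) :
    ∃ s : Finset (Fin 4 → ℝ), 4 ≤ s.card ∧
      ∀ r ∈ s, r ∈ F4Roots ∧ (∑ i, r i * u i) ≠ 0 ∧ (∑ i, r i * x i) ≠ 0 := by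
  classical
  obtain ⟨r, hr, hr1, hru, hrx⟩ := exists_short_root_not_orthogonal hu hx
  obtain ⟨t, ht, ht2, htu, htx⟩ := exists_long_root_not_orthogonal hu hx
  have ne_neg : ∀ {v : Fin 4 → ℝ}, (∑ i, v i * u i) ≠ 0 → v ≠ -v := by
    intro v hv h
    exact hv (by simp [self_eq_neg.mp h])
  have r_ne_t : r ≠ t := by
    rintro rfl
    linarith
  have r_ne_neg_t : r ≠ -t := by
    rintro rfl
    simp only [Pi.neg_apply, neg_sq] at hr1
    linarith
  refine ⟨{r, -r, t, -t}, ?_, ?_⟩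
  · have neg_r_ne_t : -r ≠ t := fun h => r_ne_neg_t (neg_eq_iff_eq_neg.mp h)
    have neg_r_ne_neg_t : -r ≠ -t := fun h => r_ne_t (neg_injective h)
    rw [Finset.card_insert_of_notMem (by simp [ne_neg hru, r_ne_t, r_ne_neg_t]),
      Finset.card_insert_of_notMem (by simp [neg_r_ne_t, r_ne_t]),
      Finset.card_pair (ne_neg htu)]
  · intro v hv
    simp only [Finset.mem_insert, Finset.mem_singleton] at hv
    rcases hv with rfl | rfl | rfl | rfl
    · exact ⟨hr, hru, hrx⟩
    · exact ⟨neg_mem_F4Roots hr, by simpa using hru, by simpa using hrx⟩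
    · exact ⟨ht, htu, htx⟩
    · exact ⟨neg_mem_F4Roots ht, by simpa using htu, by simpa using htx⟩
end

section
/- Let Δ ⊂ ℝ⁶ be the root system of type E₆ in the following realization: Δ consists of the 40 vectors ±eᵢ ± eⱼ (1 ≤ i < j ≤ 5, last coordinate 0) together with the 32 vectors (c₁, …, c₅, c₆) where cᵢ = ±1/2 for i ≤ 5, c₆ = ±√3/2, and the total number of plus signs among the six entries is odd. Then for any two nonzero vectors u, x ∈ ℝ⁶ there exist at least four distinct roots r ∈ Δ with ⟨r, u⟩ ≠ 0 and ⟨r, x⟩ ≠ 0, where ⟨·,·⟩ is the standard inner product on ℝ⁶. -/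
/-- The root system of type `E₆` in `ℝ⁶` (in the realization used in the paper): the 40
vectors `±eᵢ ± eⱼ` with `i < j ≤ 5` (last coordinate `0`), together with the 32 vectors
whose first five coordinates are `±1/2`, whose last coordinate is `±√3/2`, and which have
an odd total number of positive entries. -/
def E6Roots : Set (Fin 6 → ℝ) :=
  {r | ∃ i j : Fin 6, i < j ∧ (j : ℕ) < 5 ∧
      ∃ ε₁ ε₂ : ℝ, (ε₁ = 1 ∨ ε₁ = -1) ∧ (ε₂ = 1 ∨ ε₂ = -1) ∧
      r = ε₁ • (Pi.single i 1 : Fin 6 → ℝ) + ε₂ • (Pi.single j 1 : Fin 6 → ℝ)} ∪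
  {r | (∀ i : Fin 6, (i : ℕ) < 5 → (r i = 1 / 2 ∨ r i = -(1 / 2))) ∧
      (r 5 = Real.sqrt 3 / 2 ∨ r 5 = -(Real.sqrt 3 / 2)) ∧
      Odd (Nat.card {i : Fin 6 // 0 < r i})}

theorem neg_mem_E6Roots {r : Fin 6 → ℝ} (hr : r ∈ E6Roots) : -r ∈ E6Roots := by
  rcases hr with ⟨i, j, hij, hj, ε₁, ε₂, h₁, h₂, rfl⟩ | ⟨h, h5, hodd⟩
  · refine Or.inl ⟨i, j, hij, hj, -ε₁, -ε₂, ?_, ?_, by rw [neg_smul, neg_smul, neg_add]⟩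
    · rcases h₁ with rfl | rfl <;> simp
    · rcases h₂ with rfl | rfl <;> simp
  · have hs : 0 < Real.sqrt 3 := by positivity
    have hne : ∀ i, r i ≠ 0 := by
      intro i
      by_cases hi : (i : ℕ) < 5
      · rcases h i hi with h | h <;> rw [h] <;> norm_num
      · obtain rfl : i = 5 := by omega
        rcases h5 with h | h <;> rw [h] <;> simp
    refine Or.inr ⟨fun i hi => ?_, ?_, ?_⟩
    · rcases h i hi with h | h <;> simp [h]
    · rcases h5 with h | h <;> simp [h]
    · have key : Nat.card {i : Fin 6 // 0 < r i} + Nat.card {i : Fin 6 // 0 < (-r) i} = 6 := by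
        have e : ∀ i, 0 < (-r) i ↔ ¬ 0 < r i := fun i => by
          rw [Pi.neg_apply, neg_pos, not_lt, le_iff_lt_or_eq, or_iff_left (hne i)]
        simp only [e]
        classical
        rw [Nat.card_eq_fintype_card, Nat.card_eq_fintype_card, Fintype.card_subtype_compl]
        have := Fintype.card_subtype_le (fun i => 0 < r i)
        simp only [Fintype.card_fin] at this ⊢
        omega
      rw [Nat.odd_iff] at hodd ⊢
      omega

/-- Two roots that are neither equal nor opposite, both non-orthogonal to `u` and `x`, yield
four such roots together with their negatives. -/
theorem exists_four_roots_of_two {u x r s : Fin 6 → ℝ} (hr : r ∈ E6Roots) (hs : s ∈ E6Roots)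
    (hru : ∑ i, r i * u i ≠ 0) (hrx : ∑ i, r i * x i ≠ 0)
    (hsu : ∑ i, s i * u i ≠ 0) (hsx : ∑ i, s i * x i ≠ 0) (hne : r ≠ s) (hne' : r ≠ -s) :
    ∃ t : Finset (Fin 6 → ℝ), 4 ≤ t.card ∧
      ∀ r ∈ t, r ∈ E6Roots ∧ (∑ i, r i * u i) ≠ 0 ∧ (∑ i, r i * x i) ≠ 0 := by
  classical
  have ne_neg : ∀ v : Fin 6 → ℝ, ∑ i, v i * u i ≠ 0 → v ≠ -v := by
    intro v hv h
    rw [self_eq_neg] at h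
    simp [h] at hv
  refine ⟨{r, -r, s, -s}, ?_, ?_⟩
  · rw [Finset.card_insert_of_notMem, Finset.card_insert_of_notMem,
      Finset.card_insert_of_notMem, Finset.card_singleton]
    · simpa using ne_neg s hsu
    · simp only [Finset.mem_insert, Finset.mem_singleton, not_or, neg_inj]
      exact ⟨fun h => hne' (by rw [← h, neg_neg]), hne⟩
    · simp only [Finset.mem_insert, Finset.mem_singleton, not_or]
      exact ⟨ne_neg r hru, hne, hne'⟩
  · intro t ht
    simp only [Finset.mem_insert, Finset.mem_singleton] at ht
    rcases ht with rfl | rfl | rfl | rfl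
    · exact ⟨hr, hru, hrx⟩
    · exact ⟨neg_mem_E6Roots hr, by simpa using hru, by simpa using hrx⟩
    · exact ⟨hs, hsu, hsx⟩
    · exact ⟨neg_mem_E6Roots hs, by simpa using hsu, by simpa using hsx⟩

/-- The vector `eᵢ + ε eⱼ`. -/
def pairVec (i j : Fin 6) (ε : ℝ) : Fin 6 → ℝ := Pi.single i 1 + ε • Pi.single j 1

theorem pairVec_mem {i j : Fin 6} {ε : ℝ} (hij : i ≠ j) (hi : i ≠ 5) (hj : j ≠ 5)
    (hε : ε = 1 ∨ ε = -1) : pairVec i j ε ∈ E6Roots := by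
  rcases lt_or_gt_of_ne hij with h | h
  · exact Or.inl ⟨i, j, h, by omega, 1, ε, Or.inl rfl, hε, by rw [one_smul, pairVec]⟩
  · exact Or.inl ⟨j, i, h, by omega, ε, 1, hε, Or.inl rfl, by rw [one_smul, pairVec, add_comm]⟩

theorem sum_pairVec_mul (i j : Fin 6) (ε : ℝ) (u : Fin 6 → ℝ) :
    ∑ k, pairVec i j ε k * u k = u i + ε * u j := by
  simp [pairVec, add_mul, Finset.sum_add_distrib, Pi.single_apply]

/-- Some root `eᵢ ± eⱼ` is non-orthogonal to both `u` and `x`. -/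
def PairGood (u x : Fin 6 → ℝ) (i j : Fin 6) : Prop :=
  ∃ ε : ℝ, (ε = 1 ∨ ε = -1) ∧ u i + ε * u j ≠ 0 ∧ x i + ε * x j ≠ 0

theorem pairGood_triangle {u x : Fin 6 → ℝ} {i : Fin 6} (hu : u i ≠ 0) (hx : x i ≠ 0)
    (j k : Fin 6) : PairGood u x i j ∨ PairGood u x i k ∨ PairGood u x j k := by
  have bad : ∀ l, ¬ PairGood u x i l →
      (u l = -u i ∧ x l = x i) ∨ (u l = u i ∧ x l = -x i) := by
    intro l hl
    simp only [PairGood, not_exists, not_and, not_not] at hl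
    have h₁ := hl 1 (Or.inl rfl)
    have h₂ := hl (-1) (Or.inr rfl)
    by_cases ha : u i + 1 * u l = 0
    · have hb : u i + -1 * u l ≠ 0 := fun hb => hu (by linarith)
      exact Or.inl ⟨by linarith, by linarith [h₂ hb]⟩
    · have hb : u i + -1 * u l = 0 := by
        by_contra hb
        exact hx (by linarith [h₁ ha, h₂ hb])
      exact Or.inr ⟨by linarith, by linarith [h₁ ha]⟩
  by_contra! h
  obtain ⟨hj, hk, hjk⟩ := h
  apply hjk
  rcases bad j hj with ⟨h₁, h₂⟩ | ⟨h₁, h₂⟩ <;> rcases bad k hk with ⟨h₃, h₄⟩ | ⟨h₃, h₄⟩ <;>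
    rw [PairGood, h₁, h₂, h₃, h₄]
  · exact ⟨1, Or.inl rfl, fun h => hu (by linarith), fun h => hx (by linarith)⟩
  · exact ⟨-1, Or.inr rfl, fun h => hu (by linarith), fun h => hx (by linarith)⟩
  · exact ⟨-1, Or.inr rfl, fun h => hu (by linarith), fun h => hx (by linarith)⟩
  · exact ⟨1, Or.inl rfl, fun h => hu (by linarith), fun h => hx (by linarith)⟩

theorem exists_four_roots_of_pairGood {u x : Fin 6 → ℝ} {i j k l m : Fin 6}
    (h : PairGood u x i j) (h' : PairGood u x k l) (hij : i ≠ j) (hkl : k ≠ l)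
    (hi : i ≠ 5) (hj : j ≠ 5) (hk : k ≠ 5) (hl : l ≠ 5)
    (hm : m = k ∨ m = l) (hmi : m ≠ i) (hmj : m ≠ j) :
    ∃ t : Finset (Fin 6 → ℝ), 4 ≤ t.card ∧
      ∀ r ∈ t, r ∈ E6Roots ∧ (∑ i, r i * u i) ≠ 0 ∧ (∑ i, r i * x i) ≠ 0 := by
  obtain ⟨ε, hε, hu, hx⟩ := h
  obtain ⟨δ, hδ, hu', hx'⟩ := h'
  have h0 : pairVec i j ε m = 0 := by simp [pairVec, hmi, hmj]
  have h1 : pairVec k l δ m ≠ 0 := by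
    have : δ ≠ 0 := by rcases hδ with rfl | rfl <;> norm_num
    rcases hm with rfl | rfl
    · simp [pairVec, hkl]
    · simpa [pairVec, hkl.symm] using this
  refine exists_four_roots_of_two (pairVec_mem hij hi hj hε) (pairVec_mem hkl hk hl hδ)
    (by rwa [sum_pairVec_mul]) (by rwa [sum_pairVec_mul]) (by rwa [sum_pairVec_mul])
    (by rwa [sum_pairVec_mul]) (fun h => h1 (by rw [← h, h0])) (fun h => h1 ?_)
  rw [h, Pi.neg_apply, neg_eq_zero] at h0
  exact h0

/-- The claim when `u` and `x` have a common nonzero coordinate among the first five. -/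
theorem exists_four_roots_of_common_ne_zero {u x : Fin 6 → ℝ} {i : Fin 6} (hi : i ≠ 5)
    (hu : u i ≠ 0) (hx : x i ≠ 0) :
    ∃ t : Finset (Fin 6 → ℝ), 4 ≤ t.card ∧
      ∀ r ∈ t, r ∈ E6Roots ∧ (∑ i, r i * u i) ≠ 0 ∧ (∑ i, r i * x i) ≠ 0 := by
  obtain ⟨j, k, l, hj, hk, hl, hij, hik, hil, hjk, hjl, hkl⟩ : ∃ j k l : Fin 6,
      j ≠ 5 ∧ k ≠ 5 ∧ l ≠ 5 ∧ i ≠ j ∧ i ≠ k ∧ i ≠ l ∧ j ≠ k ∧ j ≠ l ∧ k ≠ l := by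
    clear hu hx; revert i; decide
  rcases pairGood_triangle hu hx j k with h | h | h
  · rcases pairGood_triangle hu hx k l with h' | h' | h'
    · exact exists_four_roots_of_pairGood (m := k) h h' hij hik hi hj hi hk
        (Or.inr rfl) hik.symm hjk.symm
    · exact exists_four_roots_of_pairGood (m := l) h h' hij hil hi hj hi hl
        (Or.inr rfl) hil.symm hjl.symm
    · exact exists_four_roots_of_pairGood (m := l) h h' hij hkl hi hj hk hl
        (Or.inr rfl) hil.symm hjl.symm
  · rcases pairGood_triangle hu hx j l with h' | h' | h'
    · exact exists_four_roots_of_pairGood (m := j) h h' hik hij hi hk hi hj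
        (Or.inr rfl) hij.symm hjk
    · exact exists_four_roots_of_pairGood (m := l) h h' hik hil hi hk hi hl
        (Or.inr rfl) hil.symm hkl.symm
    · exact exists_four_roots_of_pairGood (m := l) h h' hik hjl hi hk hj hl
        (Or.inr rfl) hil.symm hkl.symm
  · rcases pairGood_triangle hu hx j l with h' | h' | h'
    · exact exists_four_roots_of_pairGood (m := i) h h' hjk hij hj hk hi hj
        (Or.inl rfl) hij hik
    · exact exists_four_roots_of_pairGood (m := i) h h' hjk hil hj hk hi hl
        (Or.inl rfl) hij hik
    · exact exists_four_roots_of_pairGood (m := l) h h' hjk hjl hj hk hj hl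
        (Or.inr rfl) hjl.symm hkl.symm

/-- The claim when both vectors have a nonzero component in the span of `e₁, …, e₅`. -/
theorem exists_four_roots_of_ne_zero {u x : Fin 6 → ℝ} {i j : Fin 6} (hi : i ≠ 5) (hj : j ≠ 5)
    (hu : u i ≠ 0) (hx : x j ≠ 0) :
    ∃ t : Finset (Fin 6 → ℝ), 4 ≤ t.card ∧
      ∀ r ∈ t, r ∈ E6Roots ∧ (∑ i, r i * u i) ≠ 0 ∧ (∑ i, r i * x i) ≠ 0 := by
  by_cases hxi : x i = 0
  swap
  · exact exists_four_roots_of_common_ne_zero hi hu hxi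
  by_cases huj : u j = 0
  swap
  · exact exists_four_roots_of_common_ne_zero hj huj hx
  have hij : i ≠ j := by
    rintro rfl
    exact hx hxi
  refine exists_four_roots_of_two (pairVec_mem hij hi hj (Or.inl rfl))
    (pairVec_mem hij hi hj (Or.inr rfl)) ?_ ?_ ?_ ?_ (fun h => ?_) (fun h => ?_)
  · simpa [sum_pairVec_mul, huj] using hu
  · simpa [sum_pairVec_mul, hxi] using hx
  · simpa [sum_pairVec_mul, huj] using hu
  · simpa [sum_pairVec_mul, hxi] using hx
  · have := congrFun h j
    simp [pairVec, hij.symm] at this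
    linarith
  · have := congrFun h i
    simp [pairVec, hij] at this
    linarith

/-- The vector with entries `±1/2` (`±√3/2` in the last coordinate) and signs given by `σ`. -/
noncomputable def spinVec (σ : Fin 6 → Bool) : Fin 6 → ℝ := fun i =>
  (if σ i then 1 else -1) * (if i = 5 then Real.sqrt 3 / 2 else 1 / 2)

/-- An odd number of signs are positive. -/
def OddSigns (σ : Fin 6 → Bool) : Prop := (Finset.univ.filter fun i => σ i = true).card % 2 = 1

instance : DecidablePred OddSigns := fun _ => inferInstanceAs (Decidable (_ = _))

theorem spinVec_pos_iff (σ : Fin 6 → Bool) (i : Fin 6) : 0 < spinVec σ i ↔ σ i = true := by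
  have h : 0 < (if i = 5 then Real.sqrt 3 / 2 else 1 / 2 : ℝ) := by split_ifs <;> positivity
  unfold spinVec
  rw [mul_pos_iff_of_pos_right h]
  cases σ i <;> norm_num

theorem spinVec_injective : Function.Injective spinVec := by
  intro σ τ h
  funext i
  rw [Bool.eq_iff_iff, ← spinVec_pos_iff, ← spinVec_pos_iff, h]

theorem spinVec_mem {σ : Fin 6 → Bool} (hσ : OddSigns σ) : spinVec σ ∈ E6Roots := by
  refine Or.inr ⟨fun i hi => ?_, ?_, ?_⟩
  · have : i ≠ 5 := by rintro rfl; simp at hi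
    cases h : σ i <;> simp [spinVec, h, this]
  · cases h : σ 5 <;> simp [spinVec, h]
  · simp only [spinVec_pos_iff]
    rw [Nat.card_eq_fintype_card, Fintype.card_subtype, Nat.odd_iff]
    exact hσ

/-- The sign pattern `σ` with the signs at `i` and `j` reversed. -/
def flipSigns (i j : Fin 6) (σ : Fin 6 → Bool) : Fin 6 → Bool := fun k =>
  if k = i ∨ k = j then !σ k else σ k

theorem spinVec_sub_flipSigns {i j : Fin 6} (hij : i ≠ j) (hi : i ≠ 5) (hj : j ≠ 5)
    {σ : Fin 6 → Bool} (h : σ i = true) :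
    spinVec σ - spinVec (flipSigns i j σ) = pairVec i j (if σ j then 1 else -1) := by
  funext k
  by_cases hki : k = i
  · subst hki
    cases hs : σ j <;> simp [spinVec, flipSigns, pairVec, h, hi, hij] <;> norm_num
  by_cases hkj : k = j
  · subst hkj
    cases hk : σ k <;> simp [spinVec, flipSigns, pairVec, hk, hj, hki] <;> norm_num
  · cases hs : σ j <;> simp [spinVec, flipSigns, pairVec, hki, hkj]

theorem exists_two_signs (i : Fin 6) (hi : i ≠ 5) : ∃ j, i ≠ j ∧ j ≠ 5 ∧ ∀ b : Bool,
    ∃ σ τ : Fin 6 → Bool, (OddSigns σ ∧ OddSigns (flipSigns i j σ)) ∧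
      (OddSigns τ ∧ OddSigns (flipSigns i j τ)) ∧ (σ 5 = true ∧ σ i = true ∧ σ j = b) ∧
      (τ 5 = true ∧ τ i = true ∧ τ j = b) ∧
      σ ≠ τ ∧ σ ≠ flipSigns i j τ ∧ flipSigns i j σ ≠ τ ∧ flipSigns i j σ ≠ flipSigns i j τ := by
  fin_cases i
  · refine ⟨1, by decide, by decide, fun b => ⟨![true, b, !b, false, false, true],
      ![true, b, b, true, false, true], ?_⟩⟩
    revert b; decide
  · refine ⟨0, by decide, by decide, fun b => ⟨![b, true, !b, false, false, true],
      ![b, true, b, true, false, true], ?_⟩⟩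
    revert b; decide
  · refine ⟨0, by decide, by decide, fun b => ⟨![b, !b, true, false, false, true],
      ![b, b, true, true, false, true], ?_⟩⟩
    revert b; decide
  · refine ⟨0, by decide, by decide, fun b => ⟨![b, !b, false, true, false, true],
      ![b, b, true, true, false, true], ?_⟩⟩
    revert b; decide
  · refine ⟨0, by decide, by decide, fun b => ⟨![b, !b, false, false, true, true],
      ![b, b, true, false, true, true], ?_⟩⟩
    revert b; decide
  · exact absurd rfl hi

theorem exists_flip_not_orthogonal {x : Fin 6 → ℝ} {i j : Fin 6} (hij : i ≠ j) (hi : i ≠ 5)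
    (hj : j ≠ 5) {σ : Fin 6 → Bool} (hσi : σ i = true) (hσ5 : σ 5 = true)
    (ho : OddSigns σ) (ho' : OddSigns (flipSigns i j σ))
    (hx : x i + (if σ j then 1 else -1) * x j ≠ 0) :
    ∃ τ, (τ = σ ∨ τ = flipSigns i j σ) ∧ OddSigns τ ∧ τ 5 = true ∧
      ∑ k, spinVec τ k * x k ≠ 0 := by
  by_cases h : ∑ k, spinVec σ k * x k = 0
  · refine ⟨_, Or.inr rfl, ho', by simp [flipSigns, hi.symm, hj.symm, hσ5], fun h' => hx ?_⟩
    rw [← sum_pairVec_mul, ← spinVec_sub_flipSigns hij hi hj hσi]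
    simp only [Pi.sub_apply, sub_mul, Finset.sum_sub_distrib, h, h', sub_zero]
  · exact ⟨σ, Or.inl rfl, ho, hσ5, h⟩

/-- A nonzero multiple of `e₆` is non-orthogonal to every half-spin vector. -/
theorem sum_spinVec_mul_ne_zero {u : Fin 6 → ℝ} (hu : u ≠ 0) (h : ∀ i, i ≠ 5 → u i = 0)
    (σ : Fin 6 → Bool) : ∑ k, spinVec σ k * u k ≠ 0 := by
  have hu5 : u 5 ≠ 0 := fun h5 => hu (funext fun i => by
    by_cases hi : i = 5
    · rw [hi, h5, Pi.zero_apply]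
    · exact h i hi)
  rw [Finset.sum_eq_single 5 (fun k _ hk => by rw [h k hk, mul_zero]) (by simp)]
  refine mul_ne_zero ?_ hu5
  cases hs : σ 5 <;> simp [spinVec, hs]

/-- Two positive-ended half-spin roots are non-orthogonal to any given nonzero vector. -/
theorem exists_two_spin_roots {x : Fin 6 → ℝ} (hx : x ≠ 0) :
    ∃ σ τ : Fin 6 → Bool, σ ≠ τ ∧ (OddSigns σ ∧ σ 5 = true ∧ ∑ k, spinVec σ k * x k ≠ 0) ∧
      (OddSigns τ ∧ τ 5 = true ∧ ∑ k, spinVec τ k * x k ≠ 0) := by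
  by_cases h : ∃ i, i ≠ 5 ∧ x i ≠ 0
  · obtain ⟨i, hi, hxi⟩ := h
    obtain ⟨j, hij, hj, hb⟩ := exists_two_signs i hi
    obtain ⟨b, hb'⟩ : ∃ b : Bool, x i + (if b then 1 else -1) * x j ≠ 0 := by
      by_contra! hc
      have h₁ := hc true
      have h₂ := hc false
      simp only [if_true, Bool.false_eq_true, if_false] at h₁ h₂
      exact hxi (by linarith)
    obtain ⟨σ, τ, ⟨hσ, hσ'⟩, ⟨hτ, hτ'⟩, ⟨hσ5, hσi, hσj⟩, ⟨hτ5, hτi, hτj⟩, h₁, h₂, h₃, h₄⟩ := hb b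
    obtain ⟨σ', hs, hsp⟩ :=
      exists_flip_not_orthogonal (x := x) hij hi hj hσi hσ5 hσ hσ' (by rwa [hσj])
    obtain ⟨τ', ht, htp⟩ :=
      exists_flip_not_orthogonal (x := x) hij hi hj hτi hτ5 hτ hτ' (by rwa [hτj])
    refine ⟨σ', τ', ?_, hsp, htp⟩
    rcases hs with rfl | rfl <;> rcases ht with rfl | rfl <;> assumption
  · push Not at h
    have key := sum_spinVec_mul_ne_zero hx h
    exact ⟨![false, false, false, false, false, true], ![true, true, false, false, false, true],
      by decide, ⟨by decide, by decide, key _⟩, ⟨by decide, by decide, key _⟩⟩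

/-- The claim when the first vector is a multiple of `e₆`. -/
theorem exists_four_roots_of_eq_zero {u x : Fin 6 → ℝ} (hu : u ≠ 0) (hx : x ≠ 0)
    (h : ∀ i, i ≠ 5 → u i = 0) :
    ∃ t : Finset (Fin 6 → ℝ), 4 ≤ t.card ∧
      ∀ r ∈ t, r ∈ E6Roots ∧ (∑ i, r i * u i) ≠ 0 ∧ (∑ i, r i * x i) ≠ 0 := by
  have key := sum_spinVec_mul_ne_zero hu h
  obtain ⟨σ, τ, hne, ⟨hσ, hσ5, hσx⟩, ⟨hτ, hτ5, hτx⟩⟩ := exists_two_spin_roots hx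
  refine exists_four_roots_of_two (spinVec_mem hσ) (spinVec_mem hτ) (key σ) hσx (key τ) hτx
    (fun h => hne (spinVec_injective h)) (fun h => ?_)
  have h₁ := (spinVec_pos_iff σ 5).2 hσ5
  have h₂ := (spinVec_pos_iff τ 5).2 hτ5
  rw [h, Pi.neg_apply] at h₁
  linarith

/-- For any two nonzero vectors `u, x ∈ ℝ⁶` there are at least four
distinct roots `r` of the root system of type `E₆` with `⟨r, u⟩ ≠ 0` and `⟨r, x⟩ ≠ 0`. -/
theorem statement8 (u x : Fin 6 → ℝ) (hu : u ≠ 0) (hx : x ≠ 0) :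
    ∃ s : Finset (Fin 6 → ℝ), 4 ≤ s.card ∧
      ∀ r ∈ s, r ∈ E6Roots ∧ (∑ i, r i * u i) ≠ 0 ∧ (∑ i, r i * x i) ≠ 0 := by
  by_cases h : ∀ i, i ≠ 5 → u i = 0
  · exact exists_four_roots_of_eq_zero hu hx h
  by_cases h' : ∀ i, i ≠ 5 → x i = 0
  · obtain ⟨s, hs, hs'⟩ := exists_four_roots_of_eq_zero hx hu h'
    exact ⟨s, hs, fun r hr => ⟨(hs' r hr).1, (hs' r hr).2.2, (hs' r hr).2.1⟩⟩
  push Not at h h'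
  obtain ⟨i, hi, hui⟩ := h
  obtain ⟨j, hj, hxj⟩ := h'
  exact exists_four_roots_of_ne_zero hi hj hui hxj
end

section
/- Let Δ ⊂ ℝ⁷ be the root system of type E₇ in the following realization: Δ consists of the 60 vectors ±eᵢ ± eⱼ (1 ≤ i < j ≤ 6, last coordinate 0), the 64 vectors (c₁, …, c₆, c₇) where cᵢ = ±1/2 for i ≤ 6, c₇ = ±1/√2, and the number of entries among the first six equal to +1/2 is even, and the two vectors (0, …, 0, ±√2). Then for any two nonzero vectors u, x ∈ ℝ⁷ there exist at least four distinct roots r ∈ Δ with ⟨r, u⟩ ≠ 0 and ⟨r, x⟩ ≠ 0, where ⟨·,·⟩ is the standard inner product on ℝ⁷. -/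
/-- The root system of type `E₇` in `ℝ⁷` (in the realization used in the paper): the 60
vectors `±eᵢ ± eⱼ` with `i < j ≤ 6` (last coordinate `0`); the 64 vectors whose first six
coordinates are `±1/2`, whose last coordinate is `±1/√2`, and for which the number of
entries among the first six equal to `+1/2` is even; and the two vectors `(0, …, 0, ±√2)`. -/
def E7Roots : Set (Fin 7 → ℝ) :=
  {r | ∃ i j : Fin 7, i < j ∧ (j : ℕ) < 6 ∧
      ∃ ε₁ ε₂ : ℝ, (ε₁ = 1 ∨ ε₁ = -1) ∧ (ε₂ = 1 ∨ ε₂ = -1) ∧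
      r = ε₁ • (Pi.single i 1 : Fin 7 → ℝ) + ε₂ • (Pi.single j 1 : Fin 7 → ℝ)} ∪
  {r | (∀ i : Fin 7, (i : ℕ) < 6 → (r i = 1 / 2 ∨ r i = -(1 / 2))) ∧
      (r 6 = 1 / Real.sqrt 2 ∨ r 6 = -(1 / Real.sqrt 2)) ∧
      Even (Nat.card {i : Fin 7 // (i : ℕ) < 6 ∧ r i = 1 / 2})} ∪
  {r | r = (Pi.single 6 (Real.sqrt 2) : Fin 7 → ℝ) ∨
      r = -(Pi.single 6 (Real.sqrt 2) : Fin 7 → ℝ)}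

/-- A combination of two distinct coordinate vectors among the first six, with
coefficients `±1`, is a root. -/
lemma E7Roots.mem_of_pair {i j : Fin 6} (hij : i ≠ j) {a b : ℝ} (ha : a = 1 ∨ a = -1)
    (hb : b = 1 ∨ b = -1) :
    a • (Pi.single i.castSucc 1 : Fin 7 → ℝ) + b • (Pi.single j.castSucc 1 : Fin 7 → ℝ)
      ∈ E7Roots := by
  refine Or.inl (Or.inl ?_)
  rcases lt_or_gt_of_ne hij with h | h
  · exact ⟨i.castSucc, j.castSucc, by simpa using h, by simp, a, b, ha, hb, rfl⟩
  · exact ⟨j.castSucc, i.castSucc, by simpa using h, by simp, b, a, hb, ha, add_comm _ _⟩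

/-- The half-spin vector whose coordinates equal to `1/2` are indexed by `S` is a root when `S`
has even cardinality. -/
lemma E7Roots.mem_of_spin (S : Finset (Fin 6)) (hS : Even S.card) {r : Fin 7 → ℝ}
    (h : ∀ m : Fin 6, r m.castSucc = if m ∈ S then 1 / 2 else -(1 / 2))
    (h6 : r 6 = 1 / √2 ∨ r 6 = -(1 / √2)) : r ∈ E7Roots := by
  refine Or.inl (Or.inr ⟨fun i hi => ?_, h6, ?_⟩)
  · have := h ⟨i, hi⟩
    rw [show (⟨i, hi⟩ : Fin 6).castSucc = i from rfl] at this
    rw [this]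
    split_ifs <;> simp
  · have e : {i : Fin 7 // (i : ℕ) < 6 ∧ r i = 1 / 2} ≃ S :=
      { toFun := fun i => ⟨⟨i.1, i.2.1⟩, by
          by_contra hm
          have := h ⟨i.1, i.2.1⟩
          rw [if_neg hm, show (⟨i.1, i.2.1⟩ : Fin 6).castSucc = i.1 from rfl, i.2.2] at this
          norm_num at this⟩
        invFun := fun m => ⟨m.1.castSucc, by simp, by rw [h, if_pos m.2]⟩
        left_inv := fun _ => rfl
        right_inv := fun _ => rfl }
    rw [Nat.card_congr e]
    simpa using hS

/-- The sign change in the sixth coordinate. -/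
def e7Sign (i : Fin 6) : ℝ := if i = 5 then -1 else 1

/-- The sign attached to a boolean. -/
def boolSign (b : Bool) : ℝ := if b then 1 else -1

/-- Eight points of `ℝ⁷` whose pairwise differences are the roots of a subsystem of type `A₇`. -/
noncomputable def e7Point : Fin 6 ⊕ Bool → Fin 7 → ℝ
  | .inl i => e7Sign i • Pi.single i.castSucc 1
  | .inr b => Fin.snoc (fun m => e7Sign m / 2) (boolSign b / √2)

lemma e7Sign_eq (i : Fin 6) : e7Sign i = 1 ∨ e7Sign i = -1 := by
  unfold e7Sign; split_ifs <;> simp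

lemma boolSign_eq (b : Bool) : boolSign b = 1 ∨ boolSign b = -1 := by
  cases b <;> simp [boolSign]

lemma e7Point_inl_castSucc (i m : Fin 6) :
    e7Point (.inl i) m.castSucc = if m = i then e7Sign i else 0 := by
  simp [e7Point, Pi.single_apply]

lemma e7Point_inl_six (i : Fin 6) : e7Point (.inl i) 6 = 0 := by
  have : (6 : Fin 7) ≠ i.castSucc := (Fin.castSucc_lt_last i).ne'
  simp [e7Point, this]

lemma e7Point_inr_castSucc (b : Bool) (m : Fin 6) :
    e7Point (.inr b) m.castSucc = e7Sign m / 2 := by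
  simp only [e7Point, Fin.snoc_castSucc]

lemma e7Point_inr_six (b : Bool) : e7Point (.inr b) 6 = boolSign b / √2 :=
  Fin.snoc_last (n := 6) (α := fun _ => ℝ) _ fun m => e7Sign m / 2

lemma e7Point_inl_dot (i : Fin 6) (u : Fin 7 → ℝ) :
    e7Point (.inl i) ⬝ᵥ u = e7Sign i * u i.castSucc := by
  simp [e7Point]

lemma e7Point_inr_dot (b : Bool) (u : Fin 7 → ℝ) :
    e7Point (.inr b) ⬝ᵥ u =
      (∑ i : Fin 6, e7Sign i * u i.castSucc) / 2 + boolSign b / √2 * u 6 := by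
  simp only [e7Point, dotProduct, Fin.sum_univ_castSucc (n := 6), Fin.snoc_castSucc,
    Fin.snoc_last, Finset.sum_div]
  congr 1
  exact Finset.sum_congr rfl fun i _ => by ring

lemma sum_e7Point_dot (u : Fin 7 → ℝ) :
    ∑ i, e7Point (.inl i) ⬝ᵥ u = e7Point (.inr true) ⬝ᵥ u + e7Point (.inr false) ⬝ᵥ u := by
  simp only [e7Point_inl_dot, e7Point_inr_dot, boolSign]
  simp
  ring

/-- A vector with constant inner products against the eight points vanishes. -/
lemma exists_e7Point_dot_ne {u : Fin 7 → ℝ} (hu : u ≠ 0) :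
    ∃ a b, e7Point a ⬝ᵥ u ≠ e7Point b ⬝ᵥ u := by
  by_contra! h
  apply hu
  have hs := sum_e7Point_dot u
  have h0 : ∀ a, e7Point a ⬝ᵥ u = 0 := by
    have hc : ∀ a, e7Point a ⬝ᵥ u = e7Point (.inl 0) ⬝ᵥ u := fun a => h _ _
    have : e7Point (.inl 0) ⬝ᵥ u = 0 := by
      simp only [hc (.inl _), hc (.inr _)] at hs
      simp at hs
      linarith
    intro a
    rw [hc, this]
  have hi : ∀ i : Fin 6, u i.castSucc = 0 := fun i => by
    have := h0 (.inl i)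
    rw [e7Point_inl_dot] at this
    rcases e7Sign_eq i with h | h <;> simpa [h] using this
  have h6 : u 6 = 0 := by
    have := h0 (.inr true)
    rw [e7Point_inr_dot] at this
    simpa [hi, boolSign] using this
  funext m
  refine Fin.lastCases ?_ ?_ m
  · exact h6
  · exact hi

lemma e7Point_sub_mem {a b : Fin 6 ⊕ Bool} (hab : a ≠ b) :
    e7Point a - e7Point b ∈ E7Roots := by
  have key : ∀ (i : Fin 6) (b : Bool), e7Point (.inl i) - e7Point (.inr b) ∈ E7Roots ∧
      e7Point (.inr b) - e7Point (.inl i) ∈ E7Roots := by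
    intro i b
    constructor
    · refine E7Roots.mem_of_spin (Finset.univ.filter fun m => ¬(m = i ↔ m = 5))
        (by revert i; decide) (fun m => ?_) ?_
      · rw [Pi.sub_apply, e7Point_inl_castSucc, e7Point_inr_castSucc]
        simp only [e7Sign, Finset.mem_filter, Finset.mem_univ, true_and]
        by_cases h1 : m = i <;> by_cases h2 : m = 5 <;> grind
      · rw [Pi.sub_apply, e7Point_inl_six, e7Point_inr_six]
        cases b <;> simp [boolSign, neg_div]
    · refine E7Roots.mem_of_spin (Finset.univ.filter fun m => (m = i ↔ m = 5))
        (by revert i; decide) (fun m => ?_) ?_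
      · rw [Pi.sub_apply, e7Point_inl_castSucc, e7Point_inr_castSucc]
        simp only [e7Sign, Finset.mem_filter, Finset.mem_univ, true_and]
        by_cases h1 : m = i <;> by_cases h2 : m = 5 <;> grind
      · rw [Pi.sub_apply, e7Point_inl_six, e7Point_inr_six]
        cases b <;> simp [boolSign, neg_div]
  rcases a with i | a <;> rcases b with j | b
  · have hij : i ≠ j := fun h => hab (by rw [h])
    have := E7Roots.mem_of_pair hij (e7Sign_eq i) (b := -e7Sign j) (by
      rcases e7Sign_eq j with h | h <;> simp [h])
    simpa [e7Point, sub_eq_add_neg] using this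
  · exact (key i b).1
  · exact (key j a).2
  · have h2 : (2 : ℝ) / √2 = √2 := Real.div_sqrt
    have h : e7Point (.inr a) - e7Point (.inr b) =
        Pi.single 6 ((boolSign a - boolSign b) / √2) := by
      funext m
      refine Fin.lastCases ?_ (fun m => ?_) m
      · rw [show Fin.last 6 = 6 from rfl, Pi.sub_apply, e7Point_inr_six, e7Point_inr_six,
          Pi.single_eq_same, sub_div]
      · rw [Pi.sub_apply, e7Point_inr_castSucc, e7Point_inr_castSucc, sub_self,
          Pi.single_eq_of_ne (show m.castSucc ≠ 6 from (Fin.castSucc_lt_last m).ne)]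
    rw [h]
    refine Or.inr ?_
    cases a <;> cases b <;> simp [boolSign] at hab ⊢
    · right
      rw [show (-1 - 1 : ℝ) / √2 = -√2 by linear_combination -h2, Pi.single_neg]
    · left
      rw [show (1 + 1 : ℝ) / √2 = √2 by linear_combination h2]

lemma e7Sign_mul_self (i : Fin 6) : e7Sign i * e7Sign i = 1 := by
  rcases e7Sign_eq i with h | h <;> simp [h]

lemma e7Point_dot_snoc (t : Fin 6) (a : Fin 6 ⊕ Bool) :
    e7Point a ⬝ᵥ (Fin.snoc (fun i => e7Sign i * (1 - if i = t then 4 else 0)) 0 : Fin 7 → ℝ) =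
      1 + if a = .inl t then -4 else 0 := by
  rcases a with i | b
  · rw [e7Point_inl_dot, Fin.snoc_castSucc, ← mul_assoc, e7Sign_mul_self]
    simp only [Sum.inl.injEq]
    split_ifs <;> norm_num
  · rw [e7Point_inr_dot, show (6 : Fin 7) = Fin.last 6 from rfl, Fin.snoc_last]
    simp only [Fin.snoc_castSucc, ← mul_assoc, e7Sign_mul_self]
    simp
    norm_num

/-- For each of the eight points there is a linear functional which is constant on the others and
takes a different value there. -/
lemma exists_dot_e7Point_eq (t : Fin 6 ⊕ Bool) :
    ∃ v : Fin 7 → ℝ, ∃ d : ℝ, d ≠ 0 ∧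
      ∀ a, e7Point a ⬝ᵥ v = 1 + if a = t then d else 0 := by
  rcases t with t | c
  · exact ⟨_, -4, by norm_num, e7Point_dot_snoc t⟩
  · refine ⟨Fin.snoc e7Sign (boolSign c * (2 * √2)), 4, by norm_num, ?_⟩
    rintro (i | b)
    · rw [e7Point_inl_dot, Fin.snoc_castSucc, e7Sign_mul_self]
      simp
    · rw [e7Point_inr_dot, show (6 : Fin 7) = Fin.last 6 from rfl, Fin.snoc_last]
      simp only [Fin.snoc_castSucc, e7Sign_mul_self]
      have h2 : √2 ≠ 0 := by positivity
      rw [show boolSign b / √2 * (boolSign c * (2 * √2)) = 2 * (boolSign b * boolSign c) by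
        field_simp]
      cases b <;> cases c <;> simp [boolSign] <;> norm_num

lemma e7Point_sub_inj {a b c d : Fin 6 ⊕ Bool} (hab : a ≠ b)
    (h : e7Point a - e7Point b = e7Point c - e7Point d) : a = c ∧ b = d := by
  have key : ∀ t, ((if a = t then 1 else 0) - (if b = t then 1 else 0) : ℤ) =
      (if c = t then 1 else 0) - (if d = t then 1 else 0) := by
    intro t
    obtain ⟨v, e, he, hv⟩ := exists_dot_e7Point_eq t
    have := congrArg (· ⬝ᵥ v) h
    simp only [sub_dotProduct, hv] at this
    split_ifs at this ⊢ <;> first | rfl | (exfalso; apply he; linarith)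
  have ha := key a
  have hb := key b
  grind

lemma e7Point_add_ne (a b : Fin 6 ⊕ Bool) :
    e7Point (.inl 0) + e7Point (.inl 1) ≠ e7Point a - e7Point b := by
  intro h
  have := congrArg (· ⬝ᵥ (Fin.snoc (fun i => e7Sign i * (1 - if i = 0 then 4 else 0)) 0 :
    Fin 7 → ℝ)) h
  simp only [add_dotProduct, sub_dotProduct, e7Point_dot_snoc 0] at this
  split_ifs at this <;> norm_num at this

/-- Two nonconstant functions separate a common pair of points; either they separate a second
one, or both are constant away from a single point. -/
lemma exists_common_separated_pair {ι : Type*} {p q : ι → ℝ} (hp : ∃ a b, p a ≠ p b)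
    (hq : ∃ a b, q a ≠ q b) :
    ∃ i j, p i ≠ p j ∧ q i ≠ q j ∧
      ((∃ k l, p k ≠ p l ∧ q k ≠ q l ∧ ¬(k = i ∧ l = j) ∧ ¬(k = j ∧ l = i)) ∨
        ((∀ k, k ≠ j → p k = p i) ∧ ∀ k, k ≠ i → q k = q j)) := by
  obtain ⟨i, j, hpij, hqij⟩ : ∃ i j, p i ≠ p j ∧ q i ≠ q j := by
    by_contra! h
    obtain ⟨a, b, hab⟩ := hp
    obtain ⟨c, d, hcd⟩ := hq
    have h₁ := h a b hab
    have h₂ := h a c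
    have h₃ := h a d
    have h₄ := h b c
    have h₅ := h b d
    grind
  by_cases h : ∃ k l, p k ≠ p l ∧ q k ≠ q l ∧ ¬(k = i ∧ l = j) ∧ ¬(k = j ∧ l = i)
  · exact ⟨i, j, hpij, hqij, Or.inl h⟩
  · push Not at h
    by_cases h' : (∀ k, k ≠ j → p k = p i) ∧ ∀ k, k ≠ i → q k = q j
    · exact ⟨i, j, hpij, hqij, Or.inr h'⟩
    · refine ⟨j, i, hpij.symm, hqij.symm, Or.inr ?_⟩
      have types : ∀ k, k ≠ i → k ≠ j →
          (p k = p i ∧ q k = q j) ∨ (p k = p j ∧ q k = q i) := by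
        intro k hi hj
        have := h k i
        have := h k j
        grind
      have same : ∀ k l, k ≠ i → k ≠ j → l ≠ i → l ≠ j → p k = p i → p l = p i := by
        intro k l _ _ _ _ _
        have := h k l
        have := types k
        have := types l
        grind
      grind

/-- If the inner product with `u` is constant on the eight points except at one of them, then `u` is not
orthogonal to the root `e₁ + e₂`. -/
lemma e7Point_add_dot_ne {u : Fin 7 → ℝ} {i j : Fin 6 ⊕ Bool}
    (hij : e7Point i ⬝ᵥ u ≠ e7Point j ⬝ᵥ u)
    (h : ∀ k, k ≠ j → e7Point k ⬝ᵥ u = e7Point i ⬝ᵥ u) :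
    (e7Point (.inl 0) + e7Point (.inl 1)) ⬝ᵥ u ≠ 0 := by
  have hs := sum_e7Point_dot u
  rw [add_dotProduct]
  intro h0
  apply hij
  generalize e7Point i ⬝ᵥ u = α at *
  have h' : ∀ k, e7Point k ⬝ᵥ u = if k = j then e7Point j ⬝ᵥ u else α := by
    intro k; split_ifs with hk
    · rw [hk]
    · exact h k hk
  generalize e7Point j ⬝ᵥ u = β at *
  rw [Fin.sum_univ_six] at hs
  simp only [h'] at hs h0
  rcases j with j | b
  · fin_cases j <;> simp at hs h0 <;> linarith
  · cases b <;> simp at hs h0 <;> linarith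

lemma exists_finset_of_two_roots {u x r s : Fin 7 → ℝ} (hr : r ∈ E7Roots) (hr' : -r ∈ E7Roots)
    (hs : s ∈ E7Roots) (hs' : -s ∈ E7Roots) (hru : r ⬝ᵥ u ≠ 0) (hrx : r ⬝ᵥ x ≠ 0)
    (hsu : s ⬝ᵥ u ≠ 0) (hsx : s ⬝ᵥ x ≠ 0) (hrs : r ≠ s) (hrs' : r ≠ -s) :
    ∃ t : Finset (Fin 7 → ℝ), 4 ≤ t.card ∧
      ∀ r ∈ t, r ∈ E7Roots ∧ r ⬝ᵥ u ≠ 0 ∧ r ⬝ᵥ x ≠ 0 := by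
  have ne_neg : ∀ v : Fin 7 → ℝ, v ⬝ᵥ u ≠ 0 → v ≠ -v := by
    intro v hv h
    have := congrArg (· ⬝ᵥ u) h
    simp only [neg_dotProduct] at this
    exact hv (by linarith)
  refine ⟨{r, -r, s, -s}, ?_, ?_⟩
  · rw [Finset.card_insert_of_notMem, Finset.card_insert_of_notMem, Finset.card_insert_of_notMem,
      Finset.card_singleton]
    · simpa using ne_neg s hsu
    · simpa [neg_eq_iff_eq_neg] using ⟨hrs', hrs⟩
    · simpa using ⟨ne_neg r hru, hrs, hrs'⟩
  · simp only [Finset.mem_insert, Finset.mem_singleton]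
    rintro v (rfl | rfl | rfl | rfl) <;> simp_all [neg_dotProduct]

/-- For any two nonzero vectors `u, x ∈ ℝ⁷` there are at least four
distinct roots `r` of the root system of type `E₇` with `⟨r, u⟩ ≠ 0` and `⟨r, x⟩ ≠ 0`. -/
theorem statement9 (u x : Fin 7 → ℝ) (hu : u ≠ 0) (hx : x ≠ 0) :
    ∃ s : Finset (Fin 7 → ℝ), 4 ≤ s.card ∧
      ∀ r ∈ s, r ∈ E7Roots ∧ (∑ i, r i * u i) ≠ 0 ∧ (∑ i, r i * x i) ≠ 0 := by
  obtain ⟨i, j, hpij, hqij, ⟨k, l, hpkl, hqkl, h1, h2⟩ | ⟨hp, hq⟩⟩ :=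
    exists_common_separated_pair (exists_e7Point_dot_ne hu) (exists_e7Point_dot_ne hx)
  · have hij : i ≠ j := by rintro rfl; exact hpij rfl
    have hkl : k ≠ l := by rintro rfl; exact hpkl rfl
    refine exists_finset_of_two_roots (r := e7Point i - e7Point j) (s := e7Point k - e7Point l)
      (e7Point_sub_mem hij) (by simpa using e7Point_sub_mem hij.symm) (e7Point_sub_mem hkl)
      (by simpa using e7Point_sub_mem hkl.symm) ?_ ?_ ?_ ?_ ?_ ?_
    · rwa [sub_dotProduct, sub_ne_zero]
    · rwa [sub_dotProduct, sub_ne_zero]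
    · rwa [sub_dotProduct, sub_ne_zero]
    · rwa [sub_dotProduct, sub_ne_zero]
    · intro h
      obtain ⟨rfl, rfl⟩ := e7Point_sub_inj hij h
      exact h1 ⟨rfl, rfl⟩
    · rw [neg_sub]
      intro h
      obtain ⟨rfl, rfl⟩ := e7Point_sub_inj hij h
      exact h2 ⟨rfl, rfl⟩
  · have hij : i ≠ j := by rintro rfl; exact hpij rfl
    have hadd : e7Point (.inl 0) + e7Point (.inl 1) ∈ E7Roots :=
      E7Roots.mem_of_pair (by decide) (e7Sign_eq 0) (e7Sign_eq 1)
    have hneg : -(e7Point (.inl 0) + e7Point (.inl 1)) ∈ E7Roots := by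
      have := E7Roots.mem_of_pair (i := 0) (j := 1) (a := -1) (b := -1) (by decide)
        (Or.inr rfl) (Or.inr rfl)
      simpa [e7Point, e7Sign, add_comm] using this
    refine exists_finset_of_two_roots (r := e7Point (.inl 0) + e7Point (.inl 1))
      (s := e7Point i - e7Point j) hadd hneg
      (e7Point_sub_mem hij) (by simpa using e7Point_sub_mem hij.symm)
      (e7Point_add_dot_ne hpij hp) (e7Point_add_dot_ne hqij.symm hq) ?_ ?_
      (e7Point_add_ne i j) ?_
    · rwa [sub_dotProduct, sub_ne_zero]
    · rwa [sub_dotProduct, sub_ne_zero]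
    · rw [neg_sub]
      exact e7Point_add_ne j i
end

section
/- Let Δ ⊂ ℝ⁸ be the root system of type E₈ in the following realization: Δ consists of the 112 vectors ±eᵢ ± eⱼ (1 ≤ i < j ≤ 8) together with the 128 vectors (c₁, …, c₈) with every cᵢ = ±1/2 and an even number of minus signs. Then for any two nonzero vectors u, x ∈ ℝ⁸ there exist at least four distinct roots r ∈ Δ with ⟨r, u⟩ ≠ 0 and ⟨r, x⟩ ≠ 0, where ⟨·,·⟩ is the standard inner product on ℝ⁸. -/
/-- The root system of type `E₈` in `ℝ⁸`: the 112 vectors `±eᵢ ± eⱼ` (`i < j`) together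
with the 128 vectors all of whose coordinates are `±1/2` with an even number of minus
signs. -/
def E8Roots : Set (Fin 8 → ℝ) :=
  {r | ∃ i j : Fin 8, i < j ∧ ∃ ε₁ ε₂ : ℝ, (ε₁ = 1 ∨ ε₁ = -1) ∧ (ε₂ = 1 ∨ ε₂ = -1) ∧
      r = ε₁ • (Pi.single i 1 : Fin 8 → ℝ) + ε₂ • (Pi.single j 1 : Fin 8 → ℝ)} ∪
  {r | (∀ i : Fin 8, r i = 1 / 2 ∨ r i = -(1 / 2)) ∧
      Even (Nat.card {i : Fin 8 // r i = -(1 / 2)})}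

/-- The vector `e_a + s e_b` is a root for distinct `a`, `b` and `s = ±1`. -/
lemma single_add_smul_single_mem_E8Roots {a b : Fin 8} (hab : a ≠ b) {s : ℝ}
    (hs : s = 1 ∨ s = -1) :
    (Pi.single a 1 + s • Pi.single b 1 : Fin 8 → ℝ) ∈ E8Roots := by
  rcases lt_or_gt_of_ne hab with h | h
  · exact Or.inl ⟨a, b, h, 1, s, Or.inl rfl, hs, by simp⟩
  · exact Or.inl ⟨b, a, h, s, 1, hs, Or.inl rfl, by simp [add_comm]⟩

/-- The negative of `e_a + s e_b` is a root for distinct `a`, `b` and `s = ±1`. -/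
lemma neg_single_add_smul_single_mem_E8Roots {a b : Fin 8} (hab : a ≠ b) {s : ℝ}
    (hs : s = 1 ∨ s = -1) :
    -(Pi.single a 1 + s • Pi.single b 1 : Fin 8 → ℝ) ∈ E8Roots := by
  have hs' : -s = 1 ∨ -s = -1 := by
    rcases hs with rfl | rfl <;> simp
  rcases lt_or_gt_of_ne hab with h | h
  · exact Or.inl ⟨a, b, h, -1, -s, Or.inr rfl, hs', by simp; abel⟩
  · exact Or.inl ⟨b, a, h, -s, -1, hs', Or.inr rfl, by simp⟩

lemma sum_single_add_smul_single_mul (a b : Fin 8) (s : ℝ) (u : Fin 8 → ℝ) :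
    ∑ i, (Pi.single a 1 + s • Pi.single b 1 : Fin 8 → ℝ) i * u i = u a + s * u b := by
  simp [Pi.single_apply, add_mul, Finset.sum_add_distrib]

/-- `r` and `-r` are roots, and `r` is orthogonal to neither `u` nor `x`. -/
def IsCommonNonorthogonalRoot (u x r : Fin 8 → ℝ) : Prop :=
  r ∈ E8Roots ∧ -r ∈ E8Roots ∧ (∑ i, r i * u i) ≠ 0 ∧ (∑ i, r i * x i) ≠ 0

lemma isCommonNonorthogonalRoot_single_add_smul_single {u x : Fin 8 → ℝ} {a b : Fin 8}
    (hab : a ≠ b) {s : ℝ} (hs : s = 1 ∨ s = -1) (hu : u a + s * u b ≠ 0)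
    (hx : x a + s * x b ≠ 0) :
    IsCommonNonorthogonalRoot u x (Pi.single a 1 + s • Pi.single b 1) :=
  ⟨single_add_smul_single_mem_E8Roots hab hs, neg_single_add_smul_single_mem_E8Roots hab hs,
    by rwa [sum_single_add_smul_single_mul], by rwa [sum_single_add_smul_single_mul]⟩

lemma exists_four_roots_of_pair {u x r t : Fin 8 → ℝ} (hr : IsCommonNonorthogonalRoot u x r)
    (ht : IsCommonNonorthogonalRoot u x t) (hrt : r ≠ t) (hrt' : r ≠ -t) :
    ∃ s : Finset (Fin 8 → ℝ), 4 ≤ s.card ∧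
      ∀ r ∈ s, r ∈ E8Roots ∧ (∑ i, r i * u i) ≠ 0 ∧ (∑ i, r i * x i) ≠ 0 := by
  classical
  obtain ⟨hr1, hr2, hr3, hr4⟩ := hr
  obtain ⟨ht1, ht2, ht3, ht4⟩ := ht
  have hr0 : r ≠ -r := by
    intro h
    rw [self_eq_neg] at h
    simp [h] at hr3
  have ht0 : t ≠ -t := by
    intro h
    rw [self_eq_neg] at h
    simp [h] at ht3
  refine ⟨{r, -r, t, -t}, ?_, ?_⟩
  · rw [Finset.card_insert_of_notMem, Finset.card_insert_of_notMem,
      Finset.card_pair ht0]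
    · simp only [Finset.mem_insert, Finset.mem_singleton, neg_inj, not_or]
      exact ⟨fun h => hrt' (neg_eq_iff_eq_neg.mp h), hrt⟩
    · simp only [Finset.mem_insert, Finset.mem_singleton, not_or]
      exact ⟨hr0, hrt, hrt'⟩
  · intro v hv
    simp only [Finset.mem_insert, Finset.mem_singleton] at hv
    rcases hv with rfl | rfl | rfl | rfl
    · exact ⟨hr1, hr3, hr4⟩
    · exact ⟨hr2, by simpa using hr3, by simpa using hr4⟩
    · exact ⟨ht1, ht3, ht4⟩
    · exact ⟨ht2, by simpa using ht3, by simpa using ht4⟩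

/-- If neither sign `s = ±1` makes both `p + s q` and `y + s z` nonzero, while `p, y ≠ 0`, then
`q z = -(p y)`. -/
lemma exists_sign_or_mul_eq_neg {p q y z : ℝ} (hp : p ≠ 0) (hy : y ≠ 0) :
    (∃ s : ℝ, (s = 1 ∨ s = -1) ∧ p + s * q ≠ 0 ∧ y + s * z ≠ 0) ∨ q * z = -(p * y) := by
  by_contra! h
  obtain ⟨h, hne⟩ := h
  have h1 := h 1 (Or.inl rfl)
  have h2 := h (-1) (Or.inr rfl)
  by_cases hq : p + 1 * q = 0
  · by_cases hq' : p + -1 * q = 0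
    · exact hp (by linarith)
    · have := h2 hq'
      exact hne (by rw [show q = -p by linarith, show z = y by linarith]; ring)
  · have hz := h1 hq
    by_cases hq' : p + -1 * q = 0
    · exact hne (by rw [show q = p by linarith, show z = -y by linarith]; ring)
    · have := h2 hq'
      exact hy (by linarith)

/-- Among three distinct coordinates, one of which is nonzero in both `u` and `x`, two support a
root orthogonal to neither `u` nor `x`. -/
lemma exists_isCommonNonorthogonalRoot_of_triple {u x : Fin 8 → ℝ} {i j k : Fin 8} (hij : i ≠ j)
    (hik : i ≠ k) (hjk : j ≠ k) (hu : u i ≠ 0) (hx : x i ≠ 0) :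
    ∃ r, IsCommonNonorthogonalRoot u x r ∧ (∀ l, l ≠ i → l ≠ j → l ≠ k → r l = 0) ∧
      (r j ≠ 0 ∨ r k ≠ 0) := by
  have key : ∀ a b : Fin 8, a ≠ b → u a ≠ 0 → x a ≠ 0 →
      (∃ r, IsCommonNonorthogonalRoot u x r ∧ (∀ l, l ≠ a → l ≠ b → r l = 0) ∧ r b ≠ 0) ∨
        u b * x b = -(u a * x a) := by
    intro a b hab ha ha'
    refine (exists_sign_or_mul_eq_neg ha ha').imp_left ?_
    rintro ⟨s, hs, h1, h2⟩
    refine ⟨_, isCommonNonorthogonalRoot_single_add_smul_single hab hs h1 h2, ?_, ?_⟩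
    · intro l hla hlb
      simp [hla, hlb]
    · rcases hs with rfl | rfl <;> simp [hab.symm]
  rcases key i j hij hu hx with ⟨r, hr, h0, hj⟩ | hj
  · exact ⟨r, hr, fun l h1 h2 _ => h0 l h1 h2, Or.inl hj⟩
  rcases key i k hik hu hx with ⟨r, hr, h0, hk⟩ | hk
  · exact ⟨r, hr, fun l h1 _ h3 => h0 l h1 h3, Or.inr hk⟩
  have hne : u i * x i ≠ 0 := mul_ne_zero hu hx
  have hjne : u j * x j ≠ 0 := by rw [hj]; exact neg_ne_zero.mpr hne
  rcases key j k hjk (left_ne_zero_of_mul hjne) (right_ne_zero_of_mul hjne) with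
    ⟨r, hr, h0, hk'⟩ | hk'
  · exact ⟨r, hr, fun l _ h2 h3 => h0 l h2 h3, Or.inr hk'⟩
  · exact absurd (by linarith) hne

/-- For any two nonzero vectors `u, x ∈ ℝ⁸` there are at least four
distinct roots `r` of the root system of type `E₈` with `⟨r, u⟩ ≠ 0` and `⟨r, x⟩ ≠ 0`. -/
theorem statement10 (u x : Fin 8 → ℝ) (hu : u ≠ 0) (hx : x ≠ 0) :
    ∃ s : Finset (Fin 8 → ℝ), 4 ≤ s.card ∧
      ∀ r ∈ s, r ∈ E8Roots ∧ (∑ i, r i * u i) ≠ 0 ∧ (∑ i, r i * x i) ≠ 0 := by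
  by_cases hcommon : ∃ i, u i ≠ 0 ∧ x i ≠ 0
  · obtain ⟨i, hui, hxi⟩ := hcommon
    have hidx : ∀ i : Fin 8, i ≠ i + 1 ∧ i ≠ i + 2 ∧ i + 1 ≠ i + 2 ∧ i ≠ i + 3 ∧ i ≠ i + 4 ∧
        i + 3 ≠ i + 4 ∧ i + 1 ≠ i + 3 ∧ i + 1 ≠ i + 4 ∧ i + 2 ≠ i + 3 ∧ i + 2 ≠ i + 4 := by
      decide
    obtain ⟨h01, h02, h12, h03, h04, h34, h13, h14, h23, h24⟩ := hidx i
    obtain ⟨r, hr, -, hrne⟩ := exists_isCommonNonorthogonalRoot_of_triple h01 h02 h12 hui hxi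
    obtain ⟨t, ht, ht0, -⟩ := exists_isCommonNonorthogonalRoot_of_triple h03 h04 h34 hui hxi
    have ht1 := ht0 _ h01.symm h13 h14
    have ht2 := ht0 _ h02.symm h23 h24
    refine exists_four_roots_of_pair hr ht ?_ ?_
    · rintro rfl
      exact hrne.elim (· ht1) (· ht2)
    · rintro rfl
      exact hrne.elim (· (by simp [ht1])) (· (by simp [ht2]))
  · push Not at hcommon
    obtain ⟨i, hi⟩ := Function.ne_iff.mp hu
    obtain ⟨j, hj⟩ := Function.ne_iff.mp hx
    have hxi : x i = 0 := hcommon i hi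
    have huj : u j = 0 := by
      by_contra h
      exact hj (hcommon j h)
    have hij : i ≠ j := by
      rintro rfl
      exact hi huj
    rw [Pi.zero_apply] at hi hj
    refine exists_four_roots_of_pair
      (isCommonNonorthogonalRoot_single_add_smul_single hij (Or.inl rfl)
        (by simpa [huj] using hi) (by simpa [hxi] using hj))
      (isCommonNonorthogonalRoot_single_add_smul_single hij (Or.inr rfl)
        (by simpa [huj] using hi) (by simpa [hxi] using hj)) ?_ ?_
    · intro h
      have := congrFun h j
      simp [hij.symm] at this
      linarith
    · intro h
      have := congrFun h i
      simp [hij] at this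
      linarith
end

section
/- Let n ≥ 2 and let U, X ∈ su(n+1) be nonzero elements with UX = XU. Then the real linear subspace of su(n+1) spanned by {[U, [X, W]] : W ∈ su(n+1)} has real dimension at least 2. -/
open Matrix

/-- A matrix that annihilates every joint eigenvector of two commuting skew-Hermitian matrices
vanishes. -/
theorem eq_zero_of_forall_joint_eigenvector {ι : Type*} [Fintype ι] [DecidableEq ι]
    {U X C : Matrix ι ι ℂ} (hU : Uᴴ = -U) (hX : Xᴴ = -X) (hUX : U * X = X * U)
    (hC : ∀ (v : ι → ℂ) (a b : ℂ), U *ᵥ v = a • v → X *ᵥ v = b • v → C *ᵥ v = 0) :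
    C = 0 := by
  have hA : (Complex.I • U).IsHermitian := by
    simp [Matrix.IsHermitian, conjTranspose_smul, hU]
  have hB : (Complex.I • X).IsHermitian := by
    simp [Matrix.IsHermitian, conjTranspose_smul, hX]
  have hcomm : Commute (toEuclideanLin (Complex.I • U)) (toEuclideanLin (Complex.I • X)) := by
    refine LinearMap.ext fun v => ?_
    simp [toLpLin_apply, mulVec_mulVec, hUX]
  have hI : ∀ {M : Matrix ι ι ℂ} {v : EuclideanSpace ℂ ι} {a : ℂ},
      toEuclideanLin (Complex.I • M) v = a • v → M *ᵥ v.ofLp = (-Complex.I * a) • v.ofLp := by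
    intro M v a h
    have h' := congrArg WithLp.ofLp h
    rw [ofLp_toLpLin, toLin'_apply, smul_mulVec, WithLp.ofLp_smul] at h'
    rw [mul_smul, ← h', smul_smul]
    simp
  have htop := (isSymmetric_toEuclideanLin_iff.mpr hA)
    |>.iSup_iSup_eigenspace_inf_eigenspace_eq_top_of_commute
      (isSymmetric_toEuclideanLin_iff.mpr hB) hcomm
  have hker : LinearMap.ker (toEuclideanLin C) = ⊤ := by
    rw [eq_top_iff, ← htop]
    refine iSup_le fun a => iSup_le fun b v hv => ?_
    obtain ⟨hva, hvb⟩ := Submodule.mem_inf.mp hv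
    rw [LinearMap.mem_ker, toLpLin_apply,
      hC _ _ _ (hI (Module.End.mem_eigenspace_iff.mp hva))
        (hI (Module.End.mem_eigenspace_iff.mp hvb))]
    rfl
  exact toEuclideanLin.map_eq_zero_iff.mp (LinearMap.ker_eq_top.mp hker)

/-- A traceless nonzero matrix does not act by one and the same scalar on all joint eigenvectors of
two commuting skew-Hermitian matrices. -/
theorem exists_joint_eigenvector_mulVec_ne {ι : Type*} [Fintype ι] [DecidableEq ι] [Nonempty ι]
    {U X C : Matrix ι ι ℂ} (hU : Uᴴ = -U) (hX : Xᴴ = -X) (hUX : U * X = X * U)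
    (htr : C.trace = 0) (hC : C ≠ 0) (c : ℂ) :
    ∃ (v : ι → ℂ) (a b : ℂ), U *ᵥ v = a • v ∧ X *ᵥ v = b • v ∧ C *ᵥ v ≠ c • v := by
  by_contra! h
  have h0 : C - c • 1 = 0 := eq_zero_of_forall_joint_eigenvector hU hX hUX fun v a b ha hb => by
    rw [sub_mulVec, h v a b ha hb, smul_mulVec, one_mulVec, sub_self]
  rw [sub_eq_zero] at h0
  have hc : c = 0 := by simpa [h0] using htr
  exact hC (by rw [h0, hc, zero_smul])

/-- Two commuting nonzero traceless skew-Hermitian matrices have two joint eigenvectors whose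
eigenvalues differ for both matrices. -/
theorem exists_joint_eigenvectors_ne {ι : Type*} [Fintype ι] [DecidableEq ι] [Nonempty ι]
    {U X : Matrix ι ι ℂ} (hU : Uᴴ = -U) (hUtr : U.trace = 0) (hU0 : U ≠ 0)
    (hX : Xᴴ = -X) (hXtr : X.trace = 0) (hX0 : X ≠ 0) (hUX : U * X = X * U) :
    ∃ (v w : ι → ℂ) (a b a' b' : ℂ), v ≠ 0 ∧ w ≠ 0 ∧ U *ᵥ v = a • v ∧ X *ᵥ v = b • v ∧
      U *ᵥ w = a' • w ∧ X *ᵥ w = b' • w ∧ a ≠ a' ∧ b ≠ b' := by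
  have key₁ : ∀ c, ∃ (v : ι → ℂ) (a b : ℂ), v ≠ 0 ∧ U *ᵥ v = a • v ∧ X *ᵥ v = b • v ∧ a ≠ c := by
    intro c
    obtain ⟨v, a, b, ha, hb, h⟩ := exists_joint_eigenvector_mulVec_ne hU hX hUX hUtr hU0 c
    refine ⟨v, a, b, ?_, ha, hb, ?_⟩
    · rintro rfl
      simp at h
    · rintro rfl
      exact h ha
  have key₂ : ∀ c, ∃ (v : ι → ℂ) (a b : ℂ), v ≠ 0 ∧ U *ᵥ v = a • v ∧ X *ᵥ v = b • v ∧ b ≠ c := by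
    intro c
    obtain ⟨v, a, b, ha, hb, h⟩ := exists_joint_eigenvector_mulVec_ne hU hX hUX hXtr hX0 c
    refine ⟨v, a, b, ?_, ha, hb, ?_⟩
    · rintro rfl
      simp at h
    · rintro rfl
      exact h hb
  obtain ⟨p, a₁, b₁, hp, hpa, hpb, -⟩ := key₁ 0
  obtain ⟨q, a₂, b₂, hq, hqa, hqb, h₁₂⟩ := key₁ a₁
  by_cases hb : b₂ = b₁
  · subst hb
    obtain ⟨r, a₃, b₃, hr, hra, hrb, h₃⟩ := key₂ b₂
    by_cases ha : a₃ = a₁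
    · subst ha
      exact ⟨q, r, a₂, b₂, a₃, b₃, hq, hr, hqa, hqb, hra, hrb, h₁₂, h₃.symm⟩
    · exact ⟨r, p, a₃, b₃, a₁, b₂, hr, hp, hra, hrb, hpa, hpb, ha, h₃⟩
  · exact ⟨q, p, a₂, b₂, a₁, b₁, hq, hp, hqa, hqb, hpa, hpb, h₁₂, hb⟩

/-- The conjugate of an eigenvector of a skew-Hermitian matrix is a left eigenvector for the same
eigenvalue. -/
theorem star_vecMul_of_skew {ι : Type*} [Fintype ι] {U : Matrix ι ι ℂ} (hU : Uᴴ = -U)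
    {v : ι → ℂ} {a : ℂ} (hv : v ≠ 0) (ha : U *ᵥ v = a • v) : star v ᵥ* U = a • star v := by
  have h : star v ᵥ* U = (-star a) • star v := by
    have h' := congrArg star ha
    rw [star_mulVec, hU, vecMul_neg, star_smul] at h'
    rw [neg_smul, ← h', neg_neg]
  have hvv : star v ⬝ᵥ v ≠ 0 := fun h0 =>
    hv (by open scoped ComplexOrder in exact dotProduct_star_self_eq_zero.mp h0)
  have h2 : (-star a) * (star v ⬝ᵥ v) = a * (star v ⬝ᵥ v) := by
    rw [← smul_eq_mul, ← smul_eq_mul, ← smul_dotProduct, ← h, ← dotProduct_mulVec, ha,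
      dotProduct_smul]
  rw [h, mul_right_cancel₀ hvv h2]

theorem lie_vecMulVec_star {ι : Type*} [Fintype ι] [DecidableEq ι] {U : Matrix ι ι ℂ}
    (hU : Uᴴ = -U) {v w : ι → ℂ} {a b : ℂ} (hw : w ≠ 0)
    (ha : U *ᵥ v = a • v) (hb : U *ᵥ w = b • w) :
    ⁅U, vecMulVec v (star w)⁆ = (a - b) • vecMulVec v (star w) := by
  rw [Ring.lie_def, mul_vecMulVec, vecMulVec_mul, ha, star_vecMul_of_skew hU hw hb,
    smul_vecMulVec, vecMulVec_smul, sub_smul]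

theorem lie_smul_sub_smul {ι : Type*} [Fintype ι] (U A B : Matrix ι ι ℂ) (y z : ℂ) :
    ⁅U, y • A - z • B⁆ = y • ⁅U, A⁆ - z • ⁅U, B⁆ := by
  simp only [Ring.lie_def, mul_sub, sub_mul, mul_smul_comm, smul_mul_assoc]
  module

/-- Eigenvectors of a skew-Hermitian matrix for different eigenvalues are orthogonal. -/
theorem star_dotProduct_eq_zero_of_skew {ι : Type*} [Fintype ι] {U : Matrix ι ι ℂ}
    (hU : Uᴴ = -U) {v w : ι → ℂ} {a b : ℂ} (hv : v ≠ 0) (hab : a ≠ b)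
    (ha : U *ᵥ v = a • v) (hb : U *ᵥ w = b • w) : star v ⬝ᵥ w = 0 := by
  have h : a * (star v ⬝ᵥ w) = b * (star v ⬝ᵥ w) := by
    rw [← smul_eq_mul, ← smul_eq_mul, ← smul_dotProduct, ← star_vecMul_of_skew hU hv ha,
      ← dotProduct_mulVec, hb, dotProduct_smul]
  by_contra h0
  exact hab (mul_right_cancel₀ h0 h)

/-- Let `n ≥ 2` and let `U, X ∈ su(n+1)` (skew-Hermitian traceless
complex matrices) be nonzero commuting elements. Then the real span of
`{[U, [X, W]] : W ∈ su(n+1)}` has real dimension at least `2`. -/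
theorem statement11 (n : ℕ) (hn : 2 ≤ n)
    (U X : Matrix (Fin (n + 1)) (Fin (n + 1)) ℂ)
    (hUskew : Uᴴ = -U) (hUtr : U.trace = 0) (hUne : U ≠ 0)
    (hXskew : Xᴴ = -X) (hXtr : X.trace = 0) (hXne : X ≠ 0)
    (hcomm : U * X = X * U) :
    2 ≤ Module.finrank ℝ (Submodule.span ℝ
      {m : Matrix (Fin (n + 1)) (Fin (n + 1)) ℂ |
        ∃ W : Matrix (Fin (n + 1)) (Fin (n + 1)) ℂ,
          Wᴴ = -W ∧ W.trace = 0 ∧ m = ⁅U, ⁅X, W⁆⁆}) := by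
  obtain ⟨v, w, a, b, a', b', hv, hw, hva, hvb, hwa, hwb, ha, hb⟩ :=
    exists_joint_eigenvectors_ne hUskew hUtr hUne hXskew hXtr hXne hcomm
  have hvw : star v ⬝ᵥ w = 0 := star_dotProduct_eq_zero_of_skew hUskew hv ha hva hwa
  have hwv : star w ⬝ᵥ v = 0 := star_dotProduct_eq_zero_of_skew hUskew hw ha.symm hwa hva
  have hww : star w ⬝ᵥ w ≠ 0 := fun h0 =>
    hw (by open scoped ComplexOrder in exact dotProduct_star_self_eq_zero.mp h0)
  set E := vecMulVec v (star w) with hE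
  set F := vecMulVec w (star v) with hF
  have hEF : Eᴴ = F := by rw [hE, conjTranspose_vecMulVec, star_star]
  have hFE : Fᴴ = E := by rw [hF, conjTranspose_vecMulVec, star_star]
  set c := (a - a') * (b - b') with hc
  have hc0 : c ≠ 0 := mul_ne_zero (sub_ne_zero.mpr ha) (sub_ne_zero.mpr hb)
  have hmem : ∀ z : ℂ, c • (z • E - star z • F) ∈ {m : Matrix (Fin (n + 1)) (Fin (n + 1)) ℂ |
        ∃ W : Matrix (Fin (n + 1)) (Fin (n + 1)) ℂ,
          Wᴴ = -W ∧ W.trace = 0 ∧ m = ⁅U, ⁅X, W⁆⁆} := by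
    intro z
    refine ⟨z • E - star z • F, ?_, ?_, ?_⟩
    · rw [conjTranspose_sub, conjTranspose_smul, conjTranspose_smul, hEF, hFE, star_star, neg_sub]
    · rw [trace_sub, trace_smul, trace_smul, hE, hF, trace_vecMulVec, trace_vecMulVec,
        dotProduct_comm v, dotProduct_comm w, hvw, hwv]
      simp
    · rw [lie_smul_sub_smul, lie_vecMulVec_star hXskew hw hvb hwb,
        lie_vecMulVec_star hXskew hv hwb hvb, smul_smul, smul_smul, lie_smul_sub_smul,
        lie_vecMulVec_star hUskew hw hva hwa, lie_vecMulVec_star hUskew hv hwa hva, hc]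
      module
  have hli : LinearIndependent ℝ ![c • ((1 : ℂ) • E - star (1 : ℂ) • F),
      c • (Complex.I • E - star Complex.I • F)] := by
    rw [LinearIndependent.pair_iff]
    intro s t hst
    have hEw : E *ᵥ w = (star w ⬝ᵥ w) • v := by
      rw [hE, vecMulVec_mulVec, op_smul_eq_smul]
    have hFw : F *ᵥ w = 0 := by
      rw [hF, vecMulVec_mulVec, hvw, op_smul_eq_smul, zero_smul]
    have h := congrArg (fun M => M *ᵥ w) hst
    simp only [add_mulVec, smul_mulVec, sub_mulVec, hEw, hFw, zero_mulVec, smul_zero,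
      sub_zero] at h
    have h' : (((s : ℂ) + t * Complex.I) * (c * (star w ⬝ᵥ w))) • v = 0 := by
      rw [← h]
      simp only [← Complex.coe_smul]
      module
    have h0 : (s : ℂ) + t * Complex.I = 0 := by
      simpa [hv, hc0, hww, hw] using h'
    exact ⟨by simpa using congrArg Complex.re h0, by simpa using congrArg Complex.im h0⟩
  have hcard := finrank_span_eq_card hli
  rw [Fintype.card_fin] at hcard
  refine hcard.ge.trans (Submodule.finrank_mono (Submodule.span_mono ?_))
  rintro _ ⟨i, rfl⟩
  fin_cases i
  · exact hmem 1
  · exact hmem Complex.I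
end

section
/- Let n ≥ 2 and let U, X ∈ su(n+1) be nonzero elements with UX = XU such that the real linear span of {[U, [X, W]] : W ∈ su(n+1)} has real dimension exactly 2. Then there exist a unitary (n+1)×(n+1) matrix P and nonzero real numbers a, b such that P⁻¹UP = a·√(−1)·diag(−n, 1, …, 1) and P⁻¹XP = b·√(−1)·diag(1, −n, 1, …, 1). -/
open Matrix

/-- Two commuting Hermitian matrices are diagonalized by a common unitary matrix. -/
theorem Matrix.IsHermitian.exists_unitary_diagonal_of_commute {n : ℕ}
    {A B : Matrix (Fin n) (Fin n) ℂ} (hA : A.IsHermitian) (hB : B.IsHermitian)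
    (hAB : Commute A B) :
    ∃ P ∈ unitaryGroup (Fin n) ℂ, ∃ α β : Fin n → ℝ,
      star P * A * P = diagonal (fun i => (α i : ℂ)) ∧
      star P * B * P = diagonal (fun i => (β i : ℂ)) := by
  classical
  have hA' := isSymmetric_toEuclideanLin_iff.mpr hA
  have hB' := isSymmetric_toEuclideanLin_iff.mpr hB
  have hAB' : Commute (toEuclideanLin A) (toEuclideanLin B) := by
    ext v i
    simp [toLpLin_apply, mulVec_mulVec, hAB.eq]
  have hV := LinearMap.IsSymmetric.orthogonalFamily_eigenspace_inf_eigenspace hA' hB'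
  have hI := LinearMap.IsSymmetric.directSum_isInternal_of_commute hA' hB' hAB'
  have hfin := WellFoundedGT.finite_ne_bot_of_iSupIndep hI.submodule_iSupIndep
  have hI' := DirectSum.isInternal_ne_bot_iff.mpr hI
  have hV' := hV.comp (Subtype.val_injective (p := fun i : ℂ × ℂ =>
    Module.End.eigenspace (toEuclideanLin A) i.2 ⊓
      Module.End.eigenspace (toEuclideanLin B) i.1 ≠ ⊥))
  have : Fintype {i : ℂ × ℂ // Module.End.eigenspace (toEuclideanLin A) i.2 ⊓
      Module.End.eigenspace (toEuclideanLin B) i.1 ≠ ⊥} := hfin.fintype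
  have hn : Module.finrank ℂ (EuclideanSpace ℂ (Fin n)) = n := finrank_euclideanSpace_fin
  let b := hI'.subordinateOrthonormalBasis hn hV'
  let χ := fun j => (hI'.subordinateOrthonormalBasisIndex hn j hV').1
  have hb : ∀ j, b j ∈ Module.End.eigenspace (toEuclideanLin A) (χ j).2 ⊓
      Module.End.eigenspace (toEuclideanLin B) (χ j).1 := fun j =>
    hI'.subordinateOrthonormalBasis_subordinate hn j hV'
  let P := (EuclideanSpace.basisFun (Fin n) ℂ).toBasis.toMatrix b.toBasis
  have hP : P ∈ unitaryGroup (Fin n) ℂ :=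
    (EuclideanSpace.basisFun (Fin n) ℂ).toMatrix_orthonormalBasis_mem_unitary b
  have hPapp : ∀ i j, P i j = b j i := fun i j => by
    simp [P, Module.Basis.toMatrix_apply]
  have key : ∀ C : Matrix (Fin n) (Fin n) ℂ, C.IsHermitian → ∀ d : Fin n → ℂ,
      (∀ j, b j ∈ Module.End.eigenspace (toEuclideanLin C) (d j)) →
      ∃ α : Fin n → ℝ, star P * C * P = diagonal (fun i => (α i : ℂ)) := by
    intro C hC d hd
    have h1 : C * P = P * diagonal d := by
      ext i j
      have := congrArg (fun v => v i) (Module.End.mem_eigenspace_iff.mp (hd j))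
      simp only [toLpLin_apply, PiLp.smul_apply, smul_eq_mul, mulVec, dotProduct] at this
      rw [mul_diagonal, mul_comm (P i j)]
      simp only [mul_apply, hPapp, this]
    have h2 : star P * C * P = diagonal d := by
      rw [mul_assoc, h1, ← mul_assoc, mem_unitaryGroup_iff'.mp hP, one_mul]
    have h3 : (diagonal d).IsHermitian := by
      rw [← h2]
      exact isHermitian_conjTranspose_mul_mul P hC
    refine ⟨fun i => (d i).re, ?_⟩
    rw [h2]
    congr 1
    funext i
    have := h3.apply i i
    simp only [diagonal_apply_eq] at this
    exact (Complex.conj_eq_iff_re.mp this).symm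
  obtain ⟨α, hα⟩ := key A hA _ fun j => (hb j).1
  obtain ⟨β, hβ⟩ := key B hB _ fun j => (hb j).2
  exact ⟨P, hP, α, β, hα, hβ⟩

/-- Two commuting skew-Hermitian matrices are diagonalized by a common unitary matrix. -/
theorem Matrix.exists_unitary_diagonal_of_skewHermitian_of_commute {n : ℕ}
    {U X : Matrix (Fin n) (Fin n) ℂ} (hU : Uᴴ = -U) (hX : Xᴴ = -X) (hUX : U * X = X * U) :
    ∃ P ∈ unitaryGroup (Fin n) ℂ, ∃ α β : Fin n → ℝ,
      star P * U * P = diagonal (fun i => Complex.I * α i) ∧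
      star P * X * P = diagonal (fun i => Complex.I * β i) := by
  have herm : ∀ {Y : Matrix (Fin n) (Fin n) ℂ}, Yᴴ = -Y → (-Complex.I • Y).IsHermitian := by
    intro Y hY
    simp [IsHermitian, conjTranspose_smul, hY]
  obtain ⟨P, hP, α, β, hα, hβ⟩ := (herm hU).exists_unitary_diagonal_of_commute (herm hX)
    ((show Commute U X from hUX).smul_left _ |>.smul_right _)
  have back : ∀ {Y : Matrix (Fin n) (Fin n) ℂ} {d : Fin n → ℝ},
      star P * (-Complex.I • Y) * P = diagonal (fun i => (d i : ℂ)) →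
      star P * Y * P = diagonal (fun i => Complex.I * d i) := by
    intro Y d h
    have : star P * Y * P = Complex.I • (star P * (-Complex.I • Y) * P) := by
      simp [smul_smul]
    rw [this, h, ← diagonal_smul]
    rfl
  exact ⟨P, hP, α, β, back hα, back hβ⟩

/-- The double bracket with two diagonal matrices acts entrywise. -/
theorem Matrix.lie_diagonal_lie_diagonal_apply {ι : Type*} [Fintype ι] [DecidableEq ι]
    (u x : ι → ℂ) (W : Matrix ι ι ℂ) (j k : ι) :
    ⁅diagonal u, ⁅diagonal x, W⁆⁆ j k = (u j - u k) * (x j - x k) * W j k := by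
  simp only [Ring.lie_def, sub_apply, diagonal_mul, mul_diagonal]
  ring

theorem Matrix.star_mul_lie_mul_of_mem_unitaryGroup {ι : Type*} [Fintype ι] [DecidableEq ι]
    {P : Matrix ι ι ℂ} (hP : P ∈ unitaryGroup ι ℂ) (A B : Matrix ι ι ℂ) :
    star P * ⁅A, B⁆ * P = ⁅star P * A * P, star P * B * P⁆ := by
  have h : ∀ A B : Matrix ι ι ℂ, star P * (A * B) * P = star P * A * P * (star P * B * P) := by
    intro A B
    calc star P * (A * B) * P = star P * A * 1 * B * P := by noncomm_ring
      _ = _ := by rw [← mem_unitaryGroup_iff.mp hP]; noncomm_ring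
  rw [Ring.lie_def, Ring.lie_def, mul_sub, sub_mul, h, h]

/-- The set `{[U, [X, W]] : W ∈ su(ι)}`. -/
def suDoubleBracket {ι : Type*} [Fintype ι] [DecidableEq ι] (U X : Matrix ι ι ℂ) :
    Set (Matrix ι ι ℂ) :=
  {m | ∃ W : Matrix ι ι ℂ, Wᴴ = -W ∧ W.trace = 0 ∧ m = ⁅U, ⁅X, W⁆⁆}

section

variable {ι : Type*} [Fintype ι] [DecidableEq ι] {U X P : Matrix ι ι ℂ} {α β : ι → ℝ}

/-- If no pair of indices separates both diagonals, then the double bracket vanishes. -/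
theorem suDoubleBracket_span_eq_bot (hP : P ∈ unitaryGroup ι ℂ)
    (hU : star P * U * P = diagonal (fun i => Complex.I * α i))
    (hX : star P * X * P = diagonal (fun i => Complex.I * β i))
    (h : ∀ j k, α j = α k ∨ β j = β k) :
    Submodule.span ℝ (suDoubleBracket U X) = ⊥ := by
  rw [Submodule.span_eq_bot]
  rintro m ⟨W, -, -, rfl⟩
  have h0 : star P * ⁅U, ⁅X, W⁆⁆ * P = 0 := by
    ext j k
    rw [star_mul_lie_mul_of_mem_unitaryGroup hP, star_mul_lie_mul_of_mem_unitaryGroup hP, hU, hX,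
      lie_diagonal_lie_diagonal_apply]
    rcases h j k with h | h <;> simp [h]
  have h1 := mem_unitaryGroup_iff.mp hP
  calc ⁅U, ⁅X, W⁆⁆ = (P * star P) * ⁅U, ⁅X, W⁆⁆ * (P * star P) := by rw [h1, one_mul, mul_one]
    _ = P * (star P * ⁅U, ⁅X, W⁆⁆ * P) * star P := by simp only [mul_assoc]
    _ = 0 := by rw [h0, mul_zero, zero_mul]

theorem exists_mem_suDoubleBracket (hP : P ∈ unitaryGroup ι ℂ)
    (hU : star P * U * P = diagonal (fun i => Complex.I * α i))
    (hX : star P * X * P = diagonal (fun i => Complex.I * β i))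
    {p q : ι} (hpq : p ≠ q) (z : ℂ) :
    ∃ m ∈ suDoubleBracket U X, ∀ j k, (star P * m * P) j k =
      -((α j - α k) * (β j - β k)) * (single p q z - single q p (star z)) j k := by
  set V := single p q z - single q p (star z) with hVdef
  have hP' := mem_unitaryGroup_iff'.mp hP
  have hV : star P * (P * V * star P) * P = V := by
    calc star P * (P * V * star P) * P = (star P * P) * V * (star P * P) := by
          simp only [mul_assoc]
      _ = V := by rw [hP', one_mul, mul_one]
  have hVs : Vᴴ = -V := by simp [V]
  refine ⟨_, ⟨P * V * star P, ?_, ?_, rfl⟩, fun j k => ?_⟩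
  · simp [star_eq_conjTranspose, conjTranspose_mul, hVs, mul_assoc]
  · rw [trace_mul_comm, ← mul_assoc, hP', one_mul]
    simp [V, trace_single_eq_of_ne, hpq, hpq.symm]
  · rw [star_mul_lie_mul_of_mem_unitaryGroup hP, star_mul_lie_mul_of_mem_unitaryGroup hP, hU, hX,
      lie_diagonal_lie_diagonal_apply, hV]
    linear_combination (α j - α k : ℂ) * (β j - β k) * V j k * Complex.I_mul_I

/-- Two distinct pairs of indices that separate both diagonals force dimension at least three. -/
theorem three_le_finrank_span_suDoubleBracket (hP : P ∈ unitaryGroup ι ℂ)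
    (hU : star P * U * P = diagonal (fun i => Complex.I * α i))
    (hX : star P * X * P = diagonal (fun i => Complex.I * β i))
    {p q r s : ι} (hα : α p ≠ α q) (hβ : β p ≠ β q) (hα' : α r ≠ α s) (hβ' : β r ≠ β s)
    (h : ¬ (r = p ∧ s = q)) (h' : ¬ (r = q ∧ s = p)) :
    3 ≤ Module.finrank ℝ (Submodule.span ℝ (suDoubleBracket U X)) := by
  have hpq : p ≠ q := fun e => hα (by rw [e])
  have hrs : r ≠ s := fun e => hα' (by rw [e])
  obtain ⟨m₁, hm₁, e₁⟩ := exists_mem_suDoubleBracket hP hU hX hpq 1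
  obtain ⟨m₂, hm₂, e₂⟩ := exists_mem_suDoubleBracket hP hU hX hpq Complex.I
  obtain ⟨m₃, hm₃, e₃⟩ := exists_mem_suDoubleBracket hP hU hX hrs 1
  have hli : LinearIndependent ℝ ![m₁, m₂, m₃] := by
    rw [Fintype.linearIndependent_iff]
    intro g hg
    have hent : ∀ j k, (g 0 : ℂ) * (star P * m₁ * P) j k + g 1 * (star P * m₂ * P) j k
        + g 2 * (star P * m₃ * P) j k = 0 := by
      intro j k
      have := congrArg (fun m => (star P * m * P) j k) hg
      simpa [Fin.sum_univ_three, mul_add, add_mul] using this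
    have hc : ((α p - α q) * (β p - β q) : ℂ) ≠ 0 := by
      exact_mod_cast mul_ne_zero (sub_ne_zero.mpr hα) (sub_ne_zero.mpr hβ)
    have hc' : ((α r - α s) * (β r - β s) : ℂ) ≠ 0 := by
      exact_mod_cast mul_ne_zero (sub_ne_zero.mpr hα') (sub_ne_zero.mpr hβ')
    have h₁ := hent p q
    have h₂ := hent r s
    simp only [e₁, e₂, e₃, Matrix.sub_apply, single_apply] at h₁ h₂
    have hsr : ¬ (s = p ∧ r = q) := fun e => h' ⟨e.2, e.1⟩
    have hpr : ¬ (p = r ∧ q = s) := fun e => h ⟨e.1.symm, e.2.symm⟩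
    have hqr : ¬ (q = r ∧ p = s) := fun e => h' ⟨e.1.symm, e.2.symm⟩
    have hqp : ¬ (q = p ∧ p = q) := fun e => hpq e.2
    have hsr' : ¬ (s = r ∧ r = s) := fun e => hrs e.2
    simp only [hsr, hpr, hqr, hqp, hsr', h, and_self, if_true, if_false, sub_zero,
      mul_zero, add_zero, zero_add, mul_one] at h₁ h₂
    have h₁' : (g 0 : ℂ) + g 1 * Complex.I = 0 := by
      apply mul_left_cancel₀ hc
      linear_combination -h₁
    have g0 : g 0 = 0 := by simpa using congrArg Complex.re h₁'
    have g1 : g 1 = 0 := by simpa using congrArg Complex.im h₁'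
    have g2 : g 2 = 0 := by
      have : (g 2 : ℂ) = 0 := by
        apply mul_left_cancel₀ hc'
        linear_combination -h₂
      exact_mod_cast this
    intro i
    fin_cases i <;> assumption
  have hle : Submodule.span ℝ (Set.range ![m₁, m₂, m₃]) ≤
      Submodule.span ℝ (suDoubleBracket U X) := by
    apply Submodule.span_mono
    rintro _ ⟨i, rfl⟩
    fin_cases i <;> assumption
  calc 3 = Module.finrank ℝ (Submodule.span ℝ (Set.range ![m₁, m₂, m₃])) := by
        rw [finrank_span_eq_card hli, Fintype.card_fin]
    _ ≤ _ := Submodule.finrank_mono hle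

end

/-- If exactly one pair of indices separates both `α` and `β`, then, up to order, `α` is constant
off the first index of the pair and `β` is constant off the second. -/
theorem exists_eq_ite_of_unique_separating_pair {ι : Type*} [DecidableEq ι] {α β : ι → ℝ}
    {p q : ι} (hα : α p ≠ α q) (hβ : β p ≠ β q)
    (huniq : ∀ r s, α r ≠ α s → β r ≠ β s → (r = p ∧ s = q) ∨ (r = q ∧ s = p)) :
    ∃ p q : ι, α p ≠ α q ∧ β p ≠ β q ∧ (∀ i, i ≠ p → α i = α q) ∧ (∀ i, i ≠ q → β i = β p) := by
  have hsep : ∀ m, m ≠ p → m ≠ q →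
      (α m = α q ∧ β m = β p) ∨ (α m = α p ∧ β m = β q) := by
    intro m hmp hmq
    have h1 := huniq m p
    have h2 := huniq m q
    grind
  by_cases hall : ∀ m, m ≠ p → m ≠ q → α m = α q ∧ β m = β p
  · refine ⟨p, q, hα, hβ, fun i hi => ?_, fun i hi => ?_⟩
    · by_cases h : i = q <;> grind
    · by_cases h : i = p <;> grind
  · push Not at hall
    obtain ⟨m, hmp, hmq, hm⟩ := hall
    have hm' := (hsep m hmp hmq).resolve_left fun e => hm e.1 e.2
    have hall' : ∀ k, k ≠ p → k ≠ q → α k = α p ∧ β k = β q := by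
      intro k hkp hkq
      have := huniq m k
      rcases hsep k hkp hkq with e | e <;> grind
    refine ⟨q, p, hα.symm, hβ.symm, fun i hi => ?_, fun i hi => ?_⟩
    · by_cases h : i = p <;> grind
    · by_cases h : i = q <;> grind

/-- A traceless matrix diagonalized with imaginary entries that agree off one index `p`
is a multiple of a matrix with entries `-n` at `p` and `1` elsewhere. -/
theorem star_mul_mul_eq_smul_diagonal_ite {n : ℕ} {U P : Matrix (Fin (n + 1)) (Fin (n + 1)) ℂ}
    (hP : P ∈ unitaryGroup (Fin (n + 1)) ℂ) (htr : U.trace = 0) {α : Fin (n + 1) → ℝ}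
    (hU : star P * U * P = diagonal (fun i => Complex.I * α i)) {p : Fin (n + 1)} {a : ℝ}
    (hα : ∀ i, i ≠ p → α i = a) :
    star P * U * P = ((a : ℂ) * Complex.I) • diagonal (fun i => if i = p then -(n : ℂ) else 1) := by
  have hsum : ∑ i, Complex.I * (α i : ℂ) = 0 := by
    rw [← trace_diagonal, ← hU, trace_mul_comm, ← mul_assoc, mem_unitaryGroup_iff.mp hP, one_mul,
      htr]
  have hp : (α p : ℂ) = -(n * a) := by
    rw [← Finset.mul_sum, ← Finset.add_sum_erase _ _ (Finset.mem_univ p),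
      Finset.sum_congr rfl (g := fun _ => (a : ℂ))
        (fun i hi => by rw [hα i (Finset.ne_of_mem_erase hi)])] at hsum
    have := (mul_eq_zero.mp hsum).resolve_left Complex.I_ne_zero
    simp at this
    linear_combination this
  rw [hU, ← diagonal_smul]
  congr 1
  funext i
  by_cases h : i = p
  · subst h
    simp [hp]
    ring
  · simp [h, hα i h, mul_comm]

/-- Let `n ≥ 2` and let `U, X ∈ su(n+1)` be nonzero commuting elements
such that the real span of `{[U, [X, W]] : W ∈ su(n+1)}` has real dimension exactly `2`.
Then there are a unitary matrix `P` and nonzero reals `a, b` with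
`P⁻¹ U P = a √(-1) diag(-n, 1, …, 1)` and `P⁻¹ X P = b √(-1) diag(1, -n, 1, …, 1)`. -/
theorem statement12 (n : ℕ) (hn : 2 ≤ n)
    (U X : Matrix (Fin (n + 1)) (Fin (n + 1)) ℂ)
    (hUskew : Uᴴ = -U) (hUtr : U.trace = 0) (hUne : U ≠ 0)
    (hXskew : Xᴴ = -X) (hXtr : X.trace = 0) (hXne : X ≠ 0)
    (hcomm : U * X = X * U)
    (hdim : Module.finrank ℝ (Submodule.span ℝ
      {m : Matrix (Fin (n + 1)) (Fin (n + 1)) ℂ |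
        ∃ W : Matrix (Fin (n + 1)) (Fin (n + 1)) ℂ,
          Wᴴ = -W ∧ W.trace = 0 ∧ m = ⁅U, ⁅X, W⁆⁆}) = 2) :
    ∃ P : Matrix (Fin (n + 1)) (Fin (n + 1)) ℂ, P ∈ Matrix.unitaryGroup (Fin (n + 1)) ℂ ∧
      ∃ a b : ℝ, a ≠ 0 ∧ b ≠ 0 ∧
        P⁻¹ * U * P =
          ((a : ℂ) * Complex.I) • Matrix.diagonal (fun i => if i = 0 then -(n : ℂ) else 1) ∧
        P⁻¹ * X * P =
          ((b : ℂ) * Complex.I) • Matrix.diagonal (fun i => if i = 1 then -(n : ℂ) else 1) := by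
  obtain ⟨P, hP, α, β, hU, hX⟩ :=
    exists_unitary_diagonal_of_skewHermitian_of_commute hUskew hXskew hcomm
  change Module.finrank ℝ (Submodule.span ℝ (suDoubleBracket U X)) = 2 at hdim
  obtain ⟨p₀, q₀, hα₀, hβ₀⟩ : ∃ p q, α p ≠ α q ∧ β p ≠ β q := by
    by_contra! h
    rw [suDoubleBracket_span_eq_bot hP hU hX fun j k => or_iff_not_imp_left.mpr (h j k),
      finrank_bot] at hdim
    omega
  obtain ⟨p, q, hα, hβ, hαp, hβq⟩ := exists_eq_ite_of_unique_separating_pair hα₀ hβ₀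
    fun r s hr hs => by
      by_contra! h
      have := three_le_finrank_span_suDoubleBracket hP hU hX hα₀ hβ₀ hr hs
        (fun e => h.1 e.1 e.2) (fun e => h.2 e.1 e.2)
      omega
  have hU' := star_mul_mul_eq_smul_diagonal_ite hP hUtr hU hαp
  have hX' := star_mul_mul_eq_smul_diagonal_ite hP hXtr hX hβq
  have hpq : p ≠ q := fun e => hα (by rw [e])
  have h01 : (0 : Fin (n + 1)) ≠ 1 := by
    obtain ⟨m, rfl⟩ : ∃ m, n = m + 1 := ⟨n - 1, by omega⟩
    exact zero_ne_one
  obtain ⟨σ, hσ0, hσ1⟩ : ∃ σ : Equiv.Perm (Fin (n + 1)), σ 0 = p ∧ σ 1 = q := by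
    refine ⟨(Equiv.swap 0 p).trans (Equiv.swap (Equiv.swap 0 p 1) q), ?_, by simp⟩
    have : p ≠ Equiv.swap 0 p 1 := by
      intro e
      exact h01 ((Equiv.swap 0 p).injective (by rw [Equiv.swap_apply_left]; exact e))
    simp [Equiv.swap_apply_of_ne_of_ne this hpq]
  have hne : ∀ {Y : Matrix (Fin (n + 1)) (Fin (n + 1)) ℂ} {a : ℝ} {d : Fin (n + 1) → ℂ},
      Y ≠ 0 → star P * Y * P = ((a : ℂ) * Complex.I) • diagonal d → a ≠ 0 := by
    rintro Y a d hY h rfl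
    apply hY
    have h1 := mem_unitaryGroup_iff.mp hP
    calc Y = (P * star P) * Y * (P * star P) := by rw [h1, one_mul, mul_one]
      _ = P * (star P * Y * P) * star P := by simp only [mul_assoc]
      _ = 0 := by rw [h]; simp
  have hconj : ∀ Y : Matrix (Fin (n + 1)) (Fin (n + 1)) ℂ,
      star (P.submatrix id σ) * Y * P.submatrix id σ = (star P * Y * P).submatrix σ σ := by
    intro Y
    ext i j
    simp [mul_apply, star_apply]
  have hQ : P.submatrix id σ ∈ unitaryGroup (Fin (n + 1)) ℂ := by
    rw [mem_unitaryGroup_iff']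
    have := hconj 1
    rwa [mul_one, mul_one, mem_unitaryGroup_iff'.mp hP, submatrix_one_equiv] at this
  have hinv : (P.submatrix id σ)⁻¹ = star (P.submatrix id σ) :=
    inv_eq_left_inv (mem_unitaryGroup_iff'.mp hQ)
  refine ⟨P.submatrix id σ, hQ, α q, β p, hne hUne hU', hne hXne hX', ?_, ?_⟩
  · rw [hinv, hconj, hU', show ∀ (c : ℂ) (M : Matrix _ _ ℂ), (c • M).submatrix σ σ = c • M.submatrix σ σ from
      fun _ _ => rfl, submatrix_diagonal_equiv]
    congr 2
    funext i
    simp [← hσ0]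
  · rw [hinv, hconj, hX', show ∀ (c : ℂ) (M : Matrix _ _ ℂ), (c • M).submatrix σ σ = c • M.submatrix σ σ from
      fun _ _ => rfl, submatrix_diagonal_equiv]
    congr 2
    funext i
    simp [← hσ1]
end

section
/- Let n ≥ 2, let a be a nonzero real number, and set U = a·√(−1)·diag(−n, 1, …, 1) ∈ M_{n+1}(ℂ). Let b₁, …, bₙ ∈ ℂ be not all zero, and let V ∈ M_{n+1}(ℂ) be the skew-Hermitian matrix whose first row is (0, −b̄₁, …, −b̄ₙ), whose first column is (0, b₁, …, bₙ)ᵀ, and whose remaining entries are all zero. Then for every real number t ≠ 0, the matrix U + tV has no eigenvalue of algebraic multiplicity ≥ n; in particular, U + tV has the same eigenvalue multiplicities as U (one eigenvalue of multiplicity n and one of multiplicity 1) only when t = 0. -/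
open Matrix

open Polynomial in
/-- The characteristic polynomial of an arrow matrix with vanishing lower right block. -/
theorem charpoly_arrow {K : Type*} [CommRing K] [Nontrivial K] {n : ℕ} (hn : 1 ≤ n)
    (N : Matrix (Fin (n + 1)) (Fin (n + 1)) K)
    (hN : ∀ i j : Fin n, N i.succ j.succ = 0) :
    N.charpoly = X ^ (n - 1) *
      (X ^ 2 - C (N 0 0) * X - C (∑ i : Fin n, N 0 i.succ * N i.succ 0)) := by
  let A : Matrix (Fin (n + 1)) (Fin 2) K :=
    Matrix.of fun i => ![N i 0, (Pi.single 0 1 : Fin (n + 1) → K) i]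
  let B : Matrix (Fin 2) (Fin (n + 1)) K :=
    Matrix.of ![Pi.single 0 1, Fin.cons 0 fun j => N 0 j.succ]
  have hAB : N = A * B := by
    ext i j
    rw [Matrix.mul_apply, Fin.sum_univ_two]
    cases i using Fin.cases <;> cases j using Fin.cases <;> simp [A, B, hN]
  have hBA : B * A = !![N 0 0, 1; ∑ i : Fin n, N 0 i.succ * N i.succ 0, 0] := by
    ext i j
    rw [Matrix.mul_apply, Fin.sum_univ_succ]
    fin_cases i <;> fin_cases j <;> simp [A, B]
  have h := charpoly_mul_comm_of_le A B (by simpa using hn)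
  rw [← hAB, hBA, charpoly_fin_two] at h
  simpa [Matrix.trace_fin_two, Matrix.det_fin_two, sub_eq_add_neg] using h

open Polynomial in
/-- A quadratic with nonzero discriminant and constant term, multiplied by a power of `X`, has only
roots of multiplicity at most the larger of that power and `1`. -/
theorem rootMultiplicity_X_pow_mul_quadratic_le {K : Type*} [Field K] (m : ℕ) (d s ν : K)
    (hs : s ≠ 0) (hdisc : d ^ 2 + 4 * s ≠ 0) :
    (X ^ m * (X ^ 2 - C d * X - C s)).rootMultiplicity ν ≤ max m 1 := by
  set q : K[X] := X ^ 2 - C d * X - C s with hq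
  have hq0 : ¬ q.IsRoot 0 := by simp [hq, hs]
  have hqne : q ≠ 0 := by
    rintro h
    simp [h] at hq0
  rw [rootMultiplicity_mul (mul_ne_zero (pow_ne_zero _ X_ne_zero) hqne)]
  by_cases hν : ν = 0
  · subst hν
    rw [rootMultiplicity_eq_zero hq0]
    have := rootMultiplicity_X_sub_C_pow (0 : K) m
    rw [C_0, sub_zero] at this
    simp [this]
  · rw [rootMultiplicity_eq_zero (p := X ^ m) (by simp [hν]), zero_add]
    refine le_max_of_le_right ?_
    by_contra! h
    obtain ⟨h1, h2⟩ := (one_lt_rootMultiplicity_iff_isRoot hqne).1 h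
    simp only [hq, IsRoot.def, eval_sub, eval_mul, eval_pow, eval_X, eval_C, derivative_sub,
      derivative_X_pow, derivative_C_mul, derivative_X, derivative_C, Nat.cast_ofNat,
      Nat.add_one_sub_one, pow_one, mul_one, sub_zero] at h1 h2
    apply hdisc
    linear_combination (2 * ν - d) * h2 - 4 * h1

/-- Let `n ≥ 2`, `a ∈ ℝ` nonzero, `U = a √(-1) diag(-n, 1, …, 1)`, let
`b₁, …, bₙ ∈ ℂ` be not all zero and let `V` be the skew-Hermitian matrix with first row
`(0, -b̄₁, …, -b̄ₙ)`, first column `(0, b₁, …, bₙ)ᵀ` and all other entries zero. Then for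
every real `t ≠ 0` the matrix `U + tV` has no eigenvalue of algebraic multiplicity `≥ n`. -/
theorem statement13 (n : ℕ) (hn : 2 ≤ n) (a : ℝ) (ha : a ≠ 0)
    (b : Fin n → ℂ) (hb : b ≠ 0)
    (U V : Matrix (Fin (n + 1)) (Fin (n + 1)) ℂ)
    (hU : U = ((a : ℂ) * Complex.I) • Matrix.diagonal (fun i => if i = 0 then -(n : ℂ) else 1))
    (hV00 : V 0 0 = 0)
    (hVrow : ∀ j : Fin n, V 0 j.succ = -(starRingEnd ℂ) (b j))
    (hVcol : ∀ i : Fin n, V i.succ 0 = b i)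
    (hVrest : ∀ i j : Fin n, V i.succ j.succ = 0)
    (t : ℝ) (ht : t ≠ 0) (μ : ℂ) :
    (U + (t : ℂ) • V).charpoly.rootMultiplicity μ < n := by
  set c : ℂ := a * Complex.I with hc
  set N := U + (t : ℂ) • V - scalar (Fin (n + 1)) c with hN
  have h00 : N 0 0 = -((n + 1) * c) := by
    simp [hN, hU, hV00]
    ring
  have hrest (i j : Fin n) : N i.succ j.succ = 0 := by
    by_cases h : i = j <;> simp [hN, hU, hVrest, h]
  have hsum : ∑ i : Fin n, N 0 i.succ * N i.succ 0 =
      ((-(t ^ 2 * ∑ i, ‖b i‖ ^ 2) : ℝ) : ℂ) := by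
    push_cast
    rw [Finset.mul_sum, ← Finset.sum_neg_distrib]
    refine Finset.sum_congr rfl fun i _ => ?_
    have h1 : N 0 i.succ = -(t * (starRingEnd ℂ) (b i)) := by
      simp [hN, hU, hVrow, (Fin.succ_ne_zero i).symm]
    have h2 : N i.succ 0 = t * b i := by
      simp [hN, hU, hVcol]
    rw [h1, h2]
    linear_combination -(t : ℂ) ^ 2 * Complex.conj_mul' (b i)
  have hpos : 0 < t ^ 2 * ∑ i, ‖b i‖ ^ 2 := by
    obtain ⟨i, hi⟩ := Function.ne_iff.1 hb
    have : 0 < ‖b i‖ := norm_pos_iff.2 hi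
    exact mul_pos (by positivity)
      (Finset.sum_pos' (fun _ _ => by positivity) ⟨i, Finset.mem_univ i, by positivity⟩)
  have hshift : (U + (t : ℂ) • V).charpoly.rootMultiplicity μ =
      N.charpoly.rootMultiplicity (μ - c) := by
    have h := Polynomial.rootMultiplicity_comp_C_mul_X_add_C (U + (t : ℂ) • V).charpoly 1 c
      (μ - c) isUnit_one
    rw [hN, charpoly_sub_scalar]
    simpa using h.symm
  rw [hshift, charpoly_arrow (by lia) N hrest, hsum, h00]
  refine (rootMultiplicity_X_pow_mul_quadratic_le (n - 1) _ _ (μ - c) ?_ ?_).trans_lt (by lia)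
  · exact_mod_cast (neg_lt_zero.2 hpos).ne
  · have h : (-((n + 1) * c)) ^ 2 + 4 * ((-(t ^ 2 * ∑ i, ‖b i‖ ^ 2) : ℝ) : ℂ) =
        ((-(((n + 1) * a) ^ 2 + 4 * (t ^ 2 * ∑ i, ‖b i‖ ^ 2)) : ℝ) : ℂ) := by
      push_cast
      rw [hc]
      linear_combination ((n + 1) * (a : ℂ)) ^ 2 * Complex.I_sq
    rw [h]
    exact_mod_cast (neg_lt_zero.2 (by positivity)).ne
end

section
/- Fix integers n₁ ≥ n₂ ≥ 2 and set n = n₁ + n₂; write y = (y₁, y₂) ∈ ℝⁿ = ℝ^{n₁} × ℝ^{n₂}, α(y) = √(‖y₁‖² + ‖y₂‖²), α₁(y) = ‖y₁‖, α₂(y) = ‖y₂‖. Let φ, ψ : [0,1] → ℝ be positive functions with φ(s) = ψ(√(1−s²)) for all s ∈ [0,1], and define F : ℝⁿ → ℝ by F(0) = 0 and F(y) = α(y)·φ(α₂(y)/α(y)) for y ≠ 0 (equivalently F(y) = α(y)·ψ(α₁(y)/α(y))). If F is a Minkowski norm on ℝⁿ, then both φ and ψ are infinitely differentiable on the closed interval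 [0,1] (with one-sided derivatives at the endpoints), and for all real numbers s, b with 0 ≤ s ≤ b ≤ 1 one has φ(s) − sφ'(s) + (b² − s²)φ''(s) > 0 and ψ(s) − sψ'(s) + (b² − s²)ψ''(s) > 0. -/
/-- A Minkowski norm on a real normed vector space `E`: a continuous nonnegative function,
smooth away from the origin, positively homogeneous of degree one, and strongly convex in
the sense that for every `y ≠ 0` the Hessian `g_y(v, v) = (1/2) D²(F²)(y)[v, v]` is
positive definite. -/
def IsMinkowskiNorm {E : Type*} [NormedAddCommGroup E] [NormedSpace ℝ E] (F : E → ℝ) : Prop :=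
  Continuous F ∧ (∀ y, 0 ≤ F y) ∧
    ContDiffOn ℝ (⊤ : ℕ∞) F {(0 : E)}ᶜ ∧
    (∀ (c : ℝ) (y : E), 0 < c → F (c • y) = c * F y) ∧
    ∀ y : E, y ≠ 0 → ∀ v : E, v ≠ 0 →
      0 < (1 / 2 : ℝ) * fderiv ℝ (fun z : E => fderiv ℝ (fun w : E => F w ^ 2) z v) y v

/-- The (one-sided) derivative of a function on the closed interval `[0, 1]`. -/
noncomputable def dIcc (f : ℝ → ℝ) : ℝ → ℝ := derivWithin f (Set.Icc 0 1)

open scoped ContDiff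
open Set Filter Topology

/-- Differentiation under the integral sign for `x ↦ ∫₀¹ tᵐ k(tx) dt`. -/
theorem hasDerivAt_integral_pow_mul_comp_mul {k : ℝ → ℝ} (hk : ContDiff ℝ 1 k) (m : ℕ) (x : ℝ) :
    HasDerivAt (fun x => ∫ t in (0 : ℝ)..1, t ^ m * k (t * x))
      (∫ t in (0 : ℝ)..1, t ^ (m + 1) * deriv k (t * x)) x := by
  have hk0 : Continuous k := hk.continuous
  have hk1 : Continuous (deriv k) := hk.continuous_deriv le_rfl
  have hd : ∀ y, HasDerivAt k (deriv k y) y := fun y =>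
    (hk.differentiable one_ne_zero y).hasDerivAt
  have hcont : Continuous fun p : ℝ × ℝ => p.1 ^ (m + 1) * deriv k (p.1 * p.2) := by fun_prop
  obtain ⟨C, hC⟩ := (isCompact_Icc.prod (isCompact_closedBall x 1)).exists_bound_of_continuousOn
    (s := Icc (0 : ℝ) 1 ×ˢ Metric.closedBall x 1) hcont.continuousOn
  refine (intervalIntegral.hasDerivAt_integral_of_dominated_loc_of_deriv_le
    (F' := fun x t => t ^ (m + 1) * deriv k (t * x)) (bound := fun _ => C)
    (Metric.closedBall_mem_nhds x one_pos) ?_ ?_ ?_ ?_ ?_ ?_).2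
  · exact Eventually.of_forall fun z => Continuous.aestronglyMeasurable (by fun_prop)
  · exact Continuous.intervalIntegrable (by fun_prop) _ _
  · exact Continuous.aestronglyMeasurable (by fun_prop)
  · refine Eventually.of_forall fun t ht z hz => hC (t, z) ⟨?_, hz⟩
    rw [uIoc_of_le zero_le_one] at ht
    exact Ioc_subset_Icc_self ht
  · exact intervalIntegrable_const
  · refine Eventually.of_forall fun t _ z _ => ?_
    have := ((hd (t * z)).comp z ((hasDerivAt_id z).const_mul t)).const_mul (t ^ m)
    exact this.congr_deriv (by rw [mul_one]; ring)

theorem contDiff_integral_pow_mul_comp_mul {k : ℝ → ℝ} (hk : ContDiff ℝ ∞ k) (m : ℕ) :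
    ContDiff ℝ ∞ (fun x => ∫ t in (0 : ℝ)..1, t ^ m * k (t * x)) := by
  rw [contDiff_infty]
  intro n
  induction n generalizing k m with
  | zero =>
    exact contDiff_zero.2 (continuous_iff_continuousAt.2 fun x =>
      (hasDerivAt_integral_pow_mul_comp_mul (hk.of_le (by norm_cast)) m x).continuousAt)
  | succ n ih =>
    have hd := hasDerivAt_integral_pow_mul_comp_mul (hk.of_le (by norm_cast)) m
    rw [Nat.cast_add, Nat.cast_one, contDiff_succ_iff_deriv]
    refine ⟨fun x => (hd x).differentiableAt, by simp, ?_⟩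
    rw [funext fun x => (hd x).deriv]
    exact ih (contDiff_infty_iff_deriv.1 hk).2 (m + 1)

theorem deriv_neg_of_even {h : ℝ → ℝ} (heven : ∀ x, h (-x) = h x) (x : ℝ) :
    deriv h (-x) = -deriv h x := by
  have := deriv_comp_neg h x
  rw [funext heven] at this
  linarith

/-- The derivative of a smooth even function is `x` times a smooth even function. -/
theorem exists_deriv_eq_mul_of_even {h : ℝ → ℝ} (hh : ContDiff ℝ ∞ h)
    (heven : ∀ x, h (-x) = h x) :
    ∃ q : ℝ → ℝ, ContDiff ℝ ∞ q ∧ (∀ x, q (-x) = q x) ∧ (∀ x, deriv h x = x * q x) ∧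
      ((∀ x, 0 < deriv (deriv h) x) → ∀ x, 0 < q x) := by
  have hh1 : ContDiff ℝ ∞ (deriv h) := (contDiff_infty_iff_deriv.1 hh).2
  have hh2 : ContDiff ℝ ∞ (deriv (deriv h)) := (contDiff_infty_iff_deriv.1 hh1).2
  have hodd := deriv_neg_of_even heven
  have hzero : deriv h 0 = 0 := by have := hodd 0; rw [neg_zero] at this; linarith
  have heven2 : ∀ x, deriv (deriv h) (-x) = deriv (deriv h) x := by
    intro x
    have := deriv_comp_neg (deriv h) x
    rw [funext hodd, deriv.fun_neg] at this
    linarith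
  have hc : Continuous (deriv (deriv h)) := hh2.continuous
  refine ⟨fun x => ∫ t in (0 : ℝ)..1, deriv (deriv h) (t * x), ?_, ?_, ?_, ?_⟩
  · simpa using contDiff_integral_pow_mul_comp_mul hh2 0
  · intro x
    simp only [mul_neg, heven2]
  · intro x
    have h1 := intervalIntegral.smul_integral_comp_mul_right (a := 0) (b := 1) (deriv (deriv h)) x
    rw [zero_mul, one_mul, intervalIntegral.integral_deriv_eq_sub
      (fun y _ => (contDiff_infty_iff_deriv.1 hh1).1 y) (hc.intervalIntegrable _ _), hzero,
      sub_zero, smul_eq_mul] at h1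
    exact h1.symm
  · intro hpos x
    exact intervalIntegral.intervalIntegral_pos_of_pos
      (Continuous.intervalIntegrable (by fun_prop) _ _) (fun t => hpos _) one_pos

theorem hasDerivWithinAt_comp_sqrt {h q : ℝ → ℝ} (hh : Differentiable ℝ h) (hq : Continuous q)
    (hhq : ∀ x, deriv h x = x * q x) {u : ℝ} (hu : 0 ≤ u) :
    HasDerivWithinAt (fun u => h √u) (q √u / 2) (Ici 0) u := by
  have hpos : ∀ v : ℝ, 0 < v → HasDerivAt (fun u => h √u) (q √v / 2) v := by
    intro v hv
    have h1 := (hh √v).hasDerivAt.comp v (Real.hasDerivAt_sqrt hv.ne')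
    rw [hhq] at h1
    have := (Real.sqrt_pos.2 hv).ne'
    exact h1.congr_deriv (by field_simp)
  rcases hu.eq_or_lt with rfl | hu
  · refine hasDerivWithinAt_Ici_of_tendsto_deriv (s := Ioi 0)
      (fun v hv => (hpos v hv).differentiableAt.differentiableWithinAt)
      (hh.continuous.comp Real.continuous_sqrt).continuousWithinAt self_mem_nhdsWithin ?_
    have hc : Continuous fun v => q √v / 2 := by fun_prop
    refine (hc.tendsto' 0 _ rfl).mono_left nhdsWithin_le_nhds |>.congr' ?_
    filter_upwards [self_mem_nhdsWithin] with v hv using (hpos v hv).deriv.symm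
  · exact (hpos u hu).hasDerivWithinAt

/-- Whitney's theorem: a smooth even function is a smooth function of `x²`. -/
theorem contDiffOn_comp_sqrt_of_even {h : ℝ → ℝ} (hh : ContDiff ℝ ∞ h)
    (heven : ∀ x, h (-x) = h x) : ContDiffOn ℝ ∞ (fun u => h √u) (Ici 0) := by
  rw [contDiffOn_infty]
  intro n
  induction n generalizing h with
  | zero => exact contDiffOn_zero.2 (hh.continuous.comp Real.continuous_sqrt).continuousOn
  | succ n ih =>
    obtain ⟨q, hq, hqeven, hhq, -⟩ := exists_deriv_eq_mul_of_even hh heven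
    have hd := fun u hu => hasDerivWithinAt_comp_sqrt (u := u)
      (contDiff_infty_iff_deriv.1 hh).1 hq.continuous hhq hu
    rw [Nat.cast_add, Nat.cast_one, contDiffOn_succ_iff_derivWithin (uniqueDiffOn_Ici 0)]
    refine ⟨fun u hu => (hd u hu).differentiableWithinAt, by simp, ?_⟩
    exact ((ih hq hqeven).div_const 2).congr fun u hu =>
      (hd u hu).derivWithin (uniqueDiffOn_Ici 0 u hu)

theorem dIcc_eq_of_eqOn {φ f f' f'' : ℝ → ℝ} {U : Set ℝ} (hU : IsOpen U)
    (hφ : ∀ s ∈ Icc (0 : ℝ) 1, s ∈ U → φ s = f s)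
    (hf : ∀ s ∈ Icc (0 : ℝ) 1, s ∈ U → HasDerivWithinAt f (f' s) (Icc 0 1) s)
    (hf' : ∀ s ∈ Icc (0 : ℝ) 1, s ∈ U → HasDerivWithinAt f' (f'' s) (Icc 0 1) s)
    {s : ℝ} (hs : s ∈ Icc (0 : ℝ) 1) (hsU : s ∈ U) :
    dIcc φ s = f' s ∧ dIcc (dIcc φ) s = f'' s := by
  have key : ∀ {a b c : ℝ → ℝ}, (∀ s ∈ Icc (0 : ℝ) 1, s ∈ U → a s = b s) →
      (∀ s ∈ Icc (0 : ℝ) 1, s ∈ U → HasDerivWithinAt b (c s) (Icc 0 1) s) →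
      ∀ s ∈ Icc (0 : ℝ) 1, s ∈ U → dIcc a s = c s := by
    intro a b c hab hb s hs hsU
    have hev : a =ᶠ[𝓝[Icc 0 1] s] b := by
      filter_upwards [self_mem_nhdsWithin, mem_nhdsWithin_of_mem_nhds (hU.mem_nhds hsU)]
        with t ht htU using hab t ht htU
    exact ((hb s hs hsU).congr_of_eventuallyEq hev (hab s hs hsU)).derivWithin
      (uniqueDiffOn_Icc zero_lt_one s hs)
  exact ⟨key hφ hf s hs hsU, key (key hφ hf) hf' s hs hsU⟩

theorem hasDerivAt_sqrt_one_sub_sq {s : ℝ} (hs : 0 < 1 - s ^ 2) :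
    HasDerivAt (fun s : ℝ => √(1 - s ^ 2)) (-s / √(1 - s ^ 2)) s := by
  have h1 : HasDerivAt (fun s : ℝ => 1 - s ^ 2) (-(2 * s)) s := by
    simpa using ((hasDerivAt_id s).pow 2).const_sub 1
  have hc := (Real.sqrt_pos.2 hs).ne'
  exact (h1.sqrt hs.ne').congr_deriv (by field_simp)

/-- In the chart `x = s / √(1 - s²)` around `s = 0`, the quantity `φ - sφ' + (1 - s²)φ''` is a
positive multiple of `k''`. -/
theorem dIcc_of_chart_zero {φ k : ℝ → ℝ} (hk : ContDiff ℝ ∞ k)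
    (hφ : ∀ s ∈ Icc (0 : ℝ) 1, s ∈ Iio (1 : ℝ) → φ s = √(1 - s ^ 2) * k (s / √(1 - s ^ 2)))
    {s : ℝ} (hs0 : 0 ≤ s) (hs1 : s < 1) :
    φ s - s * dIcc φ s + (1 - s ^ 2) * dIcc (dIcc φ) s =
      deriv (deriv k) (s / √(1 - s ^ 2)) / √(1 - s ^ 2) ^ 3 := by
  have hd := contDiff_infty_iff_deriv.1 hk
  have hpos : ∀ s ∈ Icc (0 : ℝ) 1, s ∈ Iio (1 : ℝ) → 0 < 1 - s ^ 2 := by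
    intro s hs hs1
    have := hs.1
    have : s < 1 := hs1
    nlinarith
  have hx : ∀ s ∈ Icc (0 : ℝ) 1, s ∈ Iio (1 : ℝ) →
      HasDerivAt (fun s => s / √(1 - s ^ 2)) (1 / √(1 - s ^ 2) ^ 3) s := by
    intro s hs hs1
    have hp := hpos s hs hs1
    have hc := (Real.sqrt_pos.2 hp).ne'
    have hsq := Real.sq_sqrt hp.le
    refine ((hasDerivAt_id s).div (hasDerivAt_sqrt_one_sub_sq hp) hc).congr_deriv ?_
    simp only [id]
    field_simp
    rw [hsq]
    ring
  have hs : s ∈ Icc (0 : ℝ) 1 := ⟨hs0, hs1.le⟩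
  refine And.elim (fun h1 h2 => ?_) (dIcc_eq_of_eqOn (s := s) isOpen_Iio hφ
    (f' := fun s => -s / √(1 - s ^ 2) * k (s / √(1 - s ^ 2)) +
      deriv k (s / √(1 - s ^ 2)) / √(1 - s ^ 2) ^ 2)
    (f'' := fun s => -k (s / √(1 - s ^ 2)) / √(1 - s ^ 2) ^ 3 +
      s * deriv k (s / √(1 - s ^ 2)) / √(1 - s ^ 2) ^ 4 +
      deriv (deriv k) (s / √(1 - s ^ 2)) / √(1 - s ^ 2) ^ 5) ?_ ?_ hs hs1)
  · rw [hφ s hs hs1, h1, h2]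
    have hp := hpos s hs hs1
    have hc := (Real.sqrt_pos.2 hp).ne'
    have hsq := Real.sq_sqrt hp.le
    generalize √(1 - s ^ 2) = c at hc hsq ⊢
    rw [← hsq]
    field_simp
    linear_combination c ^ 2 * k (s / c) * hsq
  · intro s hs hs1
    have hp := hpos s hs hs1
    have hc := (Real.sqrt_pos.2 hp).ne'
    have hk1 := (hd.1 (s / √(1 - s ^ 2))).hasDerivAt.comp s (hx s hs hs1)
    refine (((hasDerivAt_sqrt_one_sub_sq hp).mul hk1).congr_deriv ?_).hasDerivWithinAt
    simp only [Function.comp]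
    field_simp
  · intro s hs hs1
    have hp := hpos s hs hs1
    have hc := (Real.sqrt_pos.2 hp).ne'
    have hsq := Real.sq_sqrt hp.le
    have hd2 := (contDiff_infty_iff_deriv.1 hd.2).1
    have hk1 := (hd.1 (s / √(1 - s ^ 2))).hasDerivAt.comp s (hx s hs hs1)
    have hk2 := (hd2 (s / √(1 - s ^ 2))).hasDerivAt.comp s (hx s hs hs1)
    have hc' := hasDerivAt_sqrt_one_sub_sq hp
    refine ((((((hasDerivAt_id s).neg.div hc' hc).mul hk1).add
      (hk2.div (hc'.pow 2) (pow_ne_zero 2 hc)))).congr_deriv ?_).hasDerivWithinAt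
    simp only [Function.comp, id, Pi.div_apply, Pi.neg_apply, Pi.pow_apply]
    generalize √(1 - s ^ 2) = c at hc hsq ⊢
    have : s ^ 2 = 1 - c ^ 2 := by rw [hsq]; ring
    field_simp
    simp only [this]
    ring

theorem contDiffWithinAt_of_chart_zero {φ k : ℝ → ℝ} (hk : ContDiff ℝ ∞ k)
    (hφ : ∀ s ∈ Icc (0 : ℝ) 1, s ∈ Iio (1 : ℝ) → φ s = √(1 - s ^ 2) * k (s / √(1 - s ^ 2)))
    {s : ℝ} (hs0 : 0 ≤ s) (hs1 : s < 1) : ContDiffWithinAt ℝ ∞ φ (Icc 0 1) s := by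
  have hp : 0 < 1 - s ^ 2 := by nlinarith
  have hc := (Real.sqrt_pos.2 hp).ne'
  have hsqrt : ContDiffAt ℝ ∞ (fun s : ℝ => √(1 - s ^ 2)) s :=
    ContDiffAt.sqrt (by fun_prop) hp.ne'
  have hf : ContDiffAt ℝ ∞ (fun s => √(1 - s ^ 2) * k (s / √(1 - s ^ 2))) s :=
    hsqrt.mul (hk.contDiffAt.comp s (contDiffAt_id.div hsqrt hc))
  refine hf.contDiffWithinAt.congr_of_eventuallyEq ?_ (hφ s ⟨hs0, hs1.le⟩ hs1)
  filter_upwards [self_mem_nhdsWithin, mem_nhdsWithin_of_mem_nhds (isOpen_Iio.mem_nhds hs1)]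
    with t ht htU using hφ t ht htU

theorem mapsTo_one_sub_sq_div_sq :
    MapsTo (fun s : ℝ => (1 - s ^ 2) / s ^ 2) (Icc 0 1) (Ici 0) := fun s hs =>
  div_nonneg (by nlinarith [hs.1, hs.2]) (sq_nonneg s)

theorem contDiffWithinAt_of_chart_one {φ h : ℝ → ℝ} (hh : ContDiff ℝ ∞ h)
    (heven : ∀ x, h (-x) = h x)
    (hφ : ∀ s ∈ Icc (0 : ℝ) 1, s ∈ Ioi (0 : ℝ) → φ s = s * h √((1 - s ^ 2) / s ^ 2))
    {s : ℝ} (hs0 : 0 < s) (hs1 : s ≤ 1) : ContDiffWithinAt ℝ ∞ φ (Icc 0 1) s := by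
  have hs : s ∈ Icc (0 : ℝ) 1 := ⟨hs0.le, hs1⟩
  have hu : ContDiffWithinAt ℝ ∞ (fun s : ℝ => (1 - s ^ 2) / s ^ 2) (Icc 0 1) s :=
    ContDiffWithinAt.div (by fun_prop) (by fun_prop) (pow_ne_zero 2 hs0.ne')
  have hf : ContDiffWithinAt ℝ ∞ (fun s => s * h √((1 - s ^ 2) / s ^ 2)) (Icc 0 1) s :=
    contDiffWithinAt_id.mul (ContDiffWithinAt.comp (g := fun u => h √u) s
      (contDiffOn_comp_sqrt_of_even hh heven _ (mapsTo_one_sub_sq_div_sq hs))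
      hu mapsTo_one_sub_sq_div_sq)
  refine hf.congr_of_eventuallyEq ?_ (hφ s hs hs0)
  filter_upwards [self_mem_nhdsWithin, mem_nhdsWithin_of_mem_nhds (isOpen_Ioi.mem_nhds hs0)]
    with t ht htU using hφ t ht htU

/-- In the chart `x = √(1 - s²) / s` around `s = 1`, both `φ - sφ'` and
`φ - sφ' + (1 - s²)φ''` are positive when `h` is even and `h'' > 0`. -/
theorem dIcc_pos_of_chart_one {φ h : ℝ → ℝ} (hh : ContDiff ℝ ∞ h)
    (heven : ∀ x, h (-x) = h x) (hconv : ∀ x, 0 < deriv (deriv h) x)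
    (hφ : ∀ s ∈ Icc (0 : ℝ) 1, s ∈ Ioi (0 : ℝ) → φ s = s * h √((1 - s ^ 2) / s ^ 2))
    {s : ℝ} (hs0 : 0 < s) (hs1 : s ≤ 1) :
    0 < φ s - s * dIcc φ s ∧ 0 < φ s - s * dIcc φ s + (1 - s ^ 2) * dIcc (dIcc φ) s := by
  obtain ⟨q, hq, hqeven, hhq, hqpos⟩ := exists_deriv_eq_mul_of_even hh heven
  obtain ⟨r, hr, -, hqr, -⟩ := exists_deriv_eq_mul_of_even hq hqeven
  have hs : s ∈ Icc (0 : ℝ) 1 := ⟨hs0.le, hs1⟩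
  have hq1 := (contDiff_infty_iff_deriv.1 hq).1
  have hu : ∀ s ∈ Icc (0 : ℝ) 1, s ∈ Ioi (0 : ℝ) →
      HasDerivWithinAt (fun s => (1 - s ^ 2) / s ^ 2) (-2 / s ^ 3) (Icc 0 1) s := by
    intro s _ hs0
    have hs0' : s ≠ 0 := (mem_Ioi.1 hs0).ne'
    have h2 : HasDerivAt (fun s : ℝ => s ^ 2) (2 * s) s := by simpa using hasDerivAt_pow 2 s
    refine (((h2.const_sub 1).div h2 (pow_ne_zero 2 hs0')).congr_deriv ?_).hasDerivWithinAt
    field_simp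
    ring
  have hsqrt : ∀ {a b : ℝ → ℝ}, Differentiable ℝ a → Continuous b →
      (∀ x, deriv a x = x * b x) → ∀ s ∈ Icc (0 : ℝ) 1, s ∈ Ioi (0 : ℝ) →
      HasDerivWithinAt (fun s => a √((1 - s ^ 2) / s ^ 2))
        (-b √((1 - s ^ 2) / s ^ 2) / s ^ 3) (Icc 0 1) s := by
    intro a b ha hb hab s hs hs0
    have := (hasDerivWithinAt_comp_sqrt ha hb hab (mapsTo_one_sub_sq_div_sq hs)).comp s
      (hu s hs hs0) mapsTo_one_sub_sq_div_sq
    exact this.congr_deriv (by ring)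
  refine And.elim (fun h1 h2 => ?_) (dIcc_eq_of_eqOn (s := s) isOpen_Ioi hφ
    (f' := fun s => h √((1 - s ^ 2) / s ^ 2) - q √((1 - s ^ 2) / s ^ 2) / s ^ 2)
    (f'' := fun s => q √((1 - s ^ 2) / s ^ 2) / s ^ 3 + r √((1 - s ^ 2) / s ^ 2) / s ^ 5)
    ?_ ?_ hs hs0)
  · have hconv' := hconv √((1 - s ^ 2) / s ^ 2)
    have hdd : ∀ x, deriv (deriv h) x = q x + x ^ 2 * r x := by
      intro x
      rw [funext hhq, ((hasDerivAt_id' x).fun_mul (hq1 x).hasDerivAt).deriv, hqr]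
      ring
    rw [hdd, Real.sq_sqrt (mapsTo_one_sub_sq_div_sq hs)] at hconv'
    have hqp := hqpos hconv √((1 - s ^ 2) / s ^ 2)
    rw [hφ s hs hs0, h1, h2]
    generalize q √((1 - s ^ 2) / s ^ 2) = Q at *
    generalize r √((1 - s ^ 2) / s ^ 2) = R at *
    constructor
    · have : 0 < Q / s := div_pos hqp hs0
      convert this using 1
      field_simp
      ring
    · have : 0 < (Q + (1 - s ^ 2) / s ^ 2 * R) / s ^ 3 := by positivity
      convert this using 1
      field_simp
      ring
  · intro s hs hs0
    have hs0' : s ≠ 0 := (mem_Ioi.1 hs0).ne'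
    refine ((hasDerivWithinAt_id s _).mul (hsqrt (contDiff_infty_iff_deriv.1 hh).1
      hq.continuous hhq s hs hs0)).congr_deriv ?_
    simp only [id]
    field_simp
    ring
  · intro s hs hs0
    have hs0' : s ≠ 0 := (mem_Ioi.1 hs0).ne'
    have h2 : HasDerivAt (fun s : ℝ => s ^ 2) (2 * s) s := by simpa using hasDerivAt_pow 2 s
    refine ((hsqrt (contDiff_infty_iff_deriv.1 hh).1 hq.continuous hhq s hs hs0).sub
      ((hsqrt hq1 hr.continuous hqr s hs hs0).div h2.hasDerivWithinAt
        (pow_ne_zero 2 hs0'))).congr_deriv ?_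
    field_simp
    ring

/-- The conclusion for a profile `φ` read off in the charts `h` (around `s = 1`) and `k`
(around `s = 0`). -/
theorem contDiffOn_and_pos_of_charts {φ h k : ℝ → ℝ} (hh : ContDiff ℝ ∞ h)
    (heven : ∀ x, h (-x) = h x) (hhconv : ∀ x, 0 < deriv (deriv h) x)
    (hk : ContDiff ℝ ∞ k) (hkconv : ∀ x, 0 < deriv (deriv k) x) (hφ0 : 0 < φ 0)
    (hφh : ∀ s ∈ Icc (0 : ℝ) 1, s ∈ Ioi (0 : ℝ) → φ s = s * h √((1 - s ^ 2) / s ^ 2))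
    (hφk : ∀ s ∈ Icc (0 : ℝ) 1, s ∈ Iio (1 : ℝ) → φ s = √(1 - s ^ 2) * k (s / √(1 - s ^ 2))) :
    ContDiffOn ℝ ∞ φ (Icc 0 1) ∧ ∀ s b : ℝ, 0 ≤ s → s ≤ b → b ≤ 1 →
      0 < φ s - s * dIcc φ s + (b ^ 2 - s ^ 2) * dIcc (dIcc φ) s := by
  constructor
  · intro s hs
    rcases hs.1.eq_or_lt with rfl | hs0
    · exact contDiffWithinAt_of_chart_zero hk hφk le_rfl one_pos
    · exact contDiffWithinAt_of_chart_one hh heven hφh hs0 hs.2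
  · intro s b hs0 hsb hb1
    have hs1 := hsb.trans hb1
    obtain ⟨h1, h2⟩ : 0 < φ s - s * dIcc φ s ∧
        0 < φ s - s * dIcc φ s + (1 - s ^ 2) * dIcc (dIcc φ) s := by
      rcases hs0.eq_or_lt with rfl | hs0
      · refine ⟨by simpa using hφ0, ?_⟩
        rw [dIcc_of_chart_zero hk hφk le_rfl one_pos]
        exact div_pos (hkconv _) (by simp)
      · exact dIcc_pos_of_chart_one hh heven hhconv hφh hs0 hs1
    have hb : 0 ≤ b ^ 2 - s ^ 2 := by nlinarith
    have hb' : 0 ≤ 1 - b ^ 2 := by nlinarith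
    rcases le_or_gt 0 (dIcc (dIcc φ) s) with hd | hd <;> nlinarith

/-- The restriction of a Minkowski norm to an affine line missing the origin is smooth. -/
theorem IsMinkowskiNorm.contDiff_line {E : Type*} [NormedAddCommGroup E] [NormedSpace ℝ E]
    {F : E → ℝ} (hF : IsMinkowskiNorm F) {p w : E} (hline : ∀ x : ℝ, p + x • w ≠ 0) :
    ContDiff ℝ ∞ fun x : ℝ => F (p + x • w) := by
  have := hF.2.2.1.comp (s := univ) (f := fun x : ℝ => p + x • w)
    (ContDiff.contDiffOn (by fun_prop)) fun x _ => hline x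
  exact contDiffOn_univ.1 this

/-- The restriction of a Minkowski norm to an affine line whose linear span is a plane has
positive second derivative. -/
theorem IsMinkowskiNorm.deriv_deriv_line_pos {E : Type*} [NormedAddCommGroup E]
    [NormedSpace ℝ E] {F : E → ℝ} (hF : IsMinkowskiNorm F) {p w : E}
    (hlin : ∀ a b : ℝ, a • p + b • w = 0 → a = 0 ∧ b = 0) (x : ℝ) (hx : 0 < F (p + x • w)) :
    0 < deriv (deriv fun x : ℝ => F (p + x • w)) x := by
  have hline : ∀ x : ℝ, p + x • w ≠ 0 := fun x h =>
    one_ne_zero (hlin 1 x (by rwa [one_smul])).1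
  have hd := contDiff_infty_iff_deriv.1 (hF.contDiff_line hline)
  have hd2 := contDiff_infty_iff_deriv.1 hd.2
  obtain ⟨-, -, hsmooth, hhom, hpos⟩ := hF
  set h : ℝ → ℝ := fun x => F (p + x • w) with hh
  set c : ℝ := -deriv h x / h x with hc
  set y : E := p + x • w with hy
  set v : E := w + c • y with hv
  have hv0 : v ≠ 0 := by
    intro h0
    have h1 : c • p + (1 + c * x) • w = 0 := by
      rw [← h0, hv, hy]
      module
    obtain ⟨h2, h3⟩ := hlin _ _ h1
    rw [h2] at h3
    simp at h3
  have hpos' := hpos y (hline x) v hv0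
  set Q : E → ℝ := fun z => F z ^ 2 with hQ
  have hQs : ContDiffOn ℝ ∞ Q {(0 : E)}ᶜ := hsmooth.pow 2
  have hQat : ∀ z : E, z ≠ 0 → ContDiffAt ℝ ∞ Q z := fun z hz =>
    hQs.contDiffAt (isOpen_compl_singleton.mem_nhds hz)
  have hl : ∀ t : ℝ, HasDerivAt (fun t : ℝ => y + t • v) v t := fun t => by
    simpa using ((hasDerivAt_id t).smul_const v).const_add y
  have hleft : HasDerivAt (fun t : ℝ => fderiv ℝ Q (y + t • v) v)
      (fderiv ℝ (fun z => fderiv ℝ Q z v) y v) 0 := by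
    have h1 : ContDiffAt ℝ 1 (fderiv ℝ Q) y := (hQat y (hline x)).fderiv_right (by norm_cast)
    have h2 : DifferentiableAt ℝ (fun z => fderiv ℝ Q z v) y :=
      (h1.differentiableAt one_ne_zero).clm_apply (differentiableAt_const v)
    have h3 : HasFDerivAt (fun z => fderiv ℝ Q z v) (fderiv ℝ (fun z => fderiv ℝ Q z v) y)
        (y + (0 : ℝ) • v) := by
      rw [zero_smul, add_zero]
      exact h2.hasFDerivAt
    exact h3.comp_hasDerivAt 0 (hl 0)
  have hτ : ∀ t : ℝ, 0 < 1 + c * t →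
      HasDerivAt (fun t => x + t / (1 + c * t)) (1 / (1 + c * t) ^ 2) t := by
    intro t ht
    have h1 : HasDerivAt (fun t => 1 + c * t) c t := by
      simpa using ((hasDerivAt_id t).const_mul c).const_add 1
    refine (((hasDerivAt_id' t).div h1 ht.ne').const_add x).congr_deriv ?_
    congr 1
    ring
  have hnear : ∀ᶠ t in 𝓝 (0 : ℝ), 0 < 1 + c * t := by
    have : Continuous fun t : ℝ => 1 + c * t := by fun_prop
    exact this.continuousAt.eventually_const_lt (by simp)
  have hline_eq : ∀ t : ℝ, 0 < 1 + c * t →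
      y + t • v = (1 + c * t) • (p + (x + t / (1 + c * t)) • w) := by
    intro t ht
    have : (1 + c * t) * (x + t / (1 + c * t)) = (1 + c * t) * x + t := by
      field_simp
    rw [smul_add (1 + c * t), smul_smul, this, hv, hy]
    module
  have hval : ∀ t : ℝ, 0 < 1 + c * t →
      Q (y + t • v) = ((1 + c * t) * h (x + t / (1 + c * t))) ^ 2 := by
    intro t ht
    rw [hline_eq t ht, hQ]
    simp only
    rw [hhom _ _ ht]
  have h1c : ∀ t : ℝ, HasDerivAt (fun t => 1 + c * t) c t := fun t => by
    simpa using ((hasDerivAt_id t).const_mul c).const_add 1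
  have hfirst : ∀ t : ℝ, 0 < 1 + c * t → fderiv ℝ Q (y + t • v) v =
      2 * (c * (1 + c * t) * h (x + t / (1 + c * t)) ^ 2 +
        h (x + t / (1 + c * t)) * deriv h (x + t / (1 + c * t))) := by
    intro t ht
    have hne : y + t • v ≠ 0 := by
      rw [hline_eq t ht]
      exact smul_ne_zero ht.ne' (hline _)
    have h1 : HasDerivAt (fun t : ℝ => Q (y + t • v)) (fderiv ℝ Q (y + t • v) v) t :=
      HasFDerivAt.comp_hasDerivAt (l := Q) t
        ((hQat _ hne).differentiableAt (by simp)).hasFDerivAt (hl t)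
    have h2 := (((h1c t).mul ((hd.1 _).hasDerivAt.comp t (hτ t ht))).pow 2)
    have hev : (fun t : ℝ => Q (y + t • v)) =ᶠ[𝓝 t]
        fun t => ((1 + c * t) * h (x + t / (1 + c * t))) ^ 2 := by
      have hcont : Continuous fun t : ℝ => 1 + c * t := by fun_prop
      filter_upwards [hcont.continuousAt.eventually_const_lt ht] with t ht using hval t ht
    rw [h1.unique (h2.congr_of_eventuallyEq hev)]
    simp only [Function.comp, Pi.mul_apply]
    field_simp
    ring
  have hτ0 := hτ 0 (by simp)
  have hright := (((h1c 0).const_mul c).mul (((hd.1 _).hasDerivAt.comp 0 hτ0).pow 2)).add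
    (((hd.1 _).hasDerivAt.comp 0 hτ0).mul ((hd2.1 _).hasDerivAt.comp 0 hτ0)) |>.const_mul 2
  have hev : (fun t : ℝ => fderiv ℝ Q (y + t • v) v) =ᶠ[𝓝 0] fun t =>
      2 * (c * (1 + c * t) * h (x + t / (1 + c * t)) ^ 2 +
        h (x + t / (1 + c * t)) * deriv h (x + t / (1 + c * t))) := by
    filter_upwards [hnear] with t ht using hfirst t ht
  rw [hleft.unique (hright.congr_of_eventuallyEq hev)] at hpos'
  have hx' : 0 < h x := hx
  have hch : c * h x = -deriv h x := div_mul_cancel₀ _ hx'.ne'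
  have hexp : 0 < c * c * h x ^ 2 + c * (2 * h x * deriv h x) +
      (deriv h x * deriv h x + h x * deriv (deriv h) x) := by
    simpa using hpos'
  have hfin : 0 < h x * deriv (deriv h) x := by
    have : (c * h x + deriv h x) ^ 2 = 0 := by rw [hch]; ring
    linarith
  exact (pos_iff_pos_of_mul_pos hfin).1 hx'

/-- The conclusion for a Minkowski norm whose restriction to a coordinate plane has the form
`√(a² + b²) φ(|b| / √(a² + b²))`. -/
theorem IsMinkowskiNorm.contDiffOn_and_pos_of_plane {E : Type*} [NormedAddCommGroup E]
    [NormedSpace ℝ E] {F : E → ℝ} (hF : IsMinkowskiNorm F) {p w : E}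
    (hlin : ∀ a b : ℝ, a • p + b • w = 0 → a = 0 ∧ b = 0) {φ : ℝ → ℝ}
    (hφ : ∀ s ∈ Icc (0 : ℝ) 1, 0 < φ s)
    (hplane : ∀ a b : ℝ, a ^ 2 + b ^ 2 ≠ 0 →
      F (a • p + b • w) = √(a ^ 2 + b ^ 2) * φ (|b| / √(a ^ 2 + b ^ 2))) :
    ContDiffOn ℝ ∞ φ (Icc 0 1) ∧ ∀ s b : ℝ, 0 ≤ s → s ≤ b → b ≤ 1 →
      0 < φ s - s * dIcc φ s + (b ^ 2 - s ^ 2) * dIcc (dIcc φ) s := by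
  have hlin' : ∀ a b : ℝ, a • w + b • p = 0 → a = 0 ∧ b = 0 := fun a b h =>
    (hlin b a (by rwa [add_comm])).symm
  have hpos : ∀ a b : ℝ, a ^ 2 + b ^ 2 ≠ 0 → 0 < F (a • p + b • w) := by
    intro a b hab
    have hab' : 0 < a ^ 2 + b ^ 2 := lt_of_le_of_ne (by positivity) hab.symm
    rw [hplane a b hab]
    refine mul_pos (Real.sqrt_pos.2 hab') (hφ _ ⟨by positivity, ?_⟩)
    exact div_le_one_of_le₀ (Real.abs_le_sqrt (by nlinarith)) (Real.sqrt_nonneg _)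
  have hh : ∀ x : ℝ, F (w + x • p) = √(x ^ 2 + 1) * φ (1 / √(x ^ 2 + 1)) := by
    intro x
    have := hplane x 1 (by positivity)
    rwa [one_smul, add_comm, abs_one, one_pow] at this
  have hk : ∀ x : ℝ, F (p + x • w) = √(1 + x ^ 2) * φ (|x| / √(1 + x ^ 2)) := by
    intro x
    have := hplane 1 x (by positivity)
    rwa [one_smul, one_pow] at this
  have hline : ∀ {p w : E}, (∀ a b : ℝ, a • p + b • w = 0 → a = 0 ∧ b = 0) →
      ∀ x : ℝ, p + x • w ≠ 0 := fun hl x h =>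
    one_ne_zero (hl 1 x (by rwa [one_smul])).1
  refine contDiffOn_and_pos_of_charts (h := fun x => F (w + x • p)) (k := fun x => F (p + x • w))
    (hF.contDiff_line (hline hlin')) ?_ (fun x => hF.deriv_deriv_line_pos hlin' x ?_)
    (hF.contDiff_line (hline hlin)) (fun x => hF.deriv_deriv_line_pos hlin x ?_)
    (hφ 0 (by simp)) ?_ ?_
  · intro x
    simp only [hh, neg_sq]
  · have := hpos x 1 (by positivity)
    rwa [one_smul, add_comm] at this
  · have := hpos 1 x (by positivity)
    rwa [one_smul] at this
  · intro s hs hs0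
    have hs0 : 0 < s := hs0
    have h1 : (1 - s ^ 2) / s ^ 2 + 1 = (1 / s) ^ 2 := by field_simp; ring
    simp only [hh]
    rw [Real.sq_sqrt (mapsTo_one_sub_sq_div_sq hs), h1, Real.sqrt_sq (by positivity), one_div_one_div]
    field_simp
  · intro s hs hs1
    have hs1 : s < 1 := hs1
    have hp : 0 < 1 - s ^ 2 := by nlinarith [hs.1]
    have hc := Real.sqrt_pos.2 hp
    have h1 : 1 + (s / √(1 - s ^ 2)) ^ 2 = (1 / √(1 - s ^ 2)) ^ 2 := by
      rw [div_pow, div_pow, Real.sq_sqrt hp.le]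
      field_simp
      ring
    simp only [hk]
    rw [h1, Real.sqrt_sq (by positivity), abs_of_nonneg (div_nonneg hs.1 hc.le)]
    field_simp

/-- With `n = n₁ + n₂`, `n₁ ≥ n₂ ≥ 2`, `α(y) = √(‖y₁‖² + ‖y₂‖²)`,
`α₂(y) = ‖y₂‖`, suppose `φ, ψ : [0,1] → ℝ` are positive with `φ(s) = ψ(√(1 - s²))`, and
`F(y) = α(y) φ(α₂(y)/α(y))` (for `y ≠ 0`, with `F(0) = 0`) is a Minkowski norm on `ℝⁿ`.
Then `φ` and `ψ` are smooth on `[0,1]` (one-sided derivatives at endpoints), and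
`φ(s) - s φ'(s) + (b² - s²) φ''(s) > 0` and likewise for `ψ`, for all `0 ≤ s ≤ b ≤ 1`. -/
theorem statement14 (n₁ n₂ : ℕ) (h21 : n₂ ≤ n₁) (h2 : 2 ≤ n₂)
    (φ ψ : ℝ → ℝ)
    (hφpos : ∀ s ∈ Set.Icc (0 : ℝ) 1, 0 < φ s)
    (hψpos : ∀ s ∈ Set.Icc (0 : ℝ) 1, 0 < ψ s)
    (hrel : ∀ s ∈ Set.Icc (0 : ℝ) 1, φ s = ψ (Real.sqrt (1 - s ^ 2)))
    (F : (Fin n₁ → ℝ) × (Fin n₂ → ℝ) → ℝ)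
    (hF0 : F 0 = 0)
    (hFy : ∀ y : (Fin n₁ → ℝ) × (Fin n₂ → ℝ), y ≠ 0 →
      F y = Real.sqrt (∑ i, y.1 i ^ 2 + ∑ i, y.2 i ^ 2) *
        φ (Real.sqrt (∑ i, y.2 i ^ 2) / Real.sqrt (∑ i, y.1 i ^ 2 + ∑ i, y.2 i ^ 2)))
    (hMink : IsMinkowskiNorm F) :
    ContDiffOn ℝ (⊤ : ℕ∞) φ (Set.Icc 0 1) ∧ ContDiffOn ℝ (⊤ : ℕ∞) ψ (Set.Icc 0 1) ∧
      ∀ s b : ℝ, 0 ≤ s → s ≤ b → b ≤ 1 →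
        (0 < φ s - s * dIcc φ s + (b ^ 2 - s ^ 2) * dIcc (dIcc φ) s ∧
         0 < ψ s - s * dIcc ψ s + (b ^ 2 - s ^ 2) * dIcc (dIcc ψ) s) := by
  have i₀ : Fin n₁ := ⟨0, by lia⟩
  have j₀ : Fin n₂ := ⟨0, by lia⟩
  set p : (Fin n₁ → ℝ) × (Fin n₂ → ℝ) := (Pi.single i₀ 1, 0) with hp
  set w : (Fin n₁ → ℝ) × (Fin n₂ → ℝ) := (0, Pi.single j₀ 1) with hw
  have hlin : ∀ a b : ℝ, a • p + b • w = 0 → a = 0 ∧ b = 0 := by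
    intro a b h
    have h1 := congrFun (congrArg Prod.fst h) i₀
    have h2 := congrFun (congrArg Prod.snd h) j₀
    simp [hp, hw] at h1 h2
    exact ⟨h1, h2⟩
  have hlin' : ∀ a b : ℝ, a • w + b • p = 0 → a = 0 ∧ b = 0 := fun a b h =>
    (hlin b a (by rwa [add_comm])).symm
  have hplane : ∀ a b : ℝ, a ^ 2 + b ^ 2 ≠ 0 →
      F (a • p + b • w) = √(a ^ 2 + b ^ 2) * φ (|b| / √(a ^ 2 + b ^ 2)) := by
    intro a b hab
    have hne : a • p + b • w ≠ 0 := fun h => hab (by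
      obtain ⟨rfl, rfl⟩ := hlin a b h
      simp)
    have h1 : ∑ i, (a • p + b • w).1 i ^ 2 = a ^ 2 := by
      rw [Finset.sum_eq_single i₀ (fun i _ hi => by simp [hp, hw, hi]) (by simp)]
      simp [hp, hw]
    have h2 : ∑ i, (a • p + b • w).2 i ^ 2 = b ^ 2 := by
      rw [Finset.sum_eq_single j₀ (fun i _ hi => by simp [hp, hw, hi]) (by simp)]
      simp [hp, hw]
    rw [hFy _ hne, h1, h2, Real.sqrt_sq_eq_abs]
  have hplane' : ∀ a b : ℝ, a ^ 2 + b ^ 2 ≠ 0 →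
      F (a • w + b • p) = √(a ^ 2 + b ^ 2) * ψ (|b| / √(a ^ 2 + b ^ 2)) := by
    intro a b hab
    have hab' : 0 < a ^ 2 + b ^ 2 := lt_of_le_of_ne (by positivity) hab.symm
    have hle : |a| / √(a ^ 2 + b ^ 2) ≤ 1 :=
      div_le_one_of_le₀ (Real.abs_le_sqrt (by nlinarith)) (Real.sqrt_nonneg _)
    have h1 : 1 - (|a| / √(a ^ 2 + b ^ 2)) ^ 2 = (|b| / √(a ^ 2 + b ^ 2)) ^ 2 := by
      rw [div_pow, div_pow, Real.sq_sqrt hab'.le, sq_abs, sq_abs]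
      field_simp
      ring
    rw [add_comm, hplane b a (by rwa [add_comm]), add_comm (b ^ 2),
      hrel _ ⟨by positivity, hle⟩, h1, Real.sqrt_sq (by positivity)]
  obtain ⟨hφ1, hφ2⟩ := hMink.contDiffOn_and_pos_of_plane hlin hφpos hplane
  obtain ⟨hψ1, hψ2⟩ := hMink.contDiffOn_and_pos_of_plane hlin' hψpos hplane'
  exact ⟨hφ1, hψ1, fun s b hs hsb hb => ⟨hφ2 s b hs hsb hb, hψ2 s b hs hsb hb⟩⟩
end

section
/- Fix integers n₁ ≥ n₂ ≥ 2 and set n = n₁ + n₂; write y = (y₁, y₂) ∈ ℝⁿ = ℝ^{n₁} × ℝ^{n₂}, α(y) = √(‖y₁‖² + ‖y₂‖²), α₁(y) = ‖y₁‖, α₂(y) = ‖y₂‖. Let φ, ψ : [0,1] → ℝ be positive functions, infinitely differentiable on the closed interval [0,1], with φ(s) = ψ(√(1−s²)) for all s ∈ [0,1], and suppose that φ(s) − sφ'(s) + (1−s²)φ''(s) > 0 for all s ∈ [0,1]. Then the function F : ℝⁿ → ℝ defined by F(0) = 0 and F(y) = α(y)·φ(α₂(y)/α(y)) for y ≠ 0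 (equivalently F(y) = α(y)·ψ(α₁(y)/α(y))) is a Minkowski norm on ℝⁿ. -/
open Set Filter Topology

namespace TwoBlockNorm

/-- A function on `[0, 1]` with `f(t) > 2 (e - t) f'(t)` for some fixed `e ∈ [0, 1]` is
positive, as seen at its minimum. -/
theorem pos_of_deriv_ineq {f f' : ℝ → ℝ} {e : ℝ} (he : e ∈ Icc (0 : ℝ) 1)
    (hf : ∀ t ∈ Icc (0 : ℝ) 1, HasDerivWithinAt f (f' t) (Icc 0 1) t)
    (hpos : ∀ t ∈ Icc (0 : ℝ) 1, 0 < f t - 2 * (e - t) * f' t) :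
    ∀ t ∈ Icc (0 : ℝ) 1, 0 < f t := by
  obtain ⟨m, hm, hmin⟩ := isCompact_Icc.exists_isMinOn (nonempty_Icc.2 zero_le_one)
    (fun t ht => (hf t ht).continuousWithinAt : ContinuousOn f (Icc 0 1))
  have h := hmin.localize.hasFDerivWithinAt_nonneg (hf m hm).hasFDerivWithinAt
    (sub_mem_posTangentConeAt_of_segment_subset ((convex_Icc (0 : ℝ) 1).segment_subset hm he))
  have h' : 0 ≤ (e - m) * f' m := by simpa using h
  intro t ht
  have := isMinOn_iff.1 hmin t ht
  linarith [hpos m hm]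

theorem hasDerivAt_comp_ratio {f : ℝ → ℝ} {f' : ℝ} {U V : ℝ → ℝ} {A B x : ℝ}
    (hU : HasDerivAt U (2 * A) x) (hV : HasDerivAt V (2 * B) x)
    (hU0 : ∀ x, 0 ≤ U x) (hV0 : ∀ x, 0 ≤ V x) (hr : 0 < U x + V x)
    (hf : HasDerivWithinAt f f' (Icc 0 1) (V x / (U x + V x))) :
    HasDerivAt (fun z => f (V z / (U z + V z)))
      (f' * ((2 * B * (U x + V x) - V x * (2 * A + 2 * B)) / (U x + V x) ^ 2)) x := by
  refine hf.comp_hasDerivAt x (hV.fun_div (hU.fun_add hV) hr.ne') (Eventually.of_forall fun z => ?_)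
  have := hU0 z
  have := hV0 z
  exact ⟨by positivity, div_le_one_of_le₀ (by linarith) (by positivity)⟩

/-- First derivative of `(U + V) g(V / (U + V))²` along a curve. -/
theorem hasDerivAt_sq {g : ℝ → ℝ} {g' : ℝ} {U V : ℝ → ℝ} {A B x : ℝ}
    (hU : HasDerivAt U (2 * A) x) (hV : HasDerivAt V (2 * B) x)
    (hU0 : ∀ x, 0 ≤ U x) (hV0 : ∀ x, 0 ≤ V x) (hr : 0 < U x + V x)
    (hg : HasDerivWithinAt g g' (Icc 0 1) (V x / (U x + V x))) :
    HasDerivAt (fun z => (U z + V z) * g (V z / (U z + V z)) ^ 2)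
      (2 * g (V x / (U x + V x)) *
        ((g (V x / (U x + V x)) - 2 * (V x / (U x + V x)) * g') * A +
          (g (V x / (U x + V x)) + 2 * (1 - V x / (U x + V x)) * g') * B)) x := by
  refine ((hU.fun_add hV).fun_mul
    ((hasDerivAt_comp_ratio hU hV hU0 hV0 hr hg).fun_pow 2)).congr_deriv ?_
  have := hr.ne'
  generalize g (V x / (U x + V x)) = G
  push_cast
  field_simp
  ring

/-- Second derivative of `(U + V) g(V / (U + V))²` along a curve. -/
theorem hasDerivAt_deriv_sq {g g₁ g₂ : ℝ → ℝ} {U V A B : ℝ → ℝ} {x W₁ W₂ : ℝ}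
    (hU : HasDerivAt U (2 * A x) x) (hV : HasDerivAt V (2 * B x) x)
    (hA : HasDerivAt A W₁ x) (hB : HasDerivAt B W₂ x)
    (hU0 : ∀ x, 0 ≤ U x) (hV0 : ∀ x, 0 ≤ V x) (hr : 0 < U x + V x)
    {t : ℝ} (ht : V x / (U x + V x) = t)
    (hg : HasDerivWithinAt g (g₁ t) (Icc 0 1) t)
    (hg₁ : HasDerivWithinAt g₁ (g₂ t) (Icc 0 1) t) :
    HasDerivAt (fun z => 2 * g (V z / (U z + V z)) *
        ((g (V z / (U z + V z)) - 2 * (V z / (U z + V z)) * g₁ (V z / (U z + V z))) * A z +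
          (g (V z / (U z + V z)) + 2 * (1 - V z / (U z + V z)) * g₁ (V z / (U z + V z))) * B z))
      (2 * (g t * ((g t - 2 * t * g₁ t) * W₁ + (g t + 2 * (1 - t) * g₁ t) * W₂) +
        4 * (g₁ t ^ 2 + g t * g₂ t) * (t * A x - (1 - t) * B x) ^ 2 / (U x + V x))) x := by
  subst ht
  have h := hasDerivAt_comp_ratio hU hV hU0 hV0 hr hg
  have h₁ := hasDerivAt_comp_ratio hU hV hU0 hV0 hr hg₁
  have hT := hV.fun_div (hU.fun_add hV) hr.ne'
  refine ((h.const_mul 2).fun_mul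
    (((h.fun_sub ((hT.const_mul 2).fun_mul h₁)).fun_mul hA).fun_add
      ((h.fun_add (((hT.const_sub 1).const_mul 2).fun_mul h₁)).fun_mul hB))).congr_deriv ?_
  have := hr.ne'
  generalize g (V x / (U x + V x)) = G
  generalize g₁ (V x / (U x + V x)) = G₁
  generalize g₂ (V x / (U x + V x)) = G₂
  field_simp
  ring

/-- Positivity of the Hessian quadratic form. -/
theorem form_pos {G G₁ G₂ t r A B W₁ W₂ : ℝ} (ht : t ∈ Icc (0 : ℝ) 1) (hr : 0 < r)
    (hG : 0 < G) (hp : 0 < G - 2 * t * G₁) (hq : 0 < G + 2 * (1 - t) * G₁)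
    (hC : 0 < G + 2 * (1 - 2 * t) * G₁ + 4 * t * (1 - t) * G₂)
    (hA : A ^ 2 ≤ r * (1 - t) * W₁) (hB : B ^ 2 ≤ r * t * W₂)
    (hW₁ : 0 ≤ W₁) (hW₂ : 0 ≤ W₂) (hW : 0 < W₁ + W₂) :
    0 < G * ((G - 2 * t * G₁) * W₁ + (G + 2 * (1 - t) * G₁) * W₂) +
        4 * (G₁ ^ 2 + G * G₂) * (t * A - (1 - t) * B) ^ 2 / r := by
  obtain ⟨ht0, ht1⟩ := ht
  have ht1' : 0 ≤ 1 - t := by linarith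
  obtain ⟨p, hpe⟩ : ∃ p, p = G - 2 * t * G₁ := ⟨_, rfl⟩
  obtain ⟨q, hqe⟩ : ∃ q, q = G + 2 * (1 - t) * G₁ := ⟨_, rfl⟩
  rw [← hpe] at hp ⊢
  rw [← hqe] at hq ⊢
  have hGe : G = (1 - t) * p + t * q := by rw [hpe, hqe]; ring
  have hS : 0 < p * W₁ + q * W₂ := by
    rcases hW₁.eq_or_lt with h | h
    · have : 0 < W₂ := by linarith
      positivity
    · positivity
  rcases le_or_gt 0 (G₁ ^ 2 + G * G₂) with hM | hM
  · positivity
  have key : p * q * (t * A - (1 - t) * B) ^ 2 ≤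
      r * t * (1 - t) * G * (p * W₁ + q * W₂) := by
    have h1 := mul_le_mul_of_nonneg_left hA (by positivity : 0 ≤ t * G * p)
    have h2 := mul_le_mul_of_nonneg_left hB (by positivity : 0 ≤ (1 - t) * G * q)
    have h3 : 0 ≤ t * (1 - t) * (p * A + q * B) ^ 2 := by positivity
    have h4 : t * G * p * A ^ 2 + (1 - t) * G * q * B ^ 2 -
        p * q * (t * A - (1 - t) * B) ^ 2 = t * (1 - t) * (p * A + q * B) ^ 2 := by
      rw [hGe]; ring
    linarith
  have hid : p * q + 4 * t * (1 - t) * (G₁ ^ 2 + G * G₂) =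
      G * (G + 2 * (1 - 2 * t) * G₁ + 4 * t * (1 - t) * G₂) := by
    rw [hpe, hqe]; ring
  have h5 := mul_le_mul_of_nonpos_left key (by linarith : 4 * (G₁ ^ 2 + G * G₂) ≤ 0)
  have h6 : 0 < r * (G * (p * W₁ + q * W₂)) *
      (G * (G + 2 * (1 - 2 * t) * G₁ + 4 * t * (1 - t) * G₂)) := by positivity
  rw [← hid] at h6
  have h7 : 0 < p * q * (r * (G * (p * W₁ + q * W₂)) +
      4 * (G₁ ^ 2 + G * G₂) * (t * A - (1 - t) * B) ^ 2) := by linarith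
  have h8 := pos_of_mul_pos_right h7 (by positivity)
  have h9 : G * (p * W₁ + q * W₂) + 4 * (G₁ ^ 2 + G * G₂) * (t * A - (1 - t) * B) ^ 2 / r =
      (r * (G * (p * W₁ + q * W₂)) +
      4 * (G₁ ^ 2 + G * G₂) * (t * A - (1 - t) * B) ^ 2) / r := by
    field_simp
  rw [h9]
  exact div_pos h8 hr

/-- The profile `φ` in the variable `t = s²` is smooth on the closed interval. -/
theorem contDiffOn_comp_sqrt {φ ψ : ℝ → ℝ}
    (hφ : ContDiffOn ℝ (⊤ : ℕ∞) φ (Icc 0 1)) (hψ : ContDiffOn ℝ (⊤ : ℕ∞) ψ (Icc 0 1))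
    (hrel : ∀ s ∈ Icc (0 : ℝ) 1, φ s = ψ (Real.sqrt (1 - s ^ 2))) :
    ContDiffOn ℝ (⊤ : ℕ∞) (fun t => φ (Real.sqrt t)) (Icc 0 1) := by
  have hsq : MapsTo Real.sqrt (Icc 0 1) (Icc 0 1) := fun t ht =>
    ⟨Real.sqrt_nonneg t, Real.sqrt_le_one.2 ht.2⟩
  intro t ht
  rcases ht.1.eq_or_lt with h0 | h0
  · have hsq' : MapsTo (fun t : ℝ => Real.sqrt (1 - t)) (Icc 0 1) (Icc 0 1) := fun t ht =>
      ⟨Real.sqrt_nonneg _, Real.sqrt_le_one.2 (by linarith [ht.1])⟩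
    have h : ContDiffWithinAt ℝ (⊤ : ℕ∞) (fun t => ψ (Real.sqrt (1 - t))) (Icc 0 1) t :=
      (hψ _ (hsq' ht)).comp t
        ((contDiff_const.sub contDiff_id).contDiffWithinAt.sqrt (by simp [← h0])) hsq'
    have he : ∀ t ∈ Icc (0 : ℝ) 1, φ (Real.sqrt t) = ψ (Real.sqrt (1 - t)) := fun t ht => by
      rw [hrel _ (hsq ht), Real.sq_sqrt ht.1]
    exact h.congr he (he t ht)
  · exact (hφ _ (hsq ht)).comp t (contDiff_id.contDiffWithinAt.sqrt h0.ne') hsq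

theorem hasDerivWithinAt_comp_sq {f : ℝ → ℝ} {f' s : ℝ}
    (hf : HasDerivWithinAt f f' (Icc 0 1) (s ^ 2)) :
    HasDerivWithinAt (fun s => f (s ^ 2)) (f' * (2 * s)) (Icc 0 1) s := by
  have h : HasDerivWithinAt (fun s : ℝ => s ^ 2) (2 * s) (Icc 0 1) s := by
    simpa using (hasDerivAt_pow 2 s).hasDerivWithinAt
  exact HasDerivWithinAt.comp (h := fun s : ℝ => s ^ 2) s hf h fun x hx =>
    ⟨by positivity, pow_le_one₀ hx.1 hx.2⟩

/-- The convexity expression in the variable `t = s²`. -/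
theorem convexity_expr_eq {φ g g₁ g₂ : ℝ → ℝ}
    (hφ : ∀ s ∈ Icc (0 : ℝ) 1, φ s = g (s ^ 2))
    (hg : ∀ t ∈ Icc (0 : ℝ) 1, HasDerivWithinAt g (g₁ t) (Icc 0 1) t)
    (hg₁ : ∀ t ∈ Icc (0 : ℝ) 1, HasDerivWithinAt g₁ (g₂ t) (Icc 0 1) t)
    {s : ℝ} (hs : s ∈ Icc (0 : ℝ) 1) :
    φ s - s * dIcc φ s + (1 - s ^ 2) * dIcc (dIcc φ) s =
      g (s ^ 2) + 2 * (1 - 2 * s ^ 2) * g₁ (s ^ 2) + 4 * s ^ 2 * (1 - s ^ 2) * g₂ (s ^ 2) := by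
  have hsq : ∀ s ∈ Icc (0 : ℝ) 1, s ^ 2 ∈ Icc (0 : ℝ) 1 := fun s hs =>
    ⟨by positivity, pow_le_one₀ hs.1 hs.2⟩
  have hu := uniqueDiffOn_Icc (zero_lt_one' ℝ)
  have h1 : ∀ s ∈ Icc (0 : ℝ) 1, dIcc φ s = g₁ (s ^ 2) * (2 * s) := fun s hs =>
    ((hasDerivWithinAt_comp_sq (hg _ (hsq s hs))).congr hφ (hφ s hs)).derivWithin (hu s hs)
  have h2 : HasDerivWithinAt (dIcc φ)
      (g₂ (s ^ 2) * (2 * s) * (2 * s) + g₁ (s ^ 2) * (2 * 1)) (Icc 0 1) s :=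
    ((hasDerivWithinAt_comp_sq (hg₁ _ (hsq s hs))).mul
      ((hasDerivWithinAt_id s _).const_mul 2)).congr h1 (h1 s hs)
  rw [show dIcc (dIcc φ) s = _ from h2.derivWithin (hu s hs), h1 s hs, hφ s hs]
  ring

theorem sum_sq_line {ι : Type*} [Fintype ι] (y v : ι → ℝ) (x : ℝ) :
    HasDerivAt (fun x : ℝ => ∑ i, (y i + x * v i) ^ 2) (2 * ∑ i, (y i + x * v i) * v i) x := by
  rw [Finset.mul_sum]
  refine HasDerivAt.fun_sum fun i _ => ?_
  refine ((((hasDerivAt_id' x).mul_const (v i)).const_add (y i)).fun_pow 2).congr_deriv ?_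
  simp
  ring

theorem sum_mul_line {ι : Type*} [Fintype ι] (y v : ι → ℝ) (x : ℝ) :
    HasDerivAt (fun x : ℝ => ∑ i, (y i + x * v i) * v i) (∑ i, v i ^ 2) x := by
  refine HasDerivAt.fun_sum fun i _ => ?_
  refine ((((hasDerivAt_id' x).mul_const (v i)).const_add (y i)).mul_const (v i)).congr_deriv ?_
  ring

theorem sum_sq_add_pos {ι κ : Type*} [Fintype ι] [Fintype κ] {y : (ι → ℝ) × (κ → ℝ)}
    (hy : y ≠ 0) : 0 < ∑ i, y.1 i ^ 2 + ∑ i, y.2 i ^ 2 := by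
  have h1 : 0 ≤ ∑ i, y.1 i ^ 2 := by positivity
  have h2 : 0 ≤ ∑ i, y.2 i ^ 2 := by positivity
  refine lt_of_le_of_ne (by positivity) fun h => hy ?_
  have e1 : ∑ i, y.1 i ^ 2 = 0 := by linarith
  have e2 : ∑ i, y.2 i ^ 2 = 0 := by linarith
  rw [Finset.sum_eq_zero_iff_of_nonneg fun i _ => sq_nonneg _] at e1 e2
  ext i
  · simpa using e1 i (Finset.mem_univ i)
  · simpa using e2 i (Finset.mem_univ i)

end TwoBlockNorm

open TwoBlockNorm in
/-- With `n = n₁ + n₂`, `n₁ ≥ n₂ ≥ 2`, suppose `φ, ψ : [0,1] → ℝ` are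
positive, smooth on the closed interval `[0,1]`, satisfy `φ(s) = ψ(√(1 - s²))` and
`φ(s) - s φ'(s) + (1 - s²) φ''(s) > 0` on `[0,1]`. Then `F(y) = α(y) φ(α₂(y)/α(y))`
(for `y ≠ 0`, with `F(0) = 0`) is a Minkowski norm on `ℝⁿ`. -/
theorem statement15 (n₁ n₂ : ℕ) (h21 : n₂ ≤ n₁) (h2 : 2 ≤ n₂)
    (φ ψ : ℝ → ℝ)
    (hφpos : ∀ s ∈ Set.Icc (0 : ℝ) 1, 0 < φ s)
    (hψpos : ∀ s ∈ Set.Icc (0 : ℝ) 1, 0 < ψ s)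
    (hφsmooth : ContDiffOn ℝ (⊤ : ℕ∞) φ (Set.Icc 0 1))
    (hψsmooth : ContDiffOn ℝ (⊤ : ℕ∞) ψ (Set.Icc 0 1))
    (hrel : ∀ s ∈ Set.Icc (0 : ℝ) 1, φ s = ψ (Real.sqrt (1 - s ^ 2)))
    (hconv : ∀ s ∈ Set.Icc (0 : ℝ) 1,
      0 < φ s - s * dIcc φ s + (1 - s ^ 2) * dIcc (dIcc φ) s)
    (F : (Fin n₁ → ℝ) × (Fin n₂ → ℝ) → ℝ)
    (hF0 : F 0 = 0)
    (hFy : ∀ y : (Fin n₁ → ℝ) × (Fin n₂ → ℝ), y ≠ 0 →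
      F y = Real.sqrt (∑ i, y.1 i ^ 2 + ∑ i, y.2 i ^ 2) *
        φ (Real.sqrt (∑ i, y.2 i ^ 2) / Real.sqrt (∑ i, y.1 i ^ 2 + ∑ i, y.2 i ^ 2))) :
    IsMinkowskiNorm F := by
  set g : ℝ → ℝ := fun t => φ (Real.sqrt t) with hgdef
  set g₁ := derivWithin g (Icc 0 1)
  set g₂ := derivWithin g₁ (Icc 0 1)
  have hu := uniqueDiffOn_Icc (zero_lt_one' ℝ)
  have hgs : ContDiffOn ℝ (⊤ : ℕ∞) g (Icc 0 1) := contDiffOn_comp_sqrt hφsmooth hψsmooth hrel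
  have hgs' := (contDiffOn_infty_iff_derivWithin hu).1 hgs
  have hgs'' := (contDiffOn_infty_iff_derivWithin hu).1 hgs'.2
  have hg : ∀ t ∈ Icc (0 : ℝ) 1, HasDerivWithinAt g (g₁ t) (Icc 0 1) t := fun t ht =>
    (hgs'.1 t ht).hasDerivWithinAt
  have hg₁ : ∀ t ∈ Icc (0 : ℝ) 1, HasDerivWithinAt g₁ (g₂ t) (Icc 0 1) t := fun t ht =>
    (hgs''.1 t ht).hasDerivWithinAt
  have hsqrt : ∀ t ∈ Icc (0 : ℝ) 1, Real.sqrt t ∈ Icc (0 : ℝ) 1 := fun t ht =>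
    ⟨Real.sqrt_nonneg t, Real.sqrt_le_one.2 ht.2⟩
  have hgpos : ∀ t ∈ Icc (0 : ℝ) 1, 0 < g t := fun t ht => hφpos _ (hsqrt t ht)
  have hC : ∀ t ∈ Icc (0 : ℝ) 1,
      0 < g t + 2 * (1 - 2 * t) * g₁ t + 4 * t * (1 - t) * g₂ t := fun t ht => by
    have h := hconv _ (hsqrt t ht)
    rwa [convexity_expr_eq (fun s hs => by simp [hgdef, Real.sqrt_sq hs.1]) hg hg₁ (hsqrt t ht),
      Real.sq_sqrt ht.1] at h
  have hp : ∀ t ∈ Icc (0 : ℝ) 1, 0 < g t - 2 * t * g₁ t :=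
    pos_of_deriv_ineq (right_mem_Icc.2 zero_le_one)
      (fun t ht => (hg t ht).fun_sub
        (((hasDerivWithinAt_id t _).const_mul 2).fun_mul (hg₁ t ht)))
      (fun t ht => by have := hC t ht; simp only [id]; linarith)
  have hq : ∀ t ∈ Icc (0 : ℝ) 1, 0 < g t + 2 * (1 - t) * g₁ t :=
    pos_of_deriv_ineq (left_mem_Icc.2 zero_le_one)
      (fun t ht => (hg t ht).fun_add
        ((((hasDerivWithinAt_id t _).const_sub 1).const_mul 2).fun_mul (hg₁ t ht)))
      (fun t ht => by have := hC t ht; simp only [id]; linarith)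
  have hN1 : ∀ y : (Fin n₁ → ℝ) × (Fin n₂ → ℝ), 0 ≤ ∑ i, y.1 i ^ 2 := fun y => by positivity
  have hN2 : ∀ y : (Fin n₁ → ℝ) × (Fin n₂ → ℝ), 0 ≤ ∑ i, y.2 i ^ 2 := fun y => by positivity
  have hT : ∀ y : (Fin n₁ → ℝ) × (Fin n₂ → ℝ),
      (∑ i, y.2 i ^ 2) / (∑ i, y.1 i ^ 2 + ∑ i, y.2 i ^ 2) ∈ Icc (0 : ℝ) 1 := fun y => by
    have := hN1 y
    have := hN2 y
    exact ⟨by positivity, div_le_one_of_le₀ (by linarith) (by positivity)⟩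
  have hFg : ∀ y : (Fin n₁ → ℝ) × (Fin n₂ → ℝ),
      F y = Real.sqrt (∑ i, y.1 i ^ 2 + ∑ i, y.2 i ^ 2) *
        g ((∑ i, y.2 i ^ 2) / (∑ i, y.1 i ^ 2 + ∑ i, y.2 i ^ 2)) := fun y => by
    rcases eq_or_ne y 0 with rfl | hy
    · simp [hF0]
    · rw [hFy y hy, hgdef]
      simp only [Real.sqrt_div (hN2 y)]
  have hF2 : ∀ y : (Fin n₁ → ℝ) × (Fin n₂ → ℝ),
      F y ^ 2 = (∑ i, y.1 i ^ 2 + ∑ i, y.2 i ^ 2) *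
        g ((∑ i, y.2 i ^ 2) / (∑ i, y.1 i ^ 2 + ∑ i, y.2 i ^ 2)) ^ 2 := fun y => by
    rw [hFg y, mul_pow, Real.sq_sqrt (add_nonneg (hN1 y) (hN2 y))]
  have hcN2 : ContDiff ℝ (⊤ : ℕ∞) (fun y : (Fin n₁ → ℝ) × (Fin n₂ → ℝ) => ∑ i, y.2 i ^ 2) := by
    fun_prop
  have hcR : ContDiff ℝ (⊤ : ℕ∞) (fun y : (Fin n₁ → ℝ) × (Fin n₂ → ℝ) =>
      ∑ i, y.1 i ^ 2 + ∑ i, y.2 i ^ 2) := by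
    fun_prop
  have hsmooth : ContDiffOn ℝ (⊤ : ℕ∞) F {(0 : (Fin n₁ → ℝ) × (Fin n₂ → ℝ))}ᶜ := by
    have hne : ∀ y ∈ ({(0 : (Fin n₁ → ℝ) × (Fin n₂ → ℝ))}ᶜ : Set _),
      ∑ i, y.1 i ^ 2 + ∑ i, y.2 i ^ 2 ≠ 0 := fun y hy => (sum_sq_add_pos hy).ne'
    exact ((hcR.contDiffOn.sqrt hne).mul
      (hgs.comp (hcN2.contDiffOn.div hcR.contDiffOn hne) fun y _ => hT y)).congr fun y _ => hFg y
  refine ⟨?_, ?_, hsmooth, ?_, ?_⟩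
  · refine continuous_iff_continuousAt.2 fun y => ?_
    rcases eq_or_ne y 0 with rfl | hy
    · obtain ⟨C, hCb⟩ := isCompact_Icc.exists_bound_of_continuousOn hgs.continuousOn
      have hlim : Tendsto (fun y : (Fin n₁ → ℝ) × (Fin n₂ → ℝ) =>
          Real.sqrt (∑ i, y.1 i ^ 2 + ∑ i, y.2 i ^ 2) * C) (𝓝 0) (𝓝 0) := by
        have h := (hcR.continuous.sqrt.mul_const C).tendsto 0
        simpa using h
      rw [ContinuousAt, hF0]
      refine squeeze_zero_norm (fun y => ?_) hlim
      rw [hFg y, norm_mul, Real.norm_of_nonneg (Real.sqrt_nonneg _)]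
      exact mul_le_mul_of_nonneg_left (hCb _ (hT y)) (Real.sqrt_nonneg _)
    · exact hsmooth.continuousOn.continuousAt (isOpen_compl_singleton.mem_nhds hy)
  · intro y
    rw [hFg y]
    exact mul_nonneg (Real.sqrt_nonneg _) (hgpos _ (hT y)).le
  · intro c y hc
    have h1 : ∑ i, (c • y).1 i ^ 2 = c ^ 2 * ∑ i, y.1 i ^ 2 := by
      simp [mul_pow, Finset.mul_sum]
    have h2 : ∑ i, (c • y).2 i ^ 2 = c ^ 2 * ∑ i, y.2 i ^ 2 := by
      simp [mul_pow, Finset.mul_sum]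
    rw [hFg, hFg, h1, h2, ← mul_add, mul_div_mul_left _ _ (pow_ne_zero 2 hc.ne'),
      Real.sqrt_mul (by positivity), Real.sqrt_sq hc.le, mul_assoc]
  · intro y hy v hv
    have hK : ContDiffOn ℝ (⊤ : ℕ∞) (fun w => F w ^ 2) {(0 : (Fin n₁ → ℝ) × (Fin n₂ → ℝ))}ᶜ :=
      hsmooth.pow 2
    have hd : ∀ z ≠ 0, HasFDerivAt (fun w => F w ^ 2) (fderiv ℝ (fun w => F w ^ 2) z) z :=
      fun z hz => ((hK.contDiffAt (isOpen_compl_singleton.mem_nhds hz)).differentiableAt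
        (by simp)).hasFDerivAt
    have hd2 : DifferentiableAt ℝ (fun z => fderiv ℝ (fun w => F w ^ 2) z v) y := by
      have h := (hK.contDiffAt (isOpen_compl_singleton.mem_nhds hy)).fderiv_right (m := 1)
        (by norm_cast)
      exact (h.differentiableAt one_ne_zero).clm_apply (differentiableAt_const v)
    have hline : ∀ x : ℝ, HasDerivAt (fun x : ℝ => y + x • v) v x := fun x => by
      simpa using ((hasDerivAt_id x).smul_const v).const_add y
    have hU0 : ∀ x : ℝ, 0 ≤ ∑ i, (y.1 i + x * v.1 i) ^ 2 := fun x => by positivity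
    have hV0 : ∀ x : ℝ, 0 ≤ ∑ i, (y.2 i + x * v.2 i) ^ 2 := fun x => by positivity
    have hU := sum_sq_line y.1 v.1
    have hV := sum_sq_line y.2 v.2
    have hne : ∀ᶠ x : ℝ in 𝓝 0, y + x • v ≠ 0 :=
      (hline 0).continuousAt.eventually_ne (by simpa using hy)
    have hr := sum_sq_add_pos hy
    have hsecond := hasDerivAt_deriv_sq (g := g) (g₁ := g₁) (g₂ := g₂) (hU 0) (hV 0)
      (sum_mul_line y.1 v.1 0) (sum_mul_line y.2 v.2 0) hU0 hV0 (by simpa using hr) rfl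
      (hg _ (by simpa using hT y)) (hg₁ _ (by simpa using hT y))
    have hd2' : HasFDerivAt (fun z => fderiv ℝ (fun w => F w ^ 2) z v)
      (fderiv ℝ (fun z => fderiv ℝ (fun w => F w ^ 2) z v) y) (y + (0 : ℝ) • v) := by
      simpa using hd2.hasFDerivAt
    have heq := (hd2'.comp_hasDerivAt 0 (hline 0)).unique (hsecond.congr_of_eventuallyEq (by
      filter_upwards [hne] with x hx
      have h1 := (hd _ hx).comp_hasDerivAt x (hline x)
      have hr : 0 < ∑ i, (y.1 i + x * v.1 i) ^ 2 + ∑ i, (y.2 i + x * v.2 i) ^ 2 := by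
        simpa using sum_sq_add_pos hx
      have ht := hT (y + x • v)
      have h2 := hasDerivAt_sq (hU x) (hV x) hU0 hV0 hr (hg _ (by simpa using ht))
      refine h1.unique (h2.congr_of_eventuallyEq (Eventually.of_forall fun z => ?_))
      simp [hF2]))
    rw [heq]
    simp only [zero_mul, add_zero]
    have hpos := form_pos (hT y) hr (hgpos _ (hT y)) (hp _ (hT y)) (hq _ (hT y)) (hC _ (hT y))
      (A := ∑ i, y.1 i * v.1 i) (B := ∑ i, y.2 i * v.2 i)
      (W₁ := ∑ i, v.1 i ^ 2) (W₂ := ∑ i, v.2 i ^ 2)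
      (by
        rw [mul_one_sub, mul_div_cancel₀ _ hr.ne', add_sub_cancel_right]
        exact Finset.sum_mul_sq_le_sq_mul_sq _ _ _)
      (by
        rw [mul_div_cancel₀ _ hr.ne']
        exact Finset.sum_mul_sq_le_sq_mul_sq _ _ _)
      (hN1 v) (hN2 v) (sum_sq_add_pos hv)
    linarith
end
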